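/- Let m ≥ 1. Assume F contains a primitive p-th root of unity, and if p = 2 and n = 1 assume additionally that -1 ∈ N_{K/F}(K^×). Then there exist a vector a = (a_0,…,a_{m-1}) ∈ {-∞,0,1,…,n}^m, an integer d ∈ U_1, and cardinals e(i,m) for 0 ≤ i ≤ n such that, as R_m[G]-modules, J_m ≅ X_{a,d,m} ⊕ (⊕_{i=0}^{n} Y_i), where X_{a,d,m} is an indecomposable R_m[G]-module, each Y_i is a free R_m[G_i]-module of rank e(i,m), and the cardinal equations e(i,m) + |{0 ≤ j < m : a_j = i}| = e_i(K/F) hold for every 0 ≤ i < n, together with e(n,m) + 1 + |{0 ≤ j < m : a_j = n}| = e_n(K/F). -/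

import Mathlib

/-!
Common setup.  Throughout, `K/F` is a cyclic Galois extension of degree `p^n`
with Galois group `G = Gal(K/F)` generated by `σ`.  For `0 ≤ i ≤ n`, `K_i`
denotes the intermediate field of degree `p^i` over `F`, realized here via its
unit group `KiU p σ i` (the units of `K` fixed by `σ^{p^i}`), and
`G_i = Gal(K_i/F)`.  For `m ≥ 1`, `R_m = ℤ/p^m` and `J_m = K^×/K^{×p^m}`.
-/

namespace MSS

variable {F K : Type*} [Field F] [Field K] [Algebra F K]

/-- Action of a field automorphism on the unit group. -/
def umap (σ : K ≃ₐ[F] K) : Kˣ →* Kˣ := Units.map (σ : K →* K)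

/-- The norm from `K_j` to `F`, computed in `K` as the product of conjugates
`∏_{k < p^j} σ^k(γ)` (valid for `γ ∈ K_j`). -/
noncomputable def normHom (p : ℕ) (σ : K ≃ₐ[F] K) (j : ℕ) : Kˣ →* Kˣ :=
  ∏ k ∈ Finset.range (p ^ j), umap (σ ^ k)

/-- The unit group of the intermediate field `K_i`: the units fixed by `σ^{p^i}`. -/
def KiU (p : ℕ) (σ : K ≃ₐ[F] K) (i : ℕ) : Subgroup Kˣ :=
  (umap (σ ^ p ^ i) / MonoidHom.id Kˣ).ker

/-- Membership in `K_a^×` for a level `a ∈ {-∞, 0, 1, …}`; level `-∞` means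
the trivial group `{1}`. -/
def levelMem (p : ℕ) (σ : K ≃ₐ[F] K) (a : WithBot ℕ) (γ : Kˣ) : Prop :=
  WithBot.recBotCoe (γ = 1) (fun i => γ ∈ KiU p σ i) a

/-- `(α, δ)` represents the pair `(a, d)`:  `σ(α)·α^{-d} = ∏_{i=0}^m δ_i^{p^i}` with
`δ_i ∈ K_{a_i}^×` for `i < m`, and
`ξ_p = N_{K/F}(α)^{(d-1)/p} · N_{K_{n-1}/F}(δ_0) · ∏_{i=1}^m N_{K/F}(δ_i)^{p^{i-1}}`. -/
noncomputable def Represents (p n : ℕ) (σ : K ≃ₐ[F] K) (ξ : Kˣ) {m : ℕ}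
    (a : Fin m → WithBot ℕ) (d : ℤ) (α : Kˣ) (δ : ℕ → Kˣ) : Prop :=
  (∀ i : Fin m, levelMem p σ (a i) (δ i)) ∧
  umap σ α = α ^ d * ∏ i ∈ Finset.range (m + 1), δ i ^ p ^ i ∧
  ξ = normHom p σ n α ^ ((d - 1) / (p : ℤ)) * normHom p σ (n - 1) (δ 0) *
      ∏ i ∈ Finset.Icc 1 m, normHom p σ n (δ i) ^ p ^ (i - 1)

/-- `(a, d)` is a norm pair of length `m`: `a ∈ {-∞,0,…,n}^m` with `a_0 < n`,
`d ∈ U_1`, and some `(α, δ)` represents `(a, d)`. -/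
noncomputable def IsNormPair (p n : ℕ) (σ : K ≃ₐ[F] K) (ξ : Kˣ) {m : ℕ}
    (a : Fin m → WithBot ℕ) (d : ℤ) : Prop :=
  (∀ i, a i ≤ (n : WithBot ℕ)) ∧
  (∀ h0 : 0 < m, a ⟨0, h0⟩ < (n : WithBot ℕ)) ∧
  (p : ℤ) ∣ d - 1 ∧
  ∃ (α : Kˣ) (δ : ℕ → Kˣ), Represents p n σ ξ a d α δ

/-- Strict lexicographic order on norm vectors (with `-∞` smallest). -/
def vecLT {m : ℕ} (a a' : Fin m → WithBot ℕ) : Prop :=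
  ∃ k : Fin m, (∀ j : Fin m, j < k → a j = a' j) ∧ a k < a' k

/-- The order `d ≤_m d'` on twists: `d' ∈ U_i → d ∈ U_i` for `1 ≤ i ≤ m`, except
when `p = 2` and `d, d' ∉ U_2`, in which case `d' ∈ -U_i → d ∈ -U_i` for `2 ≤ i ≤ m`. -/
def twistLE (p m : ℕ) (d d' : ℤ) : Prop :=
  ((p = 2 ∧ ¬ (4 : ℤ) ∣ (d - 1) ∧ ¬ (4 : ℤ) ∣ (d' - 1)) →
    ∀ i : ℕ, 2 ≤ i → i ≤ m → ((2 : ℤ) ^ i ∣ (d' + 1)) → ((2 : ℤ) ^ i ∣ (d + 1))) ∧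
  (¬ (p = 2 ∧ ¬ (4 : ℤ) ∣ (d - 1) ∧ ¬ (4 : ℤ) ∣ (d' - 1)) →
    ∀ i : ℕ, 1 ≤ i → i ≤ m → ((p : ℤ) ^ i ∣ (d' - 1)) → ((p : ℤ) ^ i ∣ (d - 1)))

/-- The order `⪯_m` on norm pairs of length `m`. -/
def pairLE (p : ℕ) {m : ℕ} (a : Fin m → WithBot ℕ) (d : ℤ)
    (a' : Fin m → WithBot ℕ) (d' : ℤ) : Prop :=
  vecLT a a' ∨ (a = a' ∧ twistLE p m d d')

/-- `(a, d)` is a minimal norm pair of length `m`. -/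
noncomputable def IsMinimalNormPair (p n : ℕ) (σ : K ≃ₐ[F] K) (ξ : Kˣ) {m : ℕ}
    (a : Fin m → WithBot ℕ) (d : ℤ) : Prop :=
  IsNormPair p n σ ξ a d ∧
  ∀ (a' : Fin m → WithBot ℕ) (d' : ℤ), IsNormPair p n σ ξ a' d' → pairLE p a d a' d'

/-- `α` is an `m`-exceptional element. -/
noncomputable def IsExceptional (p n : ℕ) (σ : K ≃ₐ[F] K) (ξ : Kˣ) (m : ℕ) (α : Kˣ) : Prop :=
  ∃ (a : Fin m → WithBot ℕ) (d : ℤ) (δ : ℕ → Kˣ),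
    IsMinimalNormPair p n σ ξ a d ∧ Represents p n σ ξ a d α δ

/-- The subgroup of `q`-th powers in `K^×`. -/
def powSub (K : Type*) [Field K] (q : ℕ) : Subgroup Kˣ := (powMonoidHom q : Kˣ →* Kˣ).range

/-- The class of a unit in `J_q := K^×/K^{×q}`. -/
def jcls (q : ℕ) (γ : Kˣ) : Kˣ ⧸ powSub K q := QuotientGroup.mk γ

/-- The action of a field automorphism on `J_q = K^×/K^{×q}`. -/
noncomputable def jmap (q : ℕ) (τ : K ≃ₐ[F] K) : (Kˣ ⧸ powSub K q) →* Kˣ ⧸ powSub K q :=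
  QuotientGroup.map _ _ (umap τ) (by
    rintro x ⟨y, rfl⟩
    exact ⟨umap τ y, by simp [powMonoidHom, map_pow]⟩)

/-- The natural map `J_q → J_{q'}` when `q' ∣ q`. -/
noncomputable def resMap (q q' : ℕ) (h : q' ∣ q) : (Kˣ ⧸ powSub K q) →* Kˣ ⧸ powSub K q' :=
  QuotientGroup.map _ _ (MonoidHom.id Kˣ) (by
    rintro x ⟨y, rfl⟩
    obtain ⟨c, rfl⟩ := h
    exact ⟨y ^ c, by simp [powMonoidHom, ← pow_mul, mul_comm]⟩)

/-- The `R_m[G]`-submodule of `J_q` generated by the classes of the elements of `S`: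
the subgroup generated by all `σ^k`-conjugates of classes of elements of `S`. -/
noncomputable def galSpan (q : ℕ) (σ : K ≃ₐ[F] K) (S : Set Kˣ) : Subgroup (Kˣ ⧸ powSub K q) :=
  Subgroup.closure {x | ∃ γ ∈ S, ∃ k : ℕ, x = jcls q (umap (σ ^ k) γ)}

/-- The subgroup `(σ-1)J_q` of `J_q`. -/
noncomputable def augSub (q : ℕ) (σ : K ≃ₐ[F] K) : Subgroup (Kˣ ⧸ powSub K q) :=
  Subgroup.closure {x | ∃ y : Kˣ ⧸ powSub K q, x = jmap q σ y * y⁻¹}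

/-- The cyclic `F_p[G]`-submodule of `J_1 = K^×/K^{×p}` generated by `[γ]_1` is a
free `F_p[G_i]`-module (on the generator `[γ]_1`): `[γ]_1` is fixed by `σ^{p^i}`
and the conjugates `σ^k [γ]_1`, `k < p^i`, are `F_p`-linearly independent. -/
noncomputable def FreeCyc (p : ℕ) (σ : K ≃ₐ[F] K) (i : ℕ) (γ : Kˣ) : Prop :=
  jcls p (umap (σ ^ p ^ i) γ) = jcls p γ ∧
  ∀ c : Fin (p ^ i) → ZMod p,
    (∏ k : Fin (p ^ i), jcls p (umap (σ ^ (k : ℕ)) γ) ^ (c k).val) = 1 → c = 0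

/-- An (indexed) internal direct sum decomposition of a commutative group. -/
def IsDirectSumDecomp {G : Type*} [CommGroup G] {ι : Sort*} (f : ι → Subgroup G) : Prop :=
  iSupIndep f ∧ (⨆ i, f i) = ⊤

/-- The subgroup `F^×` of `K^×` (units coming from the base field). -/
def Funits (F : Type*) {K : Type*} [Field F] [Field K] [Algebra F K] : Subgroup Kˣ :=
  (Units.map (algebraMap F K : F →* K)).range

/-- The subgroup `F^{×p}` of `K^×`. -/
def FpPow (F : Type*) {K : Type*} [Field F] [Field K] [Algebra F K] (p : ℕ) : Subgroup Kˣ :=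
  (Funits F).map (powMonoidHom p)

/-- The subgroup `N_{K_i/F}(K_i^×)` of `K^×`. -/
noncomputable def NormSub (p : ℕ) (σ : K ≃ₐ[F] K) (i : ℕ) : Subgroup Kˣ :=
  (KiU p σ i).map (normHom p σ i)

/-- The subgroup `N_{K_i/F}(K_i^×)·F^{×p}` of `K^×`. -/
noncomputable def NiF (p : ℕ) (σ : K ≃ₐ[F] K) (i : ℕ) : Subgroup Kˣ :=
  NormSub p σ i ⊔ FpPow F p

/-- The `F_p`-dimension of an (elementary abelian `p`-) commutative group `Q`,
computed as the rank of `F_p ⊗_ℤ Q`. -/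
noncomputable def fpdim (p : ℕ) (Q : Type*) [CommGroup Q] : Cardinal :=
  Module.rank (ZMod p) (TensorProduct ℤ (ZMod p) (Additive Q))

/-- The invariant `e_i(K/F)`: for `i < n` the `F_p`-dimension of
`N_{K_i/F}(K_i^×)F^{×p} / N_{K_{i+1}/F}(K_{i+1}^×)F^{×p}`, and for `i = n` the
`F_p`-dimension of `N_{K/F}(K^×)F^{×p}/F^{×p}`. -/
noncomputable def eKF (p n : ℕ) (σ : K ≃ₐ[F] K) (i : ℕ) : Cardinal :=
  if i < n then
    fpdim p ((NiF p σ i) ⧸ (NiF p σ (i + 1)).subgroupOf (NiF p σ i))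
  else
    fpdim p ((NiF p σ n) ⧸ (FpPow F p).subgroupOf (NiF p σ n))

/-- The group ring `R_m[G_i] = (ℤ/p^m)[ℤ/p^i]` (for the cyclic group `G_i` of order
`p^i`). -/
abbrev CycGR (p m i : ℕ) : Type :=
  MonoidAlgebra (ZMod (p ^ m)) (Multiplicative (ZMod (p ^ i)))

/-- The image of the generator `σ` of `G_i` in the group ring `R_m[G_i]`. -/
noncomputable def gen (p m i : ℕ) : CycGR p m i :=
  MonoidAlgebra.of _ _ (Multiplicative.ofAdd (1 : ZMod (p ^ i)))

/-- Standard basis vector of the free `R_m[G]`-module on generators `e_0, …, e_m`. -/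
noncomputable def sing (p n m : ℕ) (j : Fin (m + 1)) (c : CycGR p m n) :
    Fin (m + 1) → CycGR p m n :=
  Pi.single j c

/-- The relations defining the module `X_{a,d,m}`: on generators `y = e_0` and
`x_i = e_{i+1}` (`0 ≤ i < m`), we impose `(σ - d)·y = Σ_i p^i x_i`, and
`(σ^{p^{a_i}} - 1)·x_i = 0` when `a_i ≠ -∞`, resp. `x_i = 0` when `a_i = -∞`. -/
noncomputable def XRels (p n m : ℕ) (a : Fin m → WithBot ℕ) (d : ℤ) :
    Set (Fin (m + 1) → CycGR p m n) :=
  insert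
    (sing p n m 0 (gen p m n - (d : ZMod (p ^ m)) • 1) -
      ∑ i : Fin m, sing p n m i.succ ((p : CycGR p m n) ^ (i : ℕ)))
    {r | ∃ i : Fin m, r = sing p n m i.succ
      (WithBot.recBotCoe (1 : CycGR p m n) (fun k => gen p m n ^ p ^ k - 1) (a i))}

/-- The `R_m[G]`-module `X_{a,d,m}`. -/
noncomputable abbrev Xadm (p n m : ℕ) (a : Fin m → WithBot ℕ) (d : ℤ) :=
  (Fin (m + 1) → CycGR p m n) ⧸ Submodule.span (CycGR p m n) (XRels p n m a d)

/-- Indecomposability of a module. -/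
def IsIndecomposable (R M : Type*) [Ring R] [AddCommGroup M] [Module R M] : Prop :=
  (⊤ : Submodule R M) ≠ ⊥ ∧
  ∀ S T : Submodule R M, S ⊓ T = ⊥ → S ⊔ T = ⊤ → S = ⊥ ∨ T = ⊥

end MSS

universe u v

universe w

namespace CyclicPower

open Polynomial

/-- The polynomial `X ^ p ^ k - 1`, which annihilates the elements of level `k`. -/
noncomputable def lv (p k : ℕ) : ℤ[X] := X ^ p ^ k - 1

/-- The norm polynomial from level `i + k` to level `i`. -/
noncomputable def nm (p i k : ℕ) : ℤ[X] := ∑ l ∈ Finset.range (p ^ k), (X ^ p ^ i) ^ l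

/-- The annihilating polynomial of a level in `{-∞, 0, 1, …}`. -/
noncomputable def lev (p : ℕ) (a : WithBot ℕ) : ℤ[X] := WithBot.recBotCoe 1 (lv p) a

@[simp] theorem lev_bot (p : ℕ) : lev p ⊥ = 1 := rfl

@[simp] theorem lev_coe (p k : ℕ) : lev p (k : WithBot ℕ) = lv p k := rfl

@[simp] theorem lv_zero (p : ℕ) : lv p 0 = X - 1 := by simp [lv]

@[simp] theorem nm_zero (p i : ℕ) : nm p i 0 = 1 := by simp [nm]

theorem lv_mul_nm (p i k : ℕ) : lv p i * nm p i k = lv p (i + k) := by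
  rw [lv, nm, mul_geom_sum, ← pow_mul, ← pow_add, lv]

theorem X_sub_one_mul_nm (p k : ℕ) : (X - 1) * nm p 0 k = lv p k := by
  simpa using lv_mul_nm p 0 k

theorem lv_monic {p : ℕ} (hp : 0 < p) (k : ℕ) : (lv p k).Monic := by
  have := monic_X_pow_sub_C (1 : ℤ) (pow_pos hp k).ne'
  simpa [lv] using this

theorem lev_monic {p : ℕ} (hp : 0 < p) (a : WithBot ℕ) : (lev p a).Monic := by
  induction a using WithBot.recBotCoe with
  | bot => simp
  | coe k => exact lv_monic hp k

theorem lv_ne_zero {p : ℕ} (hp : 0 < p) (k : ℕ) : lv p k ≠ 0 := (lv_monic hp k).ne_zero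

theorem nm_mul_nm {p : ℕ} (hp : 0 < p) (i k l : ℕ) :
    nm p i k * nm p (i + k) l = nm p i (k + l) := by
  apply mul_left_cancel₀ (lv_ne_zero hp i)
  rw [← mul_assoc, lv_mul_nm, lv_mul_nm, lv_mul_nm, add_assoc]

theorem lev_dvd_lev {p : ℕ} {a b : WithBot ℕ} (h : a ≤ b) : lev p a ∣ lev p b := by
  induction a using WithBot.recBotCoe with
  | bot => simp
  | coe i =>
    induction b using WithBot.recBotCoe with
    | bot => simp at h
    | coe j =>
      obtain ⟨k, rfl⟩ := Nat.exists_eq_add_of_le (WithBot.coe_le_coe.1 h)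
      exact ⟨_, (lv_mul_nm p i k).symm⟩

theorem X_sub_one_dvd_lv (p k : ℕ) : (X - 1 : ℤ[X]) ∣ lv p k :=
  ⟨_, (X_sub_one_mul_nm p k).symm⟩

@[simp] theorem eval_one_lv (p k : ℕ) : (lv p k).eval 1 = 0 := by simp [lv]

@[simp] theorem eval_one_nm (p i k : ℕ) : (nm p i k).eval 1 = (p : ℤ) ^ k := by
  simp [nm, eval_finsetSum]

/-- Division with remainder by `X - d`. -/
theorem exists_eq_eval_add (d : ℤ) (f : ℤ[X]) :
    ∃ h : ℤ[X], f = ((f.eval d : ℤ) : ℤ[X]) + (X - (d : ℤ[X])) * h := by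
  obtain ⟨h, hh⟩ := X_sub_C_dvd_sub_C_eval (a := d) (p := f)
  refine ⟨h, ?_⟩
  rw [eq_intCast C, eq_intCast C] at hh
  linear_combination hh

theorem exists_eq_eval_one_add (f : ℤ[X]) :
    ∃ h : ℤ[X], f = ((f.eval 1 : ℤ) : ℤ[X]) + (X - 1) * h := by
  simpa using exists_eq_eval_add 1 f

theorem X_sub_one_ne_zero : (X - 1 : ℤ[X]) ≠ 0 := by
  simpa using (X_sub_C_ne_zero (1 : ℤ))

theorem exists_eq_mul_of_eval_one {f : ℤ[X]} (h : f.eval 1 = 0) : ∃ g, f = (X - 1) * g := by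
  obtain ⟨g, hg⟩ := exists_eq_eval_one_add f
  exact ⟨g, by simpa [h] using hg⟩

/-- A congruence modulo `X ^ p ^ k - 1` may be checked after multiplication by `X - 1` and
after augmentation. -/
theorem exists_sub_eq_lv_mul {p k : ℕ} (hp : 0 < p) {f g : ℤ[X]} {c : ℤ[X]}
    (h : (X - 1) * f - (X - 1) * g = lv p k * c) (h1 : f.eval 1 = g.eval 1) :
    ∃ c', f - g = lv p k * c' := by
  have h2 : f - g = nm p 0 k * c := by
    apply mul_left_cancel₀ X_sub_one_ne_zero
    rw [← mul_assoc, X_sub_one_mul_nm, ← h]; ring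
  have h3 : c.eval 1 = 0 := by
    have := congrArg (eval 1) h2
    simp only [eval_sub, eval_mul, eval_one_nm, h1, sub_self] at this
    rcases mul_eq_zero.1 this.symm with h | h
    · exact absurd h (by positivity)
    · exact h
  obtain ⟨c', rfl⟩ := exists_eq_mul_of_eval_one h3
  exact ⟨c', by rw [h2, ← X_sub_one_mul_nm]; ring⟩

theorem lev_dvd_of_dvd_mul {p : ℕ} (hp : 0 < p) (a : WithBot ℕ) {k : ℤ} (hk : k ≠ 0)
    {A : ℤ[X]} (h : lev p a ∣ (k : ℤ[X]) * A) : lev p a ∣ A := by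
  have hm := lev_monic hp a
  rw [← modByMonic_eq_zero_iff_dvd hm] at h ⊢
  rw [← eq_intCast C, ← smul_eq_C_mul, smul_modByMonic] at h
  exact (smul_eq_zero.1 h).resolve_left hk

/-- Cancellation of a level polynomial modulo a prime power. -/
theorem cancel_lev {p : ℕ} (hp : 0 < p) (a : WithBot ℕ) {e : ℕ} {c Q b A : ℤ[X]}
    (h : lev p a * c = lev p a * Q * b + (p : ℤ[X]) ^ e * A) :
    ∃ A', c = Q * b + (p : ℤ[X]) ^ e * A' := by
  have h1 : lev p a ∣ (((p : ℤ) ^ e : ℤ) : ℤ[X]) * A := by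
    push_cast
    exact ⟨c - Q * b, by linear_combination -h⟩
  obtain ⟨A', rfl⟩ := lev_dvd_of_dvd_mul hp a (by positivity) h1
  refine ⟨A', mul_left_cancel₀ (lev_monic hp a).ne_zero ?_⟩
  linear_combination h

/-- The ideal `(p, (X - 1) ^ l)`. -/
noncomputable def augIdeal (p l : ℕ) : Ideal ℤ[X] := Ideal.span {(p : ℤ[X]), (X - 1) ^ l}

theorem mem_augIdeal {p l : ℕ} {f : ℤ[X]} :
    f ∈ augIdeal p l ↔ ∃ A B, f = (p : ℤ[X]) * A + (X - 1) ^ l * B := by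
  rw [augIdeal, Ideal.mem_span_pair]
  constructor
  · rintro ⟨a, b, h⟩; exact ⟨a, b, by rw [← h]; ring⟩
  · rintro ⟨a, b, h⟩; exact ⟨a, b, by rw [h]; ring⟩

theorem p_mul_mem_augIdeal (p l : ℕ) (f : ℤ[X]) : (p : ℤ[X]) * f ∈ augIdeal p l :=
  Ideal.mul_mem_right _ _ (Ideal.subset_span (by simp))

theorem pow_mul_mem_augIdeal {p l k : ℕ} (h : l ≤ k) (f : ℤ[X]) :
    (X - 1) ^ k * f ∈ augIdeal p l := by
  obtain ⟨j, rfl⟩ := Nat.exists_eq_add_of_le h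
  rw [pow_add, mul_assoc]
  exact Ideal.mul_mem_right _ _ (Ideal.subset_span (by simp))

theorem augIdeal_mono {p l k : ℕ} (h : l ≤ k) : augIdeal p k ≤ augIdeal p l := by
  intro f hf
  obtain ⟨A, B, rfl⟩ := mem_augIdeal.1 hf
  exact add_mem (p_mul_mem_augIdeal _ _ _) (pow_mul_mem_augIdeal h _)

theorem augIdeal_cancel {p : ℕ} (hp : 0 < p) {l : ℕ} {f : ℤ[X]}
    (h : (X - 1) * f ∈ augIdeal p (l + 1)) : f ∈ augIdeal p l := by
  obtain ⟨A, B, h⟩ := mem_augIdeal.1 h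
  have hA : A.eval 1 = 0 := by
    have := congrArg (eval 1) h
    simp at this
    exact this.resolve_left hp.ne'
  obtain ⟨A', rfl⟩ := exists_eq_mul_of_eval_one hA
  refine mem_augIdeal.2 ⟨A', B, mul_left_cancel₀ X_sub_one_ne_zero ?_⟩
  rw [h]; ring

theorem augIdeal_cancel_pow {p : ℕ} (hp : 0 < p) (k : ℕ) {l : ℕ} {f : ℤ[X]}
    (h : (X - 1) ^ k * f ∈ augIdeal p (k + l)) : f ∈ augIdeal p l := by
  induction k with
  | zero => simpa using h
  | succ k ih =>
    apply ih
    apply augIdeal_cancel hp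
    rw [← mul_assoc, ← pow_succ']
    convert h using 2; ring

theorem mem_augIdeal_one {p : ℕ} {f : ℤ[X]} : f ∈ augIdeal p 1 ↔ (p : ℤ) ∣ f.eval 1 := by
  rw [mem_augIdeal]
  constructor
  · rintro ⟨A, B, rfl⟩; simp
  · rintro ⟨c, hc⟩
    obtain ⟨h, hh⟩ := exists_eq_eval_one_add f
    exact ⟨c, h, by rw [hh, hc]; push_cast; ring⟩

theorem exists_lv_eq {p : ℕ} (hp : p.Prime) (k : ℕ) :
    ∃ r, lv p k = (X - 1) ^ p ^ k + (p : ℤ[X]) * r := by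
  obtain ⟨r, hr⟩ := exists_add_pow_prime_pow_eq hp (X - 1 : ℤ[X]) 1 k
  refine ⟨(X - 1) * 1 * r, ?_⟩
  rw [sub_add_cancel] at hr
  rw [lv, hr]; simp; ring

theorem exists_nm_eq {p : ℕ} (hp : p.Prime) (k : ℕ) :
    ∃ r, nm p 0 k = (X - 1) ^ (p ^ k - 1) + (p : ℤ[X]) * r := by
  obtain ⟨r, hr⟩ := exists_lv_eq hp k
  have h1 : r.eval 1 = 0 := by
    have := congrArg (eval 1) hr
    simpa [hp.ne_zero] using this
  obtain ⟨r', rfl⟩ := exists_eq_mul_of_eval_one h1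
  refine ⟨r', mul_left_cancel₀ X_sub_one_ne_zero ?_⟩
  rw [X_sub_one_mul_nm, hr, mul_add, ← pow_succ', Nat.sub_add_cancel (Nat.one_le_pow _ _ hp.pos)]
  ring

theorem lv_mul_mem_augIdeal {p : ℕ} (hp : p.Prime) (k : ℕ) (f : ℤ[X]) :
    lv p k * f ∈ augIdeal p (p ^ k) := by
  obtain ⟨r, hr⟩ := exists_lv_eq hp k
  rw [hr]
  exact mem_augIdeal.2 ⟨r * f, f, by ring⟩

/-- The length of the truncated polynomial module of a given level. -/
def len (p : ℕ) (a : WithBot ℕ) : ℕ := WithBot.recBotCoe 0 (fun k => p ^ k) a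

@[simp] theorem len_bot (p : ℕ) : len p ⊥ = 0 := rfl

@[simp] theorem len_coe (p k : ℕ) : len p (k : WithBot ℕ) = p ^ k := rfl

theorem exists_lev_eq {p : ℕ} (hp : p.Prime) (a : WithBot ℕ) :
    ∃ r, lev p a = (X - 1) ^ len p a + (p : ℤ[X]) * r := by
  induction a using WithBot.recBotCoe with
  | bot => exact ⟨0, by simp⟩
  | coe k => exact exists_lv_eq hp k

theorem lev_mul_mem_augIdeal_iff {p : ℕ} (hp : p.Prime) (a : WithBot ℕ) {l : ℕ} {f : ℤ[X]} :
    lev p a * f ∈ augIdeal p (len p a + l) ↔ f ∈ augIdeal p l := by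
  obtain ⟨r, hr⟩ := exists_lev_eq hp a
  rw [hr, add_mul, mul_assoc, Ideal.add_mem_iff_left _ (p_mul_mem_augIdeal _ _ _)]
  refine ⟨augIdeal_cancel_pow hp.pos _, fun h => ?_⟩
  obtain ⟨A, B, rfl⟩ := mem_augIdeal.1 h
  exact mem_augIdeal.2 ⟨(X - 1) ^ len p a * A, B, by ring⟩

theorem len_lt_len {p : ℕ} (hp : p.Prime) {a b : WithBot ℕ} (h : a < b) : len p a < len p b := by
  induction b using WithBot.recBotCoe with
  | bot => simp at h
  | coe j =>
    induction a using WithBot.recBotCoe with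
    | bot => exact pow_pos hp.pos j
    | coe i => exact Nat.pow_lt_pow_right hp.one_lt (WithBot.coe_lt_coe.1 h)

section

theorem exists_nm_eq_pow_add (p i k : ℕ) : ∃ r, nm p i k = (p : ℤ[X]) ^ k + lv p i * r := by
  have : lv p i ∣ nm p i k - (p : ℤ[X]) ^ k := by
    have h : nm p i k - (p : ℤ[X]) ^ k
        = ∑ l ∈ Finset.range (p ^ k), ((X ^ p ^ i) ^ l - 1 : ℤ[X]) := by
      simp [nm]
    rw [h]
    exact Finset.dvd_sum fun l _ => sub_one_dvd_pow_sub_one _ l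
  obtain ⟨r, hr⟩ := this
  exact ⟨r, by rw [← hr]; ring⟩

section

variable {A : Type v} [AddCommGroup A] [Module ℤ[X] A]

theorem smul_eq_zero_of_dvd {f g : ℤ[X]} (h : f ∣ g) {x : A} (hx : f • x = 0) : g • x = 0 := by
  obtain ⟨c, rfl⟩ := h
  rw [mul_comm, mul_smul, hx, smul_zero]

theorem lev_smul_mono {p : ℕ} {a b : WithBot ℕ} (h : a ≤ b) {x : A} (hx : lev p a • x = 0) :
    lev p b • x = 0 := smul_eq_zero_of_dvd (lev_dvd_lev h) hx

theorem nm_smul_of_level {p i : ℕ} (k : ℕ) {x : A} (hx : lv p i • x = 0) :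
    nm p i k • x = (p : ℤ[X]) ^ k • x := by
  obtain ⟨r, hr⟩ := exists_nm_eq_pow_add p i k
  rw [hr, add_smul, mul_comm, mul_smul, hx, smul_zero, add_zero]

theorem nm_add_smul_of_level {p i : ℕ} (hp : 0 < p) (k : ℕ) {x : A} (hx : lv p i • x = 0) :
    nm p 0 (i + k) • x = (p : ℤ[X]) ^ k • nm p 0 i • x := by
  have := nm_mul_nm hp 0 i k
  rw [zero_add] at this
  rw [← this, mul_smul, nm_smul_of_level k hx, smul_comm]

theorem nm_smul_of_le {p i j : ℕ} (hp : 0 < p) (h : i ≤ j) {x : A} (hx : lv p i • x = 0) :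
    nm p 0 j • x = (p : ℤ[X]) ^ (j - i) • nm p 0 i • x := by
  conv_lhs => rw [← Nat.add_sub_cancel' h]
  exact nm_add_smul_of_level hp _ hx

theorem smul_of_fixed (f : ℤ[X]) {x : A} (hx : (X - 1 : ℤ[X]) • x = 0) :
    f • x = ((f.eval 1 : ℤ) : ℤ[X]) • x := by
  obtain ⟨h, hh⟩ := exists_eq_eval_one_add f
  conv_lhs => rw [hh, add_smul, mul_comm, mul_smul, hx, smul_zero, add_zero]

theorem X_sub_one_smul_nm {p i : ℕ} {x : A} (hx : lv p i • x = 0) :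
    (X - 1 : ℤ[X]) • nm p 0 i • x = 0 := by
  rw [← mul_smul, X_sub_one_mul_nm, hx]

variable (A) in
/-- The module-theoretic properties of the multiplicative group of a cyclic extension of degree
`p ^ n` containing a primitive `p`-th root of unity `ξ`. -/
structure CycData (p n : ℕ) (ξ : A) : Prop where
  prime : p.Prime
  pos : 0 < n
  per : ∀ x : A, lv p n • x = 0
  h90 : ∀ s < n, ∀ x : A, lv p (s + 1) • x = 0 → nm p s 1 • x = 0 →
    ∃ w : A, lv p (s + 1) • w = 0 ∧ x = lv p s • w
  tors : ∀ x : A, (p : ℤ[X]) • x = 0 → ∃ c : ℤ, x = (c : ℤ[X]) • ξ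
  fixed : (X - 1 : ℤ[X]) • ξ = 0
  p_smul : (p : ℤ[X]) • ξ = 0
  ne_zero : ξ ≠ 0
  special : p = 2 → n = 1 → ∃ γ : A, nm p 0 n • γ = ξ

namespace CycData

variable {p n : ℕ} {ξ : A}

theorem exists_of_norm_succ (h : CycData A p n ξ) {s : ℕ} (hs : s < n) {η g : A}
    (hη : lv p (s + 1) • η = 0) (hg : (X - 1 : ℤ[X]) • g = 0)
    (hN : nm p 0 (s + 1) • η = (p : ℤ[X]) • g) :
    ∃ w κ : A, lv p (s + 1) • w = 0 ∧ lv p s • κ = 0 ∧ nm p 0 s • κ = g ∧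
      η = (X - 1 : ℤ[X]) • w + κ := by
  have hg' : ∀ k, lv p k • g = 0 := fun k => smul_eq_zero_of_dvd (X_sub_one_dvd_lv p k) hg
  have hmul : nm p s 1 * nm p 0 s = nm p 0 (s + 1) := by
    have := nm_mul_nm h.prime.pos 0 s 1
    rwa [zero_add, mul_comm] at this
  obtain ⟨w, hw, hx⟩ := h.h90 s hs (nm p 0 s • η - g)
    (by rw [smul_sub, hg', smul_comm, hη, smul_zero, sub_zero])
    (by rw [smul_sub, ← mul_smul, hmul, hN, smul_of_fixed (nm p s 1) hg]; simp)
  have hk : nm p 0 s • (η - (X - 1 : ℤ[X]) • w) = g := by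
    have h1 := X_sub_one_mul_nm p s
    rw [← h1, mul_smul, smul_comm] at hx
    rw [smul_sub, ← hx]; abel
  refine ⟨w, η - (X - 1 : ℤ[X]) • w, hw, ?_, hk, by abel⟩
  rw [← X_sub_one_mul_nm, mul_smul, hk, hg]

/-- An element of level `s` whose norm is a `p`-th multiple modulo norms from level `s + 1` can be
replaced by an element of smaller level. -/
theorem exists_lower (h : CycData A p n ξ) {s : ℕ} (hs : s < n) {ε γ g : A}
    (hε : lv p s • ε = 0) (hγ : lv p (s + 1) • γ = 0) (hg : (X - 1 : ℤ[X]) • g = 0)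
    (hN : nm p 0 s • ε = nm p 0 (s + 1) • γ + (p : ℤ[X]) • g) :
    ∃ (t : WithBot ℕ) (γ' w κ : A), t < s ∧ lev p t • κ = 0 ∧
      ε = (p : ℤ[X]) • γ' + (X - 1 : ℤ[X]) • w + κ ∧
      nm p 0 (n - 1) • (κ - ε) + nm p 0 n • γ' = 0 := by
  have hp0 := h.prime.pos
  have hmul : nm p 0 s * nm p s 1 = nm p 0 (s + 1) := by
    have := nm_mul_nm h.prime.pos 0 s 1
    rwa [zero_add] at this
  obtain ⟨q, hq⟩ := exists_eq_eval_one_add (nm p s 1)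
  rw [eval_one_nm] at hq
  have hε' : nm p 0 (n - 1) • ε = nm p 0 n • γ + (p : ℤ[X]) ^ (n - s) • g := by
    rw [nm_smul_of_le hp0 (show s ≤ n - 1 by omega) hε, nm_smul_of_le hp0 hs hγ, hN,
      show n - (s + 1) = n - 1 - s by omega, show n - s = (n - 1 - s) + 1 by omega]
    module
  rcases s with _ | s
  · refine ⟨⊥, γ + g, q • γ, 0, WithBot.bot_lt_coe _, by simp, ?_, ?_⟩
    · simp only [nm_zero, one_smul, zero_add] at hN
      rw [hN, hq]; push_cast; module
    · rw [zero_sub, smul_neg, hε', smul_add, smul_of_fixed (nm p 0 n) hg, eval_one_nm]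
      push_cast
      simp
  · obtain ⟨w, κ, hw, hκ, hκN, hE⟩ := h.exists_of_norm_succ (s := s) (by omega)
      (η := ε - nm p (s + 1) 1 • γ) (g := g)
      (by rw [smul_sub, hε, ← mul_smul, lv_mul_nm, hγ, sub_zero]) hg
      (by rw [smul_sub, ← mul_smul, hmul, hN]; abel)
    refine ⟨s, γ, q • γ + w, κ, by exact_mod_cast Nat.lt_succ_self s, hκ, ?_, ?_⟩
    · rw [eq_add_of_sub_eq hE, hq]; push_cast; module
    · rw [smul_sub, hε', nm_smul_of_le hp0 (show s ≤ n - 1 by omega) hκ, hκN,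
        show n - 1 - s = n - (s + 1) by omega]
      abel

/-- The basic data from which a decomposition is built. -/
structure Core (p n : ℕ) (ξ : A) (a : WithBot ℕ) (α δ ρ : A) : Prop where
  rel : (X - 1 : ℤ[X]) • α = δ + (p : ℤ[X]) • ρ
  level : lev p a • δ = 0
  lt : a < n
  norm : nm p 0 (n - 1) • δ + nm p 0 n • ρ = ξ
  special : p = 2 → n = 1 → a = ⊥

theorem Core.level_pred {a : WithBot ℕ} {α δ ρ : A}
    (hc : Core p n ξ a α δ ρ) : lv p (n - 1) • δ = 0 := by
  refine lev_smul_mono (p := p) (b := ((n - 1 : ℕ) : WithBot ℕ)) ?_ hc.level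
  have := hc.lt
  induction a using WithBot.recBotCoe with
  | bot => exact bot_le
  | coe k =>
    have := WithBot.coe_lt_coe.1 this
    exact WithBot.coe_le_coe.2 (by simpa using Nat.le_pred_of_lt this)

theorem Core.move {a b : WithBot ℕ} {α δ ρ w η y : A} (hc : Core p n ξ a α δ ρ)
    (hw : (X - 1 : ℤ[X]) • w = η + (p : ℤ[X]) • y)
    (hN : nm p 0 (n - 1) • η + nm p 0 n • y = 0)
    (hb : b ≤ a) (hl : lev p b • (δ + η) = 0) :
    Core p n ξ b (α + w) (δ + η) (ρ + y) where
  rel := by rw [smul_add, hc.rel, hw]; module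
  level := hl
  lt := hb.trans_lt hc.lt
  norm := by
    rw [smul_add, smul_add, ← hc.norm]
    linear_combination (norm := module) hN
  special := fun h1 h2 => by
    have := hc.special h1 h2
    subst this
    exact le_bot_iff.1 hb

theorem exists_core (h : CycData A p n ξ) :
    ∃ (a : WithBot ℕ) (α δ ρ : A), Core p n ξ a α δ ρ := by
  by_cases hs : p = 2 ∧ n = 1
  · obtain ⟨γ, hγ⟩ := h.special hs.1 hs.2
    obtain ⟨rfl, rfl⟩ := hs
    obtain ⟨w, -, hw⟩ := h.h90 0 one_pos ((2 : ℤ[X]) • γ) (h.per _) (by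
      have := h.p_smul
      push_cast at this
      rw [smul_comm, hγ, this])
    refine ⟨⊥, w, 0, γ, ⟨?_, by simp, WithBot.bot_lt_coe _, by simp [hγ], fun _ _ => rfl⟩⟩
    rw [lv_zero] at hw
    rw [← hw]; push_cast; module
  · obtain ⟨θ, -, hθ⟩ := h.h90 (n - 1) (Nat.sub_lt h.pos one_pos) ξ
      (smul_eq_zero_of_dvd (X_sub_one_dvd_lv _ _) h.fixed)
      (by rw [smul_of_fixed _ h.fixed, eval_one_nm]; simpa using h.p_smul)
    refine ⟨((n - 1 : ℕ) : WithBot ℕ), θ, (X - 1 : ℤ[X]) • θ, 0, by simp, ?_, ?_, ?_, ?_⟩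
    · rw [lev_coe, smul_comm, ← hθ, h.fixed]
    · exact WithBot.coe_lt_coe.2 (Nat.sub_lt h.pos one_pos)
    · rw [smul_zero, add_zero, ← mul_smul, mul_comm, X_sub_one_mul_nm, hθ]
    · exact fun h1 h2 => absurd ⟨h1, h2⟩ hs

end CycData

end

end

section

theorem exists_nm_zero_eq (p k : ℕ) (hp : 0 < p) :
    ∃ S : ℤ[X], nm p 0 k = (p : ℤ[X]) ^ k + (X - 1) * S ∧
      2 * S.eval 1 = (p : ℤ) ^ k * ((p : ℤ) ^ k - 1) := by
  obtain ⟨S, hS⟩ := exists_eq_eval_one_add (nm p 0 k)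
  rw [eval_one_nm] at hS
  refine ⟨S, by rw [hS]; push_cast; rfl, ?_⟩
  have h1 := congrArg (fun f => eval 1 (derivative f)) hS
  simp only [nm, pow_zero, pow_one, derivative_sum, derivative_X_pow, eval_finsetSum, eval_mul,
    derivative_add, derivative_mul, derivative_sub, derivative_X, derivative_one, eval_add,
    eval_sub, eval_X, eval_one, derivative_intCast, eval_pow, one_pow, mul_one, sub_self,
    zero_mul, add_zero, sub_zero, one_mul, zero_add] at h1
  have h2 := Finset.sum_range_id_mul_two (p ^ k)
  have h3 : ((∑ i ∈ Finset.range (p ^ k), i : ℕ) : ℤ) = S.eval 1 := by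
    rw [← h1]; simp
  rw [← h3]
  have h4 : 1 ≤ p ^ k := Nat.one_le_pow _ _ hp
  have h5 := congrArg (Nat.cast (R := ℤ)) h2
  push_cast [Nat.cast_sub h4] at h5
  rw [← h5]
  push_cast
  ring

namespace CycData

variable {A : Type v} [AddCommGroup A] [Module ℤ[X] A] {p n : ℕ} {ξ : A}

namespace Core

variable {a : WithBot ℕ} {α δ ρ : A}

theorem exists_root (h : CycData A p n ξ) (hc : Core p n ξ a α δ ρ) :
    ∃ z : A, (X - 1 : ℤ[X]) • z = ξ ∧ nm p 0 n • α = (p : ℤ[X]) • z := by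
  obtain ⟨k, rfl⟩ : ∃ k, n = k + 1 := ⟨n - 1, (Nat.succ_pred_eq_of_pos h.pos).symm⟩
  obtain ⟨S, hS, hS1⟩ := exists_nm_zero_eq p (k + 1) h.prime.pos
  obtain ⟨T, hT, hT1⟩ := exists_nm_zero_eq p k h.prime.pos
  have hδ := hc.level_pred
  have hnorm := hc.norm
  simp only [Nat.add_sub_cancel] at hδ hnorm
  have key : ∃ c : ℤ[X], S • δ = (p : ℤ[X]) • (T + c * nm p 0 k) • δ := by
    by_cases hs : p = 2 ∧ k = 0
    · have h0 := hc.special hs.1 (by omega)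
      have h1 := hc.level
      subst h0
      rw [lev_bot, one_smul] at h1
      exact ⟨0, by simp [h1]⟩
    · obtain ⟨c, hcc⟩ : ∃ c : ℤ, 2 * c = ((p : ℤ) - 1) * (p : ℤ) ^ k := by
        have : (2 : ℤ) ∣ ((p : ℤ) - 1) * (p : ℤ) ^ k := by
          rcases h.prime.eq_two_or_odd' with h2 | h2
          · have hk : k ≠ 0 := fun hk => hs ⟨h2, hk⟩
            subst h2
            exact Dvd.dvd.mul_left (dvd_pow_self _ hk) _
          · obtain ⟨r, hr⟩ := h2
            have h3 : (p : ℤ) - 1 = 2 * r := by rw [hr]; push_cast; ring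
            exact Dvd.dvd.mul_right (Dvd.intro _ h3.symm) _
        obtain ⟨c, hc⟩ := this
        exact ⟨c, hc.symm⟩
      obtain ⟨r, hr⟩ := exists_nm_eq_pow_add p k 1
      have hmul := nm_mul_nm h.prime.pos 0 k 1
      rw [zero_add] at hmul
      obtain ⟨c', hc'⟩ := exists_sub_eq_lv_mul (k := k) h.prime.pos (f := S)
        (g := (p : ℤ[X]) * (T + (c : ℤ[X]) * nm p 0 k)) (c := nm p 0 k * r - p * c) (by
          have hX := X_sub_one_mul_nm p k
          rw [hr, hS] at hmul
          linear_combination (-1 : ℤ[X]) * hmul + (p : ℤ[X]) * hT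
            - (p : ℤ[X]) * (c : ℤ[X]) * hX)
        (by
          have h20 : (2 : ℤ) ≠ 0 := two_ne_zero
          apply mul_left_cancel₀ h20
          simp only [eval_mul, eval_add, eval_natCast, eval_intCast, eval_one_nm]
          linear_combination hS1 - (p : ℤ) * hT1 - (p : ℤ) * (p : ℤ) ^ k * hcc)
      refine ⟨c, ?_⟩
      rw [← mul_smul, ← sub_eq_zero, ← sub_smul, hc', mul_comm, mul_smul, hδ, smul_zero]
  obtain ⟨c, hkey⟩ := key
  have hrel := hc.rel
  refine ⟨(p : ℤ[X]) ^ k • α + S • ρ + (T + c * nm p 0 k) • δ, ?_, ?_⟩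
  · have h1 : (X - 1 : ℤ[X]) * (T + c * nm p 0 k) = nm p 0 k - p ^ k + c * lv p k := by
      rw [hT, ← X_sub_one_mul_nm, hT]; ring
    have h2 : (X - 1 : ℤ[X]) * S = nm p 0 (k + 1) - p ^ (k + 1) := by rw [hS]; ring
    rw [smul_add, smul_add, smul_comm, hrel, ← mul_smul, ← mul_smul, h1, h2, add_smul, mul_smul,
      hδ, ← hnorm]
    module
  · rw [smul_add, ← hkey, hS, add_smul, mul_comm, mul_smul, hrel]
    module

theorem norm_ne (h : CycData A p n ξ) (hc : Core p n ξ a α δ ρ) {g : A}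
    (hg : (X - 1 : ℤ[X]) • g = 0) : nm p 0 n • α ≠ (p : ℤ[X]) • g := by
  intro hE
  obtain ⟨z, hz, hz'⟩ := hc.exists_root h
  obtain ⟨c, hcz⟩ := h.tors (z - g) (by rw [smul_sub, ← hz', hE, sub_self])
  apply h.ne_zero
  rw [← hz, eq_add_of_sub_eq hcz, smul_add, hg, smul_comm, h.fixed]
  simp

theorem dvd_of_smul_norm (h : CycData A p n ξ) (hc : Core p n ξ a α δ ρ) {g : A} {c : ℤ}
    (hg : (X - 1 : ℤ[X]) • g = 0) (hE : (c : ℤ[X]) • nm p 0 n • α = (p : ℤ[X]) • g) :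
    (p : ℤ) ∣ c := by
  by_contra hpc
  have hcop : IsCoprime (p : ℤ) c := (Nat.prime_iff_prime_int.1 h.prime).coprime_iff_not_dvd.2 hpc
  obtain ⟨u, v, huv⟩ := hcop
  refine hc.norm_ne h (g := (u : ℤ[X]) • nm p 0 n • α + (v : ℤ[X]) • g) ?_ ?_
  · rw [smul_add, smul_comm, X_sub_one_smul_nm (h.per α), smul_comm (X - 1 : ℤ[X]), hg]
    simp
  · have huv' : (u : ℤ[X]) * (p : ℤ[X]) + (v : ℤ[X]) * (c : ℤ[X]) = 1 := by exact_mod_cast huv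
    linear_combination (norm := module) (v : ℤ[X]) • hE - congrArg (· • nm p 0 n • α) huv'

theorem exists_of_p_smul_fixed (h : CycData A p n ξ) (hc : Core p n ξ a α δ ρ) {x : A}
    (hx : (X - 1 : ℤ[X]) • (p : ℤ[X]) • x = 0) :
    ∃ (c : ℤ) (g : A), (X - 1 : ℤ[X]) • g = 0 ∧
      (p : ℤ[X]) • x = (c : ℤ[X]) • nm p 0 n • α + (p : ℤ[X]) • g := by
  obtain ⟨z, hz, hz'⟩ := hc.exists_root h
  obtain ⟨c, hcx⟩ := h.tors ((X - 1 : ℤ[X]) • x) (by rw [smul_comm, hx])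
  refine ⟨c, x - (c : ℤ[X]) • z, ?_, ?_⟩
  · rw [smul_sub, hcx, smul_comm, hz, sub_self]
  · rw [hz']; module

/-- An element of level `n` whose norm is a multiple of the norm of `α` modulo `p`-th multiples can
be replaced by an element of smaller level. -/
theorem exists_lower_top (h : CycData A p n ξ) (hc : Core p n ξ a α δ ρ) {ε g : A} {c : ℤ}
    (hg : (X - 1 : ℤ[X]) • g = 0)
    (hN : nm p 0 n • ε = (c : ℤ[X]) • nm p 0 n • α + (p : ℤ[X]) • g) :
    ∃ (t : WithBot ℕ) (w κ : A), t < n ∧ lev p t • κ = 0 ∧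
      ε = (c : ℤ[X]) • α + (X - 1 : ℤ[X]) • w + κ := by
  obtain ⟨k, rfl⟩ : ∃ k, n = k + 1 := ⟨n - 1, (Nat.succ_pred_eq_of_pos h.pos).symm⟩
  obtain ⟨w, κ, -, hκ, -, hE⟩ := h.exists_of_norm_succ (s := k) (Nat.lt_succ_self k)
    (η := ε - (c : ℤ[X]) • α) (g := g) (h.per _) hg (by rw [smul_sub, hN, smul_comm]; abel)
  exact ⟨k, w, κ, by exact_mod_cast Nat.lt_succ_self k, hκ, by rw [eq_add_of_sub_eq hE]; abel⟩

end Core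

end CycData

end

section

/-- A factorization `c = p ^ v * u` of an integer not divisible by `p ^ (N + 1)`, together with an
inverse of `u` modulo `p ^ M`. -/
theorem exists_unit_factor {p : ℕ} (hp : p.Prime) {N : ℕ} (M : ℕ) {c : ℤ}
    (hc : ¬ (p : ℤ) ^ (N + 1) ∣ c) :
    ∃ (v : ℕ) (u u' s : ℤ), v ≤ N ∧ c = (p : ℤ) ^ v * u ∧ ¬ (p : ℤ) ∣ u ∧
      u * u' + (p : ℤ) ^ M * s = 1 := by
  have hp' : Prime (p : ℤ) := Nat.prime_iff_prime_int.1 hp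
  have hfin : FiniteMultiplicity (p : ℤ) c := by
    rw [Int.finiteMultiplicity_iff]
    refine ⟨by simpa using hp.ne_one, ?_⟩
    rintro rfl
    exact hc (dvd_zero _)
  obtain ⟨u, hu, hpu⟩ := hfin.exists_eq_pow_mul_and_not_dvd
  have hcop : IsCoprime u ((p : ℤ) ^ M) :=
    ((hp'.coprime_iff_not_dvd.2 hpu).symm).pow_right
  obtain ⟨u', s, h⟩ := hcop
  refine ⟨_, u, u', s, ?_, hu, hpu, by rw [← h]; ring⟩
  by_contra hlt
  push Not at hlt
  exact hc ((pow_dvd_pow _ hlt).trans (Dvd.intro _ hu.symm))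

theorem withBot_cases (a : WithBot ℕ) : a = ⊥ ∨ ∃ k : ℕ, a = (k : WithBot ℕ) := by
  induction a using WithBot.recBotCoe with
  | bot => exact Or.inl rfl
  | coe k => exact Or.inr ⟨k, rfl⟩

theorem le_pred_of_lt {a : WithBot ℕ} {n : ℕ} (h : a < n) : a ≤ ((n - 1 : ℕ) : WithBot ℕ) := by
  rcases withBot_cases a with rfl | ⟨k, rfl⟩
  · exact bot_le
  · have : k < n := by exact_mod_cast h
    exact_mod_cast Nat.le_pred_of_lt this

section

variable {A : Type v} [AddCommGroup A] [Module ℤ[X] A]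

/-- The weighted sum `∑ p ^ k ε_k`. -/
noncomputable def wsum (p M : ℕ) (ε : ℕ → A) : A :=
  ∑ k ∈ Finset.range (M + 1), (p : ℤ[X]) ^ k • ε k

theorem wsum_add (p M : ℕ) (ε ε' : ℕ → A) : wsum p M (ε + ε') = wsum p M ε + wsum p M ε' := by
  simp [wsum, Finset.sum_add_distrib]

theorem wsum_single {p M j : ℕ} (hj : j ≤ M) (x : A) :
    wsum p M (Pi.single j x) = (p : ℤ[X]) ^ j • x := by
  rw [wsum, Finset.sum_eq_single j]
  · simp
  · intro b _ hb; simp [hb]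
  · intro h; exact absurd (Finset.mem_range.2 (Nat.lt_succ_of_le hj)) h

theorem lex_update {M : ℕ} (b : Fin M → WithBot ℕ) (i : Fin M) (hb : b i ≠ ⊥) :
    Pi.Lex (· < ·) (fun {_} => (· < ·)) (Function.update b i ⊥) b :=
  ⟨i, fun j hj => by simp [hj.ne], by simpa using bot_lt_iff_ne_bot.2 hb⟩

namespace CycData

variable {p n : ℕ} {ξ : A}

/-- Representations of core data by generators of prescribed levels. -/
structure Rep (p n : ℕ) (ξ : A) (M : ℕ) (a : WithBot ℕ) (b : Fin M → WithBot ℕ) (e : ℤ)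
    (α δ : A) (ε : ℕ → A) : Prop where
  core : Core p n ξ a α δ ((e : ℤ[X]) • α + wsum p M ε)
  level : ∀ k : Fin M, lev p (b k) • ε k = 0
  le : ∀ k, b k ≤ n

namespace Rep

variable {M : ℕ} {a : WithBot ℕ} {b : Fin M → WithBot ℕ} {e : ℤ} {α δ : A} {ε : ℕ → A}

theorem exists_lex_of_lower (h : CycData A p n ξ) (hr : Rep p n ξ M a b e α δ ε) {j : Fin M}
    {t : WithBot ℕ} {c : ℤ} {γ w κ : A} (ht : t < b j) (hκ : lev p t • κ = 0)
    (hε : ε j = (c : ℤ[X]) • α + (p : ℤ[X]) • γ + (X - 1 : ℤ[X]) • w + κ) :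
    ∃ b' e' α' δ' ε', Rep p n ξ M a b' e' α' δ' ε' ∧
      Pi.Lex (· < ·) (fun {_} => (· < ·)) b' b := by
  have hj := j.2
  set e' : ℤ := e + c * (p : ℤ) ^ (j : ℕ) with he'
  refine ⟨fun k => if k < j then b k else if k = j then t else n, e',
    α + (-(p : ℤ[X]) ^ ((j : ℕ) + 1)) • w, δ + 0,
    ε + Pi.single (j : ℕ) (κ - ε j) + Pi.single ((j : ℕ) + 1) (γ + (e' : ℤ[X]) • w),
    ⟨?_, ?_, ?_⟩, j, ?_, ?_⟩
  · have := hr.core.move (b := a) (w := (-(p : ℤ[X]) ^ ((j : ℕ) + 1)) • w) (η := 0)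
      (y := -((X - 1 : ℤ[X]) * (p : ℤ[X]) ^ (j : ℕ)) • w) (by module) (by
        have := h.per w
        rw [← X_sub_one_mul_nm] at this
        linear_combination (norm := module) (-(p : ℤ[X]) ^ (j : ℕ)) • this) le_rfl
        (by rw [add_zero]; exact hr.core.level)
    convert this using 1
    rw [wsum_add, wsum_add, wsum_single hj.le, wsum_single (show (j : ℕ) + 1 ≤ M from hj), hε,
      he']
    push_cast
    module
  · intro k
    rcases lt_trichotomy k j with hk | hk | hk
    · have h1 : (k : ℕ) ≠ j := by have : (k : ℕ) < j := hk; omega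
      have h2 : (k : ℕ) ≠ j + 1 := by have : (k : ℕ) < j := hk; omega
      simpa [hk, h1, h2] using hr.level k
    · subst hk
      simpa using hκ
    · simp only [hk.not_gt, hk.ne', if_false]
      exact h.per _
  · intro k
    split_ifs
    · exact hr.le k
    · exact ht.le.trans (hr.le j)
    · exact le_rfl
  · intro k hk
    simp [hk]
  · simpa using ht

theorem level_update {i : Fin M} {ε' : ℕ → A} (h0 : ε' i = 0)
    (h1 : ∀ k : Fin M, k ≠ i → lev p (b k) • ε' k = 0) (k : Fin M) :
    lev p (Function.update b i ⊥ k) • ε' k = 0 := by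
  by_cases hk : k = i
  · subst hk; rw [h0, smul_zero]
  · rw [Function.update_of_ne hk]; exact h1 k hk

theorem le_update (hr : Rep p n ξ M a b e α δ ε) (i : Fin M) (k : Fin M) :
    Function.update b i ⊥ k ≤ n := by
  by_cases hk : k = i
  · subst hk; simp
  · rw [Function.update_of_ne hk]; exact hr.le k

theorem exists_lex_of_le (hr : Rep p n ξ M a b e α δ ε) {i j : Fin M} (hij : j < i)
    (hi : b i ≠ ⊥) (hle : b i ≤ b j) :
    ∃ b' e' α' δ' ε', Rep p n ξ M a b' e' α' δ' ε' ∧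
      Pi.Lex (· < ·) (fun {_} => (· < ·)) b' b := by
  have hij' : (j : ℕ) < i := hij
  refine ⟨_, e, α, δ, ε + Pi.single (i : ℕ) (-ε i)
    + Pi.single (j : ℕ) ((p : ℤ[X]) ^ ((i : ℕ) - j) • ε i),
    ⟨?_, level_update (i := i) ?_ ?_, hr.le_update i⟩, lex_update b i hi⟩
  · convert hr.core using 2
    rw [wsum_add, wsum_add, wsum_single i.2.le, wsum_single j.2.le, ← mul_smul, ← pow_add,
      Nat.add_sub_cancel' hij'.le]
    module
  · simp [hij'.ne']
  · intro k hk
    have hk' : (k : ℕ) ≠ i := fun h => hk (Fin.ext h)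
    by_cases hkj : k = j
    · subst hkj
      simp only [Pi.add_apply, Pi.single_eq_of_ne hk', Pi.single_eq_same, add_zero, smul_add,
        hr.level, zero_add]
      rw [smul_comm, lev_smul_mono hle (hr.level i), smul_zero]
    · have hkj' : (k : ℕ) ≠ j := fun h => hkj (Fin.ext h)
      simpa [hk', hkj'] using hr.level k

theorem exists_lex_of_not_dvd (h : CycData A p n ξ) (hr : Rep p n ξ M a b e α δ ε) {i j : Fin M}
    (hij : j < i) (hi : b i ≠ ⊥) {Q : ℤ[X]} (hQ : lev p (b i) = lev p (b j) * Q)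
    (hdvd : ¬ (p : ℤ) ^ ((i : ℕ) - j + 1) ∣ Q.eval (1 + p * e)) :
    ∃ b' e' α' δ' ε', Rep p n ξ M a b' e' α' δ' ε' ∧
      Pi.Lex (· < ·) (fun {_} => (· < ·)) b' b := by
  have hij' : (j : ℕ) < i := hij
  have hiM : (i : ℕ) < M := i.2
  obtain ⟨v, u, u', s, hv, hu, -, huu⟩ := exists_unit_factor h.prime M hdvd
  obtain ⟨f, hf⟩ := exists_eq_eval_add (1 + p * e) Q
  rw [hu] at hf
  have huu' : (u : ℤ[X]) * (u' : ℤ[X]) + (p : ℤ[X]) ^ M * (s : ℤ[X]) = 1 := by exact_mod_cast huu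
  have hpow : (p : ℤ[X]) ^ (i : ℕ) = (p : ℤ[X]) ^ ((i : ℕ) - v) * (p : ℤ[X]) ^ v := by
    rw [← pow_add]; congr 1; omega
  have hpow2 : (p : ℤ[X]) ^ ((i : ℕ) - v) = (p : ℤ[X]) ^ (j : ℕ) * (p : ℤ[X]) ^ ((i : ℕ) - v - j) := by
    rw [← pow_add]; congr 1; omega
  set w : A := ((p : ℤ[X]) ^ ((i : ℕ) - v) * u' * f) • ε i with hw
  refine ⟨_, e, α + (p : ℤ[X]) • w, δ + 0, ε + Pi.single (i : ℕ) (-ε i)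
    + Pi.single (j : ℕ) (((p : ℤ[X]) ^ ((i : ℕ) - v - j) * u' * Q) • ε i)
    + Pi.single M (((p : ℤ[X]) ^ (i : ℕ) * s) • ε i),
    ⟨?_, level_update (i := i) ?_ ?_, hr.le_update i⟩, lex_update b i hi⟩
  · have := hr.core.move (b := a) (w := (p : ℤ[X]) • w) (η := 0)
      (y := (X - 1 : ℤ[X]) • w) (by module) (by
        have := h.per w
        rw [← X_sub_one_mul_nm] at this
        linear_combination (norm := module) this) le_rfl
        (by rw [add_zero]; exact hr.core.level)
    convert this using 1
    rw [wsum_add, wsum_add, wsum_add, wsum_single i.2.le, wsum_single j.2.le, wsum_single le_rfl]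
    have key : (p : ℤ[X]) ^ (j : ℕ)
        * ((p : ℤ[X]) ^ ((i : ℕ) - v - (j : ℕ)) * (u' : ℤ[X]) * Q)
        + (p : ℤ[X]) ^ M * ((p : ℤ[X]) ^ (i : ℕ) * (s : ℤ[X]))
        = (p : ℤ[X]) ^ (i : ℕ)
          + (X - 1 - (p : ℤ[X]) * (e : ℤ[X])) * ((p : ℤ[X]) ^ ((i : ℕ) - v) * (u' : ℤ[X]) * f) := by
      push_cast at hf
      rw [hf]
      linear_combination (-(u' : ℤ[X]) * ((p : ℤ[X]) ^ v * (u : ℤ[X])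
        + (X - (1 + (p : ℤ[X]) * (e : ℤ[X]))) * f)) * hpow2
        - (u : ℤ[X]) * (u' : ℤ[X]) * hpow + (p : ℤ[X]) ^ (i : ℕ) * huu'
    have key' := congrArg (· • ε (i : ℕ)) key
    rw [hw]
    linear_combination (norm := module) key'
  · have hM : (i : ℕ) ≠ M := hiM.ne
    simp [hij'.ne', hM]
  · intro k hk
    have hk' : (k : ℕ) ≠ i := fun h => hk (Fin.ext h)
    have hkM : (k : ℕ) ≠ M := k.2.ne
    by_cases hkj : k = j
    · subst hkj
      simp only [Pi.add_apply, Pi.single_eq_of_ne hk', Pi.single_eq_of_ne hkM,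
        Pi.single_eq_same, add_zero, smul_add, hr.level, zero_add]
      have := hr.level i
      rw [hQ] at this
      linear_combination (norm := module) ((p : ℤ[X]) ^ ((i : ℕ) - v - k) * u') • this
    · have hkj' : (k : ℕ) ≠ j := fun h => hkj (Fin.ext h)
      simpa [hk', hkj', hkM] using hr.level k

theorem exists_lex_of_le_head (h : CycData A p n ξ) (hr : Rep p n ξ M a b e α δ ε) {i : Fin M}
    (hi : b i ≠ ⊥) (hle : b i ≤ a) :
    ∃ b' e' α' δ' ε', Rep p n ξ M a b' e' α' δ' ε' ∧
      Pi.Lex (· < ·) (fun {_} => (· < ·)) b' b := by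
  refine ⟨_, e, α + 0, δ + (p : ℤ[X]) ^ ((i : ℕ) + 1) • ε i, ε + Pi.single (i : ℕ) (-ε i),
    ⟨?_, level_update (i := i) ?_ ?_, hr.le_update i⟩, lex_update b i hi⟩
  · have := hr.core.move (b := a) (w := 0) (η := (p : ℤ[X]) ^ ((i : ℕ) + 1) • ε i)
      (y := -(p : ℤ[X]) ^ (i : ℕ) • ε i) (by module) (by
        have hl : lv p (n - 1) • ε i = 0 := by
          exact lev_smul_mono (hle.trans (le_pred_of_lt hr.core.lt)) (hr.level i)
        have := nm_smul_of_le h.prime.pos (Nat.sub_le n 1) hl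
        rw [show n - (n - 1) = 1 by have := h.pos; omega] at this
        linear_combination (norm := module) (-(p : ℤ[X]) ^ (i : ℕ)) • this) le_rfl
        (by rw [smul_add, hr.core.level, smul_comm, lev_smul_mono hle (hr.level i)]; simp)
    convert this using 1
    rw [wsum_add, wsum_single i.2.le]
    module
  · simp
  · intro k hk
    have hk' : (k : ℕ) ≠ i := fun h => hk (Fin.ext h)
    simpa [hk'] using hr.level k

theorem exists_quotient (h : CycData A p n ξ) {a b : WithBot ℕ} (hab : a < b) (ha : a < n)
    (hb : b ≤ n) : ∃ (Q : ℤ[X]) (q : ℤ), lev p b = lev p a * Q ∧ Q.eval 1 = p * q ∧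
      ∀ x : A, lev p b • x = 0 → nm p 0 (n - 1) • Q • x = (q : ℤ[X]) • nm p 0 n • x := by
  rcases withBot_cases a with rfl | ⟨s, rfl⟩
  · exact ⟨lev p b, 0, by simp, by
      obtain ⟨b, rfl⟩ := (withBot_cases b).resolve_left hab.ne'
      simp, fun x hx => by rw [hx]; simp⟩
  · obtain ⟨b, rfl⟩ := (withBot_cases b).resolve_left (bot_le.trans_lt hab).ne'
    obtain ⟨k, rfl⟩ := Nat.exists_eq_add_of_lt (show s < b by exact_mod_cast hab)
    have hb' : s + k + 1 ≤ n := by exact_mod_cast hb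
    have hp0 := h.prime.pos
    refine ⟨nm p s (k + 1), p ^ k, ?_, by rw [eval_one_nm]; ring, fun x hx => ?_⟩
    · rw [lev_coe, lev_coe, lv_mul_nm]; rfl
    · have e1 : nm p 0 (n - 1) = nm p 0 s * nm p s (n - 1 - s) := by
        have := nm_mul_nm hp0 0 s (n - 1 - s)
        rw [zero_add] at this
        rw [this]; congr 1; omega
      have e2 : nm p 0 s * nm p s (k + 1) = nm p 0 (s + k + 1) := by
        have := nm_mul_nm hp0 0 s (k + 1)
        rw [zero_add] at this
        rw [this]; rfl
      rw [lev_coe] at hx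
      rw [e1, ← mul_smul, mul_right_comm, e2, mul_smul, smul_comm,
        smul_of_fixed (nm p s (n - 1 - s)) (X_sub_one_smul_nm hx), eval_one_nm,
        nm_smul_of_le hp0 hb' hx]
      push_cast
      rw [← mul_smul, ← mul_smul, ← mul_smul, ← pow_add]
      congr 3; omega

theorem exists_lex_of_not_dvd_head (h : CycData A p n ξ) (hr : Rep p n ξ M a b e α δ ε)
    {i : Fin M} (hi : b i ≠ ⊥) {Q : ℤ[X]} {q : ℤ} (hQ : lev p (b i) = lev p a * Q)
    (hQ1 : Q.eval 1 = p * q)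
    (hQN : ∀ x : A, lev p (b i) • x = 0 → nm p 0 (n - 1) • Q • x = (q : ℤ[X]) • nm p 0 n • x)
    (hdvd : ¬ (p : ℤ) ^ ((i : ℕ) + 1 + 1) ∣ Q.eval (1 + p * e)) :
    ∃ b' e' α' δ' ε', Rep p n ξ M a b' e' α' δ' ε' ∧
      Pi.Lex (· < ·) (fun {_} => (· < ·)) b' b := by
  have hiM : (i : ℕ) < M := i.2
  obtain ⟨v, u, u', s, hv, hu, hpu, huu⟩ := exists_unit_factor h.prime M hdvd
  obtain ⟨f, hf⟩ := exists_eq_eval_add (1 + p * e) Q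
  rw [hu] at hf
  have h1 := congrArg (eval 1) hf
  simp only [eval_add, eval_mul, eval_sub, eval_X, eval_intCast, Int.cast_id, hQ1] at h1
  obtain ⟨v, rfl⟩ : ∃ v', v = v' + 1 := by
    rcases v with _ | v
    · exact absurd ⟨q + e * f.eval 1, by rw [pow_zero, one_mul] at h1; linear_combination -h1⟩ hpu
    · exact ⟨v, rfl⟩
  have h2 : q + e * f.eval 1 = (p : ℤ) ^ v * u := by
    apply mul_left_cancel₀ (show (p : ℤ) ≠ 0 by exact_mod_cast h.prime.ne_zero)
    linear_combination h1
  have h2' : (q : ℤ[X]) + e * ((f.eval 1 : ℤ) : ℤ[X]) = (p : ℤ[X]) ^ v * u := by exact_mod_cast h2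
  have huu' : (u : ℤ[X]) * (u' : ℤ[X]) + (p : ℤ[X]) ^ M * (s : ℤ[X]) = 1 := by exact_mod_cast huu
  have hpow : (p : ℤ[X]) ^ (i : ℕ) = (p : ℤ[X]) ^ ((i : ℕ) - v) * (p : ℤ[X]) ^ v := by
    rw [← pow_add]; congr 1; omega
  set r : ℤ[X] := (p : ℤ[X]) ^ ((i : ℕ) - v) * u' with hr'
  have hεi := hr.level i
  refine ⟨_, e, α + (r * f) • ε i, δ + (r * Q) • ε i, ε + Pi.single (i : ℕ) (-ε i)
    + Pi.single M (((p : ℤ[X]) ^ (i : ℕ) * s) • ε i),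
    ⟨?_, level_update (i := i) ?_ ?_, hr.le_update i⟩, lex_update b i hi⟩
  · push_cast at hf
    have := hr.core.move (b := a) (w := (r * f) • ε i) (η := (r * Q) • ε i)
      (y := (-(p : ℤ[X]) ^ (i : ℕ) * u * u' + e * r * f) • ε i) (by
        have key : (X - 1 : ℤ[X]) * (r * f) = r * Q
            + p * (-(p : ℤ[X]) ^ (i : ℕ) * u * u' + e * r * f) := by
          rw [hf, hr']
          linear_combination ((p : ℤ[X]) * u * u') * hpow
        have key' := congrArg (· • ε (i : ℕ)) key
        linear_combination (norm := module) key') (by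
        have e1 := hQN _ hεi
        have e2 := smul_of_fixed f (X_sub_one_smul_nm (h.per (ε i)))
        have e3 : r * (q : ℤ[X]) + (-(p : ℤ[X]) ^ (i : ℕ) * u * u'
            + e * r * ((f.eval 1 : ℤ) : ℤ[X])) = 0 := by
          rw [hr']
          linear_combination ((p : ℤ[X]) ^ ((i : ℕ) - v) * u') * h2' - (u : ℤ[X]) * (u' : ℤ[X]) * hpow
        have e4 := congrArg (· • nm p 0 n • ε (i : ℕ)) e3
        simp only [zero_smul] at e4
        linear_combination (norm := module) r • e1 + ((e : ℤ[X]) * r) • e2 + e4) le_rfl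
        (by
          rw [hQ] at hεi
          rw [smul_add, hr.core.level]
          linear_combination (norm := module) r • hεi)
    convert this using 1
    rw [wsum_add, wsum_add, wsum_single i.2.le, wsum_single le_rfl]
    have key' := congrArg (fun f => ((p : ℤ[X]) ^ (i : ℕ) * f) • ε (i : ℕ)) huu'
    linear_combination (norm := module) key'
  · have hM : (i : ℕ) ≠ M := hiM.ne
    simp [hM]
  · intro k hk
    have hk' : (k : ℕ) ≠ i := fun h => hk (Fin.ext h)
    have hkM : (k : ℕ) ≠ M := k.2.ne
    simpa [hk', hkM] using hr.level k

end Rep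

end CycData

end

end

section

namespace CycData

variable {A : Type v} [AddCommGroup A] [Module ℤ[X] A] {p n : ℕ} {ξ : A}

/-- A system of generators of prescribed levels that cannot be lowered. -/
structure Good (p n : ℕ) (ξ : A) {M : ℕ} (a : Fin (M + 1) → WithBot ℕ) (e : ℤ) (α : A)
    (g : ℕ → A) : Prop where
  core : Core p n ξ (a 0) α (g 0) ((e : ℤ[X]) • α + wsum p M (fun k => g (k + 1)))
  level : ∀ j : Fin (M + 1), lev p (a j) • g j = 0
  le : ∀ j, a j ≤ n
  order : ∀ i j : Fin (M + 1), j < i → a i ≠ ⊥ → (a j ≠ ⊥ ∨ j = 0) →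
    a j < a i ∧ ∃ Q, lev p (a i) = lev p (a j) * Q ∧
      (p : ℤ) ^ ((i : ℕ) - j + 1) ∣ Q.eval (1 + p * e)
  norm_ne : ∀ (j : Fin (M + 1)) (s : ℕ), a j = s → s < n → ∀ γ x : A, lv p (s + 1) • γ = 0 →
    (X - 1 : ℤ[X]) • x = 0 → nm p 0 s • g j ≠ nm p 0 (s + 1) • γ + (p : ℤ[X]) • x
  norm_ne_top : ∀ j : Fin (M + 1), a j = n → ∀ (c : ℤ) (x : A), (X - 1 : ℤ[X]) • x = 0 →
    nm p 0 n • g j ≠ (c : ℤ[X]) • nm p 0 n • α + (p : ℤ[X]) • x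

theorem Good.rel {M : ℕ} {a : Fin (M + 1) → WithBot ℕ} {e : ℤ} {α : A} {g : ℕ → A}
    (hg : Good p n ξ a e α g) :
    (X - (1 + (p : ℤ[X]) * (e : ℤ[X]))) • α
      = ∑ j ∈ Finset.range (M + 2), (p : ℤ[X]) ^ j • g j := by
  rw [Finset.sum_range_succ']
  have h1 := hg.core.rel
  have h2 : ∑ k ∈ Finset.range (M + 1), (p : ℤ[X]) ^ (k + 1) • g (k + 1)
      = (p : ℤ[X]) • wsum p M (fun k => g (k + 1)) := by
    rw [wsum, Finset.smul_sum]
    exact Finset.sum_congr rfl fun k _ => by rw [pow_succ', mul_smul]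
  rw [h2, pow_zero]
  linear_combination (norm := module) h1

theorem exists_rep (h : CycData A p n ξ) (M : ℕ) {a : WithBot ℕ} {α δ ρ : A}
    (hc : Core p n ξ a α δ ρ) : ∃ b e α δ ε, Rep p n ξ M a b e α δ (ε : ℕ → A) := by
  refine ⟨fun _ => n, 0, α, δ, Pi.single 0 ρ, ⟨?_, fun k => h.per _, fun _ => le_rfl⟩⟩
  convert hc using 1
  rw [wsum_single (Nat.zero_le M)]
  simp

theorem exists_good (h : CycData A p n ξ) (M : ℕ) :
    ∃ (a : Fin (M + 1) → WithBot ℕ) (e : ℤ) (α : A) (g : ℕ → A), Good p n ξ a e α g := by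
  obtain ⟨a, ⟨α₀, δ₀, ρ₀, hc₀⟩, hmin⟩ := (wellFounded_lt (α := WithBot ℕ)).has_min
    {a | ∃ α δ ρ : A, Core p n ξ a α δ ρ} h.exists_core
  have hwf : WellFounded (Pi.Lex (· < ·) (fun {_ : Fin M} => (· < ·))
      : (Fin M → WithBot ℕ) → (Fin M → WithBot ℕ) → Prop) :=
    Pi.Lex.wellFounded _ (fun _ => wellFounded_lt)
  obtain ⟨b, ⟨e, α, δ, ε, hr⟩, hminb⟩ := hwf.has_min
    {b | ∃ e α δ ε, Rep p n ξ M a b e α δ (ε : ℕ → A)} (h.exists_rep M hc₀)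
  have hlex : ¬ ∃ b' e' α' δ' ε', Rep p n ξ M a b' e' α' δ' (ε' : ℕ → A) ∧
      Pi.Lex (· < ·) (fun {_} => (· < ·)) b' b := by
    rintro ⟨b', e', α', δ', ε', hr', hl⟩
    exact hminb b' ⟨e', α', δ', ε', hr'⟩ hl
  refine ⟨Fin.cons a b, e, α, fun k => Nat.casesOn (motive := fun _ => A) k δ ε,
    ⟨hr.core, ?_, ?_, ?_, ?_, ?_⟩⟩
  · refine Fin.cases ?_ fun k => ?_
    · exact hr.core.level
    · simpa using hr.level k
  · refine Fin.cases ?_ fun k => ?_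
    · exact hr.core.lt.le
    · simpa using hr.le k
  · refine Fin.cases (fun j hj => absurd hj (Fin.not_lt_zero j)) fun i => ?_
    refine Fin.cases (fun _ hi _ => ?_) fun j hij hi hj => ?_
    · simp only [Fin.cons_succ] at hi
      have hlt : a < b i := by
        by_contra hle
        exact hlex (hr.exists_lex_of_le_head h hi (not_lt.1 hle))
      refine ⟨hlt, ?_⟩
      obtain ⟨Q, q, hQ, hQ1, hQN⟩ := Rep.exists_quotient h hlt hr.core.lt (hr.le i)
      refine ⟨Q, hQ, ?_⟩
      by_contra hd
      exact hlex (hr.exists_lex_of_not_dvd_head h hi hQ hQ1 hQN hd)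
    · have hj' := hj.resolve_right (Fin.succ_ne_zero j)
      simp only [Fin.cons_succ] at hi hj' ⊢
      have hij' : j < i := Fin.succ_lt_succ_iff.1 hij
      have hlt : b j < b i := by
        by_contra hle
        exact hlex (hr.exists_lex_of_le hij' hi (not_lt.1 hle))
      refine ⟨hlt, ?_⟩
      obtain ⟨Q, hQ⟩ := lev_dvd_lev (p := p) hlt.le
      refine ⟨Q, hQ, ?_⟩
      by_contra hd
      refine hlex (hr.exists_lex_of_not_dvd h hij' hi hQ ?_)
      simpa using hd
  · refine Fin.cases (fun s hs hsn γ x hγ hx hE => ?_) fun j s hs hsn γ x hγ hx hE => ?_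
    · simp only [Fin.cons_zero] at hs
      subst hs
      obtain ⟨t, γ', w, κ, ht, hκ, hδ, hN⟩ := h.exists_lower hsn hr.core.level hγ hx hE
      refine hmin t ⟨_, _, _, hr.core.move (b := t) (w := -w) (η := κ - δ) (y := γ') ?_ hN
        ht.le ?_⟩ ht
      · rw [hδ]; module
      · rw [add_sub_cancel]; exact hκ
    · simp only [Fin.cons_succ] at hs
      have hl := hr.level j
      rw [hs] at hl
      obtain ⟨t, γ', w, κ, ht, hκ, hδ, hN⟩ := h.exists_lower (ε := ε j) hsn hl hγ hx hE
      refine hlex (hr.exists_lex_of_lower h (j := j) (t := t) (c := 0) (hs ▸ ht) hκ (γ := γ')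
        (w := w) ?_)
      rw [hδ]; push_cast; module
  · refine Fin.cases (fun hs => ?_) fun j hs c x hx hE => ?_
    · simp only [Fin.cons_zero] at hs
      exact absurd hs hr.core.lt.ne
    · simp only [Fin.cons_succ] at hs
      obtain ⟨t, w, κ, ht, hκ, hδ⟩ := hr.core.exists_lower_top h hx (ε := ε j) hE
      refine hlex (hr.exists_lex_of_lower h (j := j) (t := t) (c := c) (hs ▸ ht) hκ (γ := 0)
        (w := w) ?_)
      rw [hδ]; module

end CycData

end

section

open scoped TensorProduct

/-- A family which is a basis modulo `p` of an elementary abelian `p`-group. -/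
structure IsZBasis (p : ℕ) {B : Type v} [AddCommGroup B] {κ : Type w} (f : κ → B) : Prop where
  indep : ∀ c : κ →₀ ℤ, Finsupp.linearCombination ℤ f c = 0 → ∀ k, (p : ℤ) ∣ c k
  span : ∀ x : B, ∃ c : κ →₀ ℤ, Finsupp.linearCombination ℤ f c = x

section

variable {p : ℕ} {B : Type v} [AddCommGroup B] {κ : Type w} {f : κ → B}

theorem linearCombination_intCast [Module (ZMod p) B] (f : κ → B) (c : κ →₀ ℤ) :
    Finsupp.linearCombination (ZMod p) f (c.mapRange (Int.cast : ℤ → ZMod p) Int.cast_zero)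
      = Finsupp.linearCombination ℤ f c := by
  rw [Finsupp.linearCombination_apply, Finsupp.linearCombination_apply,
    Finsupp.sum_mapRange_index (by simp)]
  simp only [Int.cast_smul_eq_zsmul]

theorem linearIndependent_zmod [Module (ZMod p) B]
    (hf : ∀ c : κ →₀ ℤ, Finsupp.linearCombination ℤ f c = 0 → ∀ k, (p : ℤ) ∣ c k) :
    LinearIndependent (ZMod p) f := by
  rw [linearIndependent_iff]
  intro l hl
  obtain ⟨c, rfl⟩ := Finsupp.mapRange_surjective (Int.cast : ℤ → ZMod p) Int.cast_zero
    ZMod.intCast_surjective l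
  rw [linearCombination_intCast] at hl
  ext k
  simpa using (ZMod.intCast_zmod_eq_zero_iff_dvd _ _).2 (hf c hl k)

theorem exists_isZBasis_extension_of_module [Module (ZMod p) B] (hp : p.Prime)
    (hf : ∀ c : κ →₀ ℤ, Finsupp.linearCombination ℤ f c = 0 → ∀ k, (p : ℤ) ∣ c k) :
    ∃ (ι : Type v) (g : ι → B), IsZBasis p (Sum.elim f g) := by
  have : Fact p.Prime := ⟨hp⟩
  have hli := linearIndependent_zmod hf
  let b := Module.Basis.sumExtend hli
  have hb : ∀ k, b (Sum.inl k) = f k := fun k => by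
    simp only [b, Module.Basis.sumExtend, Module.Basis.reindex_apply, Module.Basis.extend_apply_self]
    rfl
  have hb' : Sum.elim f (fun t => b (Sum.inr t)) = b := by
    ext x; rcases x with x | x
    · exact (hb x).symm
    · rfl
  refine ⟨_, fun t => b (Sum.inr t), ?_⟩
  rw [hb']
  refine ⟨fun c hc k => ?_, fun x => ?_⟩
  · rw [← linearCombination_intCast (p := p)] at hc
    have := (linearIndependent_iff.1 b.linearIndependent) _ hc
    have := DFunLike.congr_fun this k
    exact (ZMod.intCast_zmod_eq_zero_iff_dvd _ _).1 (by simpa using this)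
  · obtain ⟨c, hc⟩ := Finsupp.mapRange_surjective (Int.cast : ℤ → ZMod p) Int.cast_zero
      ZMod.intCast_surjective (b.repr x)
    refine ⟨c, ?_⟩
    rw [← linearCombination_intCast (p := p), hc, b.linearCombination_repr]

theorem exists_isZBasis_extension (hp : p.Prime) (hB : ∀ x : B, p • x = 0)
    (hf : ∀ c : κ →₀ ℤ, Finsupp.linearCombination ℤ f c = 0 → ∀ k, (p : ℤ) ∣ c k) :
    ∃ (ι : Type v) (g : ι → B), IsZBasis p (Sum.elim f g) :=
  @exists_isZBasis_extension_of_module p B _ κ f (AddCommGroup.zmodModule hB) hp hf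

end

theorem IsZBasis.fpdim_of_module {p : ℕ} (hp : p.Prime) {Q : Type v} [CommGroup Q]
    [Module (ZMod p) (Additive Q)] {κ : Type w} {f : κ → Additive Q} (hf : IsZBasis p f) :
    Cardinal.lift.{w} (MSS.fpdim p Q) = Cardinal.lift.{v} (Cardinal.mk κ) := by
  have : Fact p.Prime := ⟨hp⟩
  have hli := linearIndependent_zmod hf.indep
  have hspan : ⊤ ≤ Submodule.span (ZMod p) (Set.range f) := by
    rintro x -
    obtain ⟨c, rfl⟩ := hf.span x
    rw [← linearCombination_intCast (p := p), ← Finsupp.range_linearCombination]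
    exact LinearMap.mem_range_self _ _
  let b := Module.Basis.mk hli hspan
  let F : Additive Q →+ TensorProduct ℤ (ZMod p) (Additive Q) :=
    (TensorProduct.mk ℤ (ZMod p) (Additive Q) 1).toAddMonoidHom
  let G : TensorProduct ℤ (ZMod p) (Additive Q) →ₗ[ℤ] Additive Q :=
    TensorProduct.lift (LinearMap.mk₂ ℤ (fun (z : ZMod p) (q : Additive Q) => z • q)
      (fun _ _ _ => add_smul _ _ _) (fun c z q => by rw [smul_assoc])
      (fun _ _ _ => smul_add _ _ _) (fun c z q => by rw [smul_comm]))
  let e : Additive Q ≃ₗ[ZMod p] TensorProduct ℤ (ZMod p) (Additive Q) :=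
    LinearEquiv.ofBijective (F.toZModLinearMap p) ⟨by
      apply Function.LeftInverse.injective (g := G)
      intro q
      exact (TensorProduct.lift.tmul _ _).trans (one_smul (ZMod p) q), by
      intro t
      induction t with
      | zero => exact ⟨0, map_zero _⟩
      | add x y hx hy =>
        obtain ⟨a, rfl⟩ := hx
        obtain ⟨b, rfl⟩ := hy
        exact ⟨a + b, map_add _ _ _⟩
      | tmul z q =>
        obtain ⟨z, rfl⟩ := ZMod.intCast_surjective z
        refine ⟨z • q, ?_⟩
        change (1 : ZMod p) ⊗ₜ[ℤ] (z • q) = (z : ZMod p) ⊗ₜ[ℤ] q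
        rw [← TensorProduct.smul_tmul, zsmul_one]⟩
  rw [MSS.fpdim, ← e.rank_eq]
  exact b.mk_eq_rank.symm

theorem IsZBasis.fpdim {p : ℕ} (hp : p.Prime) {Q : Type v} [CommGroup Q] {κ : Type w}
    {f : κ → Additive Q} (hB : ∀ x : Additive Q, p • x = 0) (hf : IsZBasis p f) :
    Cardinal.lift.{w} (MSS.fpdim p Q) = Cardinal.lift.{v} (Cardinal.mk κ) :=
  @IsZBasis.fpdim_of_module p hp Q _ (AddCommGroup.zmodModule hB) κ f hf

theorem exists_extension_fpdim {p : ℕ} (hp : p.Prime) {Q : Type v} [CommGroup Q]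
    (hQ : ∀ x : Additive Q, p • x = 0) {C : Type v} [AddCommGroup C] (ψ : C →+ Additive Q)
    (hψ : Function.Surjective ψ) {κ : Type} [Finite κ] (f : κ → C)
    (hf : ∀ c : κ →₀ ℤ, ψ (Finsupp.linearCombination ℤ f c) = 0 → ∀ k, (p : ℤ) ∣ c k) :
    ∃ (ι : Type v) (g : ι → C), IsZBasis p (fun k => ψ (Sum.elim f g k)) ∧
      Cardinal.mk ι + (Nat.card κ : Cardinal) = MSS.fpdim p Q := by
  have hψf : ∀ c : κ →₀ ℤ, ψ (Finsupp.linearCombination ℤ f c) =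
      Finsupp.linearCombination ℤ (fun k => ψ (f k)) c := fun c => by
    simp [Finsupp.linearCombination_apply, Finsupp.sum, map_sum]
  obtain ⟨ι, g', hg'⟩ := exists_isZBasis_extension (f := fun k => ψ (f k)) hp hQ
    (fun c hc => hf c ((hψf c).trans hc))
  choose g hg using fun t => hψ (g' t)
  have hb : IsZBasis p (fun k => ψ (Sum.elim f g k)) := by
    convert hg' using 1
    ext k
    rcases k with k | k
    · rfl
    · exact congrArg _ (hg k)
  refine ⟨ι, g, hb, ?_⟩
  have := hb.fpdim hp hQ
  have h2 : Cardinal.mk κ = (Nat.card κ : Cardinal) := (Nat.cast_card).symm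
  rw [Cardinal.mk_sum, Cardinal.lift_id'.{v, v}, h2] at this
  simpa [add_comm] using this.symm

end

section

variable {A : Type v} [AddCommGroup A] [Module ℤ[X] A] {p n : ℕ} {ξ : A}

/-- The step `N A_i + p A_0` of the norm filtration of `A_0`; the step `n + 1` is `p A_0`. -/
def normStep (A : Type v) [AddCommGroup A] [Module ℤ[X] A] (p n i : ℕ) : AddSubgroup A where
  carrier := {x | ∃ γ g : A, lv p i • γ = 0 ∧ (n < i → γ = 0) ∧ (X - 1 : ℤ[X]) • g = 0 ∧
    x = nm p 0 i • γ + (p : ℤ[X]) • g}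
  zero_mem' := ⟨0, 0, by simp⟩
  add_mem' := by
    rintro _ _ ⟨γ, g, h1, h2, h3, rfl⟩ ⟨γ', g', h1', h2', h3', rfl⟩
    refine ⟨γ + γ', g + g', by rw [smul_add, h1, h1', add_zero],
      fun h => by rw [h2 h, h2' h, add_zero], by rw [smul_add, h3, h3', add_zero], by module⟩
  neg_mem' := by
    rintro _ ⟨γ, g, h1, h2, h3, rfl⟩
    exact ⟨-γ, -g, by rw [smul_neg, h1, neg_zero], fun h => by rw [h2 h, neg_zero],
      by rw [smul_neg, h3, neg_zero], by module⟩

theorem mem_normStep {i : ℕ} {x : A} : x ∈ normStep A p n i ↔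
    ∃ γ g : A, lv p i • γ = 0 ∧ (n < i → γ = 0) ∧ (X - 1 : ℤ[X]) • g = 0 ∧
      x = nm p 0 i • γ + (p : ℤ[X]) • g := Iff.rfl

theorem nm_smul_mem_normStep {i : ℕ} (hi : i ≤ n) {γ : A} (hγ : lv p i • γ = 0) :
    nm p 0 i • γ ∈ normStep A p n i :=
  ⟨γ, 0, hγ, fun h => absurd hi h.not_ge, by simp, by simp⟩

theorem p_smul_mem_normStep (i : ℕ) {g : A} (hg : (X - 1 : ℤ[X]) • g = 0) :
    (p : ℤ[X]) • g ∈ normStep A p n i :=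
  ⟨0, g, by simp, fun _ => rfl, hg, by simp⟩

theorem nm_succ_smul (hp : 0 < p) (i : ℕ) (γ : A) :
    nm p 0 (i + 1) • γ = nm p 0 i • nm p i 1 • γ := by
  have := nm_mul_nm hp 0 i 1
  rw [zero_add] at this
  rw [← this, mul_smul]

theorem lv_smul_nm_smul {i : ℕ} {γ : A} (h : lv p (i + 1) • γ = 0) :
    lv p i • nm p i 1 • γ = 0 := by rw [← mul_smul, lv_mul_nm, h]

theorem normStep_succ_le (hp : 0 < p) (i : ℕ) : normStep A p n (i + 1) ≤ normStep A p n i := by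
  rintro _ ⟨γ, g, h1, h2, h3, rfl⟩
  exact ⟨nm p i 1 • γ, g, lv_smul_nm_smul h1, fun h => by rw [h2 (by omega), smul_zero], h3,
    by rw [nm_succ_smul hp]⟩

theorem normStep_antitone (hp : 0 < p) : Antitone (normStep A p n) :=
  antitone_nat_of_succ_le (normStep_succ_le hp)

theorem mem_normStep_top {x : A} : x ∈ normStep A p n (n + 1) ↔
    ∃ g : A, (X - 1 : ℤ[X]) • g = 0 ∧ x = (p : ℤ[X]) • g := by
  constructor
  · rintro ⟨γ, g, -, h2, h3, rfl⟩
    exact ⟨g, h3, by rw [h2 n.lt_succ_self, smul_zero, zero_add]⟩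
  · rintro ⟨g, h, rfl⟩
    exact p_smul_mem_normStep _ h

/-- The norm polynomial of a level in `{-∞, 0, 1, …}`. -/
noncomputable def nlev (p : ℕ) (a : WithBot ℕ) : ℤ[X] := WithBot.recBotCoe 0 (nm p 0) a

@[simp] theorem nlev_bot (p : ℕ) : nlev p ⊥ = 0 := rfl

@[simp] theorem nlev_coe (p k : ℕ) : nlev p (k : WithBot ℕ) = nm p 0 k := rfl

/-- A family of elements of prescribed levels whose norms form a basis of the graded pieces of the
norm filtration. -/
structure Graded (p n : ℕ) {Γ : Type w} (lvl : Γ → WithBot ℕ) (gv : Γ → A) : Prop where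
  level : ∀ t, lev p (lvl t) • gv t = 0
  le : ∀ t, lvl t ≤ n
  indep : ∀ i ≤ n, ∀ c : Γ →₀ ℤ, (∀ t, c t ≠ 0 → lvl t = i) →
    nm p 0 i • Finsupp.linearCombination ℤ gv c ∈ normStep A p n (i + 1) → ∀ t, (p : ℤ) ∣ c t
  span : ∀ i ≤ n, ∀ γ : A, lv p i • γ = 0 → ∃ c : Γ →₀ ℤ, (∀ t, c t ≠ 0 → lvl t = i) ∧
    nm p 0 i • γ - nm p 0 i • Finsupp.linearCombination ℤ gv c ∈ normStep A p n (i + 1)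

section generation

variable {Γ : Type w} {lvl : Γ → WithBot ℕ} {gv : Γ → A}

theorem linearCombination_int_mem (B : Submodule ℤ[X] A) (hB : ∀ t, gv t ∈ B) (c : Γ →₀ ℤ) :
    Finsupp.linearCombination ℤ gv c ∈ B := by
  rw [Finsupp.linearCombination_apply]
  exact Submodule.sum_mem _ fun t _ => B.toAddSubgroup.zsmul_mem (hB t) _

theorem smul_linearCombination_int {f : ℤ[X]} {c : Γ →₀ ℤ} (h : ∀ t, c t ≠ 0 → f • gv t = 0) :
    f • Finsupp.linearCombination ℤ gv c = 0 := by
  rw [Finsupp.linearCombination_apply, Finsupp.sum, Finset.smul_sum]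
  refine Finset.sum_eq_zero fun t ht => ?_
  rw [smul_comm, h t (Finsupp.mem_support_iff.1 ht), smul_zero]

theorem Graded.exists_norm_eq (hp : 0 < p) (hG : Graded p n lvl gv) (B : Submodule ℤ[X] A)
    (hB : ∀ t, gv t ∈ B) (k i : ℕ) (hk : n + 1 = i + k) {f : A} (hf : f ∈ normStep A p n i) :
    ∃ b ∈ B, ∃ g : A, lv p i • b = 0 ∧ (n < i → b = 0) ∧ (X - 1 : ℤ[X]) • g = 0 ∧
      f = nm p 0 i • b + (p : ℤ[X]) • g := by
  induction k generalizing i f with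
  | zero =>
    obtain rfl : i = n + 1 := hk.symm
    obtain ⟨g, hg, rfl⟩ := mem_normStep_top.1 hf
    exact ⟨0, B.zero_mem, g, by simp, fun _ => rfl, hg, by simp⟩
  | succ k ih =>
    obtain ⟨γ, g, h1, h2, h3, rfl⟩ := hf
    have hi : i ≤ n := by omega
    obtain ⟨c, hc, hm⟩ := hG.span i hi γ h1
    obtain ⟨b, hb, g', hb1, -, hg', he⟩ := ih (i + 1) (by omega) hm
    refine ⟨Finsupp.linearCombination ℤ gv c + nm p i 1 • b,
      B.add_mem (linearCombination_int_mem B hB c) (B.smul_mem _ hb), g + g', ?_,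
      fun h => absurd hi h.not_ge, by rw [smul_add, h3, hg', add_zero], ?_⟩
    · rw [smul_add, lv_smul_nm_smul hb1, add_zero]
      refine smul_linearCombination_int fun t ht => ?_
      rw [← lev_coe, ← hc t ht, hG.level t]
    · rw [nm_succ_smul hp] at he
      linear_combination (norm := module) he

theorem Graded.exists_sub_p_smul (h : CycData A p n ξ) (hG : Graded p n lvl gv)
    (B : Submodule ℤ[X] A) (hB : ∀ t, gv t ∈ B) (i : ℕ) (hi : i ≤ n) (x : A)
    (hx : lv p i • x = 0) : ∃ b ∈ B, ∃ y : A, x = b + (p : ℤ[X]) • y := by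
  have hp := h.prime
  induction i generalizing x with
  | zero =>
    obtain ⟨b, hb, g, -, -, -, he⟩ := hG.exists_norm_eq hp.pos B hB (n + 1) 0 (by omega)
      (nm_smul_mem_normStep (Nat.zero_le n) hx)
    exact ⟨b, hb, g, by simpa using he⟩
  | succ s ih =>
    have step : ∀ k : ℕ, ∀ x : A, lv p (s + 1) • x = 0 → ∃ b ∈ B, ∃ y w : A,
        lv p (s + 1) • w = 0 ∧ x = b + (p : ℤ[X]) • y + (X - 1 : ℤ[X]) ^ k • w := by
      intro k
      induction k with
      | zero => exact fun x hx => ⟨0, B.zero_mem, 0, x, hx, by simp⟩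
      | succ k ihk =>
        intro x hx
        obtain ⟨b, hb, y, w, hw, rfl⟩ := ihk x hx
        obtain ⟨b', hb', g, hb1, -, hg, he⟩ := hG.exists_norm_eq hp.pos B hB (n - s) (s + 1)
          (by omega) (nm_smul_mem_normStep hi hw)
        obtain ⟨w', κ, hw', hκ, -, he'⟩ := h.exists_of_norm_succ (s := s) (η := w - b') (g := g)
          hi (by rw [smul_sub, hw, hb1, sub_zero]) hg (by
            rw [smul_sub, he, add_sub_cancel_left])
        obtain ⟨b₂, hb₂, y₂, rfl⟩ := ih (by omega) κ hκ
        refine ⟨b + (X - 1 : ℤ[X]) ^ k • (b' + b₂), B.add_mem hb (B.smul_mem _ (B.add_mem hb' hb₂)),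
          y + (X - 1 : ℤ[X]) ^ k • y₂, w', hw', ?_⟩
        rw [sub_eq_iff_eq_add.1 he', pow_succ]
        module
    obtain ⟨b, hb, y, w, hw, rfl⟩ := step (p ^ (s + 1)) x hx
    obtain ⟨r, hr⟩ := exists_lv_eq hp (s + 1)
    refine ⟨b, hb, y - r • w, ?_⟩
    rw [hr, add_smul] at hw
    linear_combination (norm := module) hw

theorem Graded.exists_sub_pow_smul (h : CycData A p n ξ) (hG : Graded p n lvl gv) (m : ℕ) (x : A) :
    ∃ (z : Γ →₀ ℤ[X]) (y : A), x = Finsupp.linearCombination ℤ[X] gv z + (p : ℤ[X]) ^ m • y := by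
  induction m generalizing x with
  | zero => exact ⟨0, x, by simp⟩
  | succ m ih =>
    obtain ⟨z, y, rfl⟩ := ih x
    obtain ⟨_, ⟨z', rfl⟩, y', hy⟩ := hG.exists_sub_p_smul h
      (LinearMap.range (Finsupp.linearCombination ℤ[X] gv))
      (fun t => ⟨Finsupp.single t 1, by simp⟩) n le_rfl y (h.per y)
    refine ⟨z + (p : ℤ[X]) ^ m • z', y', ?_⟩
    rw [map_add, map_smul, hy, pow_succ]
    module

end generation

section independence

variable {Γ : Type w} {lvl : Γ → WithBot ℕ} {gv : Γ → A}

theorem Graded.dvd_of_sum (hp : 0 < p) (hG : Graded p n lvl gv) {c : Γ →₀ ℤ}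
    (hc : ∀ t, c t ≠ 0 → lvl t ≠ ⊥)
    (hs : Finsupp.linearCombination ℤ (fun t => nlev p (lvl t) • gv t) c ∈ normStep A p n (n + 1)) :
    ∀ t, (p : ℤ) ∣ c t := by
  classical
  have hlev : ∀ t (i : ℕ), lvl t = i → i ≤ n := fun t i ht => by
    have := hG.le t
    rw [ht] at this
    exact_mod_cast this
  have hmem : ∀ t (i : ℕ), lvl t = i → nlev p (lvl t) • gv t ∈ normStep A p n i := by
    intro t i ht
    have := hG.level t
    rw [ht, lev_coe] at this
    rw [ht, nlev_coe]
    exact nm_smul_mem_normStep (hlev t i ht) this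
  have key : ∀ i : ℕ, i ≤ n + 1 → ∀ t, lvl t < i → (p : ℤ) ∣ c t := by
    intro i
    induction i with
    | zero =>
      intro _ t ht
      by_contra h0
      rcases withBot_cases (lvl t) with h | ⟨k, h⟩
      · exact hc t (fun h' => h0 (h' ▸ dvd_zero _)) h
      · rw [h] at ht
        exact absurd (show k < 0 by exact_mod_cast ht) (Nat.not_lt_zero k)
    | succ i ih =>
      intro hi t ht
      have ih := ih (by omega)
      rcases withBot_cases (lvl t) with h | ⟨k, h⟩
      · exact ih t (h ▸ WithBot.bot_lt_coe i)
      rw [h] at ht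
      have hki : k < i + 1 := by exact_mod_cast ht
      rcases Nat.lt_succ_iff_lt_or_eq.1 hki with hlt | rfl
      · exact ih t (by rw [h]; exact_mod_cast hlt)
      let c' : Γ →₀ ℤ := c.filter (fun t => lvl t = (k : WithBot ℕ))
      have hc' : ∀ t, c' t ≠ 0 → lvl t = (k : WithBot ℕ) := fun t ht => by
        by_contra h'
        exact ht (Finsupp.filter_apply_neg _ _ h')
      have hsum := Finsupp.filter_add_filter_not c (fun t => lvl t = (k : WithBot ℕ))
      have hrest : Finsupp.linearCombination ℤ (fun t => nlev p (lvl t) • gv t)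
          (c.filter (fun t => ¬ lvl t = (k : WithBot ℕ))) ∈ normStep A p n (k + 1) := by
        rw [Finsupp.linearCombination_apply]
        refine AddSubgroup.sum_mem _ fun t ht => ?_
        have hne : lvl t ≠ (k : WithBot ℕ) := by
          by_contra h'
          exact (Finsupp.mem_support_iff.1 ht) (Finsupp.filter_apply_neg _ _ (not_not.2 h'))
        rw [Finsupp.filter_apply_pos (fun t => ¬ lvl t = (k : WithBot ℕ)) _ hne]
        change c t • nlev p (lvl t) • gv t ∈ _
        rcases withBot_cases (lvl t) with h' | ⟨l, h'⟩
        · rw [h']; simp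
        rcases lt_trichotomy l k with hl | rfl | hl
        · obtain ⟨u, hu⟩ := ih t (by rw [h']; exact_mod_cast hl)
          have h1 : (X - 1 : ℤ[X]) • nlev p (lvl t) • gv t = 0 := by
            have := hG.level t
            rw [h', lev_coe] at this
            rw [h', nlev_coe, X_sub_one_smul_nm this]
          have : (c t) • nlev p (lvl t) • gv t = (p : ℤ[X]) • (u • nlev p (lvl t) • gv t) := by
            rw [hu, mul_smul]
            norm_cast
          rw [this]
          exact p_smul_mem_normStep _ (by rw [smul_comm, h1, smul_zero])
        · exact absurd h' hne
        · exact AddSubgroup.zsmul_mem _ (normStep_antitone hp (show k + 1 ≤ l from hl) (hmem t l h')) _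
      have hmain : nm p 0 k • Finsupp.linearCombination ℤ gv c' ∈ normStep A p n (k + 1) := by
        have heq : nm p 0 k • Finsupp.linearCombination ℤ gv c'
            = Finsupp.linearCombination ℤ (fun t => nlev p (lvl t) • gv t) c' := by
          rw [Finsupp.linearCombination_apply, Finsupp.linearCombination_apply, Finsupp.sum,
            Finsupp.sum, Finset.smul_sum]
          refine Finset.sum_congr rfl fun t ht => ?_
          rw [hc' t (Finsupp.mem_support_iff.1 ht), nlev_coe, smul_comm]
        have h2 := normStep_antitone hp (show k + 1 ≤ n + 1 by omega) hs
        rw [← hsum, map_add] at h2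
        rw [heq]
        exact (AddSubgroup.add_mem_cancel_right _ hrest).1 h2
      have := hG.indep k (by omega) c' hc' hmain t
      rwa [Finsupp.filter_apply_pos (fun t => lvl t = (k : WithBot ℕ)) _ h] at this
  exact fun t => key (n + 1) le_rfl t (lt_of_le_of_lt (hG.le t) (by exact_mod_cast n.lt_succ_self))

end independence

end

section

variable {A : Type v} [AddCommGroup A] [Module ℤ[X] A] {p n : ℕ} {ξ : A}

/-- The submodule `p A`. -/
noncomputable def pSub (A : Type v) [AddCommGroup A] [Module ℤ[X] A] (p : ℕ) : Submodule ℤ[X] A :=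
  LinearMap.range (LinearMap.lsmul ℤ[X] A (p : ℤ[X]))

theorem mem_pSub {x : A} : x ∈ pSub A p ↔ ∃ y : A, x = (p : ℤ[X]) • y :=
  ⟨fun ⟨y, h⟩ => ⟨y, h.symm⟩, fun ⟨y, h⟩ => ⟨y, h.symm⟩⟩

theorem p_smul_mem_pSub (x : A) : (p : ℤ[X]) • x ∈ pSub A p := mem_pSub.2 ⟨x, rfl⟩

theorem smul_mem_pSub_of_augIdeal {l : ℕ} {f : ℤ[X]} (hf : f ∈ augIdeal p l) {x : A}
    (hx : (X - 1 : ℤ[X]) ^ l • x ∈ pSub A p) : f • x ∈ pSub A p := by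
  obtain ⟨B, C, rfl⟩ := mem_augIdeal.1 hf
  rw [add_smul, mul_smul, mul_comm _ C, mul_smul]
  exact add_mem (p_smul_mem_pSub _) (Submodule.smul_mem _ _ hx)

/-- A graded family containing a given good system of generators. -/
structure Pres (p n : ℕ) (ξ : A) {M : ℕ} (a : Fin (M + 1) → WithBot ℕ) (e : ℤ) (α : A)
    (g : ℕ → A) {Γ : Type w} (lvl : Γ → WithBot ℕ) (gv : Γ → A) (y : Γ) (x : Fin (M + 1) → Γ) :
    Prop where
  data : CycData A p n ξ
  good : CycData.Good p n ξ a e α g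
  graded : Graded p n lvl gv
  gv_y : gv y = α
  lvl_y : lvl y = n
  gv_x : ∀ j, gv (x j) = g j
  lvl_x : ∀ j, lvl (x j) = a j
  x_ne : ∀ j, x j ≠ y

/-- The module of relations of the presentation. -/
noncomputable def relModule (p : ℕ) {M : ℕ} (e : ℤ) {Γ : Type w} (lvl : Γ → WithBot ℕ) (y : Γ)
    (x : Fin (M + 1) → Γ) : Submodule ℤ[X] (Γ →₀ ℤ[X]) :=
  Submodule.span ℤ[X] (insert (Finsupp.single y (X - (1 + (p : ℤ[X]) * (e : ℤ[X])))
    - ∑ j : Fin (M + 1), Finsupp.single (x j) ((p : ℤ[X]) ^ (j : ℕ)))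
    (Set.range fun t => Finsupp.single t (lev p (lvl t))))

namespace Pres

variable {M : ℕ} {a : Fin (M + 1) → WithBot ℕ} {e : ℤ} {α : A} {g : ℕ → A} {Γ : Type w}
  {lvl : Γ → WithBot ℕ} {gv : Γ → A} {y : Γ} {x : Fin (M + 1) → Γ}

theorem exists_leading {f : ℤ[X]} {l : ℕ} (hp : 0 < p) (hf : (X - 1) * f ∈ augIdeal p l) :
    ∃ c : ℤ, (f = 0 → c = 0) ∧ (l = 0 → c = 0) ∧
      f - (c : ℤ[X]) * (X - 1) ^ (l - 1) ∈ augIdeal p l := by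
  rcases eq_or_ne f 0 with rfl | hf0
  · exact ⟨0, by simp⟩
  rcases l with _ | l
  · refine ⟨0, by simp, by simp, mem_augIdeal.2 ⟨0, f, by simp⟩⟩
  · obtain ⟨B, C, rfl⟩ := mem_augIdeal.1 (augIdeal_cancel hp hf)
    obtain ⟨D, hD⟩ := exists_eq_eval_one_add C
    refine ⟨C.eval 1, fun h => absurd h hf0, by simp, mem_augIdeal.2 ⟨B, D, ?_⟩⟩
    rw [Nat.add_sub_cancel]
    linear_combination (X - 1) ^ l * hD

theorem X_sub_one_pow_smul_mem (hp : p.Prime) {b : WithBot ℕ} {u : A} (hu : lev p b • u = 0) :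
    (X - 1 : ℤ[X]) ^ len p b • u ∈ pSub A p := by
  obtain ⟨r, hr⟩ := exists_lev_eq hp b
  refine mem_pSub.2 ⟨-(r • u), ?_⟩
  rw [hr] at hu
  linear_combination (norm := module) hu

theorem X_sub_one_pow_pred_smul (hp : p.Prime) {b : WithBot ℕ} (hb : b ≠ ⊥) (u : A) :
    (X - 1 : ℤ[X]) ^ (len p b - 1) • u - nlev p b • u ∈ pSub A p := by
  obtain ⟨k, rfl⟩ := (withBot_cases b).resolve_left hb
  obtain ⟨r, hr⟩ := exists_nm_eq hp k
  refine mem_pSub.2 ⟨-(r • u), ?_⟩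
  rw [nlev_coe, hr, len_coe]
  module

theorem X_sub_one_smul_nlev {b : WithBot ℕ} {u : A} (hu : lev p b • u = 0) :
    (X - 1 : ℤ[X]) • nlev p b • u = 0 := by
  rcases withBot_cases b with rfl | ⟨k, rfl⟩
  · simp
  · exact X_sub_one_smul_nm hu

theorem rel_mem (h : Pres p n ξ a e α g lvl gv y x) :
    (X - 1 : ℤ[X]) • α - g 0 ∈ pSub A p :=
  mem_pSub.2 ⟨_, sub_eq_iff_eq_add'.2 h.good.core.rel⟩

open Classical in
theorem mem_augIdeal_of_mul (h : Pres p n ξ a e α g lvl gv y x) {z : Γ →₀ ℤ[X]}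
    (hz0 : z (x 0) = 0) (hz : Finsupp.linearCombination ℤ[X] gv z ∈ pSub A p)
    (hzt : ∀ t, t ≠ y → (X - 1) * z t ∈ augIdeal p (len p (lvl t)))
    (hzy : (X - 1) * z y ∈ augIdeal p (len p (a 0) + 1)) :
    (∀ t, t ≠ y → z t ∈ augIdeal p (len p (lvl t))) ∧ z y ∈ augIdeal p (len p (a 0) + 1) := by
  have hp := h.data.prime
  let ℓ : Γ → ℕ := fun t => if t = y then len p (a 0) + 1 else len p (lvl t)
  have hℓy : ℓ y = len p (a 0) + 1 := if_pos rfl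
  have hℓ : ∀ t, t ≠ y → ℓ t = len p (lvl t) := fun t ht => if_neg ht
  have hz' : ∀ t, (X - 1) * z t ∈ augIdeal p (ℓ t) := fun t => by
    by_cases ht : t = y
    · rw [ht, hℓy]; exact hzy
    · rw [hℓ t ht]; exact hzt t ht
  choose c₀ hc0 hcl hc using fun t => exists_leading hp.pos (hz' t)
  let c : Γ →₀ ℤ := Finsupp.onFinset z.support c₀ fun t ht =>
    Finsupp.mem_support_iff.2 fun h0 => ht (hc0 t h0)
  have hcc : ∀ t, c t = c₀ t := fun _ => rfl
  suffices hdvd : ∀ t, (p : ℤ) ∣ c t by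
    have hfin : ∀ t, z t ∈ augIdeal p (ℓ t) := fun t => by
      obtain ⟨u, hu⟩ := hdvd t
      rw [hcc] at hu
      have := hc t
      rw [hu] at this
      push_cast at this
      rw [mul_assoc] at this
      exact (Submodule.sub_mem_iff_left _ (p_mul_mem_augIdeal p _ _)).1 this
    exact ⟨fun t ht => hℓ t ht ▸ hfin t, hℓy ▸ hfin y⟩
  let τ : A := if a 0 = ⊥ then α else nlev p (a 0) • g 0
  let s : Γ → A := fun t => if t = y then τ else nlev p (lvl t) • gv t
  have hsy : s y = τ := if_pos rfl
  have hs : ∀ t, t ≠ y → s t = nlev p (lvl t) • gv t := fun t ht => if_neg ht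
  have htop : ∀ t, (X - 1 : ℤ[X]) ^ ℓ t • gv t ∈ pSub A p := fun t => by
    by_cases ht : t = y
    · rw [ht, hℓy, h.gv_y, pow_succ, mul_smul]
      have h1 := Submodule.smul_mem _ ((X - 1 : ℤ[X]) ^ len p (a 0)) h.rel_mem
      rw [smul_sub] at h1
      exact (Submodule.sub_mem_iff_left _ (X_sub_one_pow_smul_mem hp h.good.core.level)).1 h1
    · rw [hℓ t ht]
      exact X_sub_one_pow_smul_mem hp (h.graded.level t)
  have hpre : ∀ t, c₀ t ≠ 0 → (X - 1 : ℤ[X]) ^ (ℓ t - 1) • gv t - s t ∈ pSub A p := by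
    intro t hct
    by_cases ht : t = y
    · rw [ht, hℓy, h.gv_y, hsy, Nat.add_sub_cancel]
      by_cases ha : a 0 = ⊥
      · have : τ = α := if_pos ha
        rw [this, ha]
        simp
      · have : τ = nlev p (a 0) • g 0 := if_neg ha
        rw [this]
        have h0 : 0 < len p (a 0) := by
          have := len_lt_len hp (bot_lt_iff_ne_bot.2 ha)
          simpa using this
        have h1 := Submodule.smul_mem _ ((X - 1 : ℤ[X]) ^ (len p (a 0) - 1)) h.rel_mem
        rw [smul_sub, ← mul_smul, ← pow_succ, Nat.sub_add_cancel h0] at h1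
        have h2 := X_sub_one_pow_pred_smul hp ha (g 0)
        have := add_mem h1 h2
        rwa [sub_add_sub_cancel] at this
    · have hb : lvl t ≠ ⊥ := fun hb => hct (hcl t (by rw [hℓ t ht, hb]; rfl))
      rw [hs t ht, hℓ t ht]
      exact X_sub_one_pow_pred_smul hp hb _
  have hsum : Finsupp.linearCombination ℤ s c ∈ pSub A p := by
    have hdiff : Finsupp.linearCombination ℤ[X] gv z - Finsupp.linearCombination ℤ s c
        ∈ pSub A p := by
      rw [Finsupp.linearCombination_apply, Finsupp.linearCombination_apply, Finsupp.sum,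
        Finsupp.sum_of_support_subset c (s := z.support) (Finsupp.support_onFinset_subset) _
          (by simp), ← Finset.sum_sub_distrib]
      refine Submodule.sum_mem _ fun t _ => ?_
      rw [hcc]
      have h1 := smul_mem_pSub_of_augIdeal (hc t) (htop t)
      have h2 : (c₀ t : ℤ[X]) • ((X - 1 : ℤ[X]) ^ (ℓ t - 1) • gv t - s t) ∈ pSub A p := by
        by_cases h0 : c₀ t = 0
        · simp [h0]
        · exact Submodule.smul_mem _ _ (hpre t h0)
      have h3 := add_mem h1 h2
      convert h3 using 1
      rw [← Int.cast_smul_eq_zsmul ℤ[X]]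
      module
    exact (Submodule.sub_mem_iff_right _ hz).1 hdiff
  let LC := Finsupp.linearCombination ℤ (fun t => nlev p (lvl t) • gv t)
  have hLCfix : ∀ c, (X - 1 : ℤ[X]) • LC c = 0 := fun c => by
    rw [Finsupp.linearCombination_apply, Finsupp.sum, Finset.smul_sum]
    refine Finset.sum_eq_zero fun t _ => ?_
    rw [smul_comm, X_sub_one_smul_nlev (h.graded.level t), smul_zero]
  have hsplit : Finsupp.linearCombination ℤ s c = c y • τ + LC (c.erase y) := by
    have h1 : c = Finsupp.single y (c y) + c.erase y := (Finsupp.single_add_erase y c).symm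
    conv_lhs => rw [h1]
    rw [map_add, Finsupp.linearCombination_single, hsy]
    congr 1
    rw [Finsupp.linearCombination_apply, Finsupp.linearCombination_apply]
    refine Finsupp.sum_congr fun t ht => ?_
    have : t ≠ y := fun h' => by simp [h'] at ht
    rw [hs t this]
  have hcbot : ∀ t, t ≠ y → c t ≠ 0 → lvl t ≠ ⊥ := fun t ht h0 hb =>
    h0 (hcl t (by rw [hℓ t ht, hb]; rfl))
  have hcx : c (x 0) = 0 := hc0 _ hz0
  -- any fixed combination divisible by `p` has all its coefficients divisible by `p`
  have hfinal : ∀ c' : Γ →₀ ℤ, c' y = 0 → (∀ t, c' t ≠ 0 → lvl t ≠ ⊥) → LC c' ∈ pSub A p →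
      ∀ t, (p : ℤ) ∣ c' t := by
    intro c' hy' hb' hm t
    obtain ⟨w, hw⟩ := mem_pSub.1 hm
    obtain ⟨k, g', hg', hk⟩ := h.good.core.exists_of_p_smul_fixed h.data (x := w)
      (by rw [← hw, hLCfix])
    have hd := h.graded.dvd_of_sum hp.pos (c := c' - Finsupp.single y k) (fun t ht => by
      by_cases hty : t = y
      · rw [hty, h.lvl_y]; exact WithBot.coe_ne_bot
      · rw [Finsupp.sub_apply, Finsupp.single_apply, if_neg (Ne.symm hty), sub_zero] at ht
        exact hb' t ht) (by
      rw [map_sub, Finsupp.linearCombination_single, h.lvl_y, h.gv_y, nlev_coe,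
        ← Int.cast_smul_eq_zsmul ℤ[X]]
      refine mem_normStep_top.2 ⟨g', hg', ?_⟩
      rw [← sub_eq_iff_eq_add'.2 hk, ← hw]) t
    by_cases hty : t = y
    · rw [hty, hy']; exact dvd_zero _
    · rwa [Finsupp.sub_apply, Finsupp.single_apply, if_neg (Ne.symm hty), sub_zero] at hd
  rw [hsplit] at hsum
  by_cases ha : a 0 = ⊥
  · have hτ : τ = α := if_pos ha
    rw [hτ] at hsum
    have hcy : (p : ℤ) ∣ c y := by
      obtain ⟨w, hw⟩ := mem_pSub.1 hsum
      refine h.good.core.dvd_of_smul_norm h.data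
        (g := nm p 0 n • w - (p : ℤ[X]) ^ (n - 1) • LC (c.erase y)) ?_ ?_
      · rw [smul_sub, X_sub_one_smul_nm (h.data.per w), smul_comm, hLCfix, smul_zero, sub_zero]
      · have h1 := congrArg (nm p 0 n • ·) hw
        have h2 := smul_of_fixed (nm p 0 n) (hLCfix (c.erase y))
        rw [eval_one_nm] at h2
        simp only [smul_add] at h1
        rw [h2, ← Int.cast_smul_eq_zsmul ℤ[X] (c y)] at h1
        have h3 : (((p : ℤ) ^ n : ℤ) : ℤ[X]) = (p : ℤ[X]) * (p : ℤ[X]) ^ (n - 1) := by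
          rw [← pow_succ', Nat.sub_add_cancel h.data.pos]; push_cast; rfl
        rw [h3] at h1
        linear_combination (norm := module) h1
    intro t
    by_cases hty : t = y
    · rw [hty]; exact hcy
    have := hfinal (c.erase y) Finsupp.erase_same (fun t ht => by
      by_cases hty : t = y
      · rw [hty, h.lvl_y]; exact WithBot.coe_ne_bot
      · rw [Finsupp.erase_ne hty] at ht
        exact hcbot t hty ht) (by
      obtain ⟨u, hu⟩ := hcy
      refine (Submodule.add_mem_iff_right _ ?_).1 hsum
      rw [hu, ← Int.cast_smul_eq_zsmul ℤ[X]]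
      push_cast
      rw [mul_smul]
      exact p_smul_mem_pSub _) t
    rwa [Finsupp.erase_ne hty] at this
  · have hτ : τ = nlev p (a 0) • g 0 := if_neg ha
    have hd := hfinal (Finsupp.single (x 0) (c y) + c.erase y) (by
        rw [Finsupp.add_apply, Finsupp.erase_same, Finsupp.single_apply, if_neg (h.x_ne 0),
          add_zero]) (fun t ht => by
        by_cases htx : t = x 0
        · rw [htx, h.lvl_x]; exact ha
        rw [Finsupp.add_apply, Finsupp.single_apply, if_neg (Ne.symm htx), zero_add] at ht
        by_cases hty : t = y
        · rw [hty, h.lvl_y]; exact WithBot.coe_ne_bot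
        · rw [Finsupp.erase_ne hty] at ht
          exact hcbot t hty ht) (by
        rw [map_add, Finsupp.linearCombination_single, h.lvl_x, h.gv_x]
        rw [hτ] at hsum
        exact hsum)
    intro t
    by_cases hty : t = y
    · have := hd (x 0)
      rw [Finsupp.add_apply, Finsupp.erase_ne (h.x_ne 0), hcx, Finsupp.single_eq_same,
        add_zero] at this
      rwa [hty]
    by_cases htx : t = x 0
    · rw [htx, hcx]; exact dvd_zero _
    have := hd t
    rwa [Finsupp.add_apply, Finsupp.single_apply, if_neg (Ne.symm htx), zero_add,
      Finsupp.erase_ne hty] at this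

end Pres

end

section

namespace Pres

variable {A : Type v} [AddCommGroup A] [Module ℤ[X] A] {p n : ℕ} {ξ : A}
  {M : ℕ} {a : Fin (M + 1) → WithBot ℕ} {e : ℤ} {α : A} {g : ℕ → A} {Γ : Type w}
  {lvl : Γ → WithBot ℕ} {gv : Γ → A} {y : Γ} {x : Fin (M + 1) → Γ}

theorem mem_augIdeal_of_pow (h : Pres p n ξ a e α g lvl gv y x) {z : Γ →₀ ℤ[X]}
    (hz0 : z (x 0) = 0) (hz : Finsupp.linearCombination ℤ[X] gv z ∈ pSub A p) (K : ℕ)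
    (hzt : ∀ t, t ≠ y → (X - 1) ^ K * z t ∈ augIdeal p (len p (lvl t)))
    (hzy : (X - 1) ^ K * z y ∈ augIdeal p (len p (a 0) + 1)) :
    (∀ t, t ≠ y → z t ∈ augIdeal p (len p (lvl t))) ∧ z y ∈ augIdeal p (len p (a 0) + 1) := by
  induction K with
  | zero => simpa using And.intro hzt hzy
  | succ K ih =>
    have := h.mem_augIdeal_of_mul (z := (X - 1 : ℤ[X]) ^ K • z) (by simp [hz0])
      (by rw [map_smul]; exact Submodule.smul_mem _ _ hz)
      (fun t ht => by
        have := hzt t ht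
        rw [pow_succ', mul_assoc] at this
        simpa using this)
      (by
        rw [pow_succ', mul_assoc] at hzy
        simpa using hzy)
    exact ih (fun t ht => by simpa using this.1 t ht) (by simpa using this.2)

theorem mem_augIdeal (h : Pres p n ξ a e α g lvl gv y x) {z : Γ →₀ ℤ[X]}
    (hz0 : z (x 0) = 0) (hz : Finsupp.linearCombination ℤ[X] gv z ∈ pSub A p) :
    (∀ t, t ≠ y → z t ∈ augIdeal p (len p (lvl t))) ∧ z y ∈ augIdeal p (len p (a 0) + 1) := by
  have hlen : ∀ b : WithBot ℕ, b ≤ n → len p b ≤ p ^ n := fun b hb => by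
    rcases hb.eq_or_lt with rfl | hb
    · exact le_rfl
    · exact (len_lt_len h.data.prime hb).le
  refine h.mem_augIdeal_of_pow hz0 hz (p ^ n + 1) (fun t _ => ?_) ?_
  · exact pow_mul_mem_augIdeal ((hlen _ (h.graded.le t)).trans (Nat.le_succ _)) _
  · exact pow_mul_mem_augIdeal (Nat.succ_le_succ (hlen _ (h.good.le 0))) _

theorem map_single_sub (h : Pres p n ξ a e α g lvl gv y x) :
    Finsupp.linearCombination ℤ[X] gv (Finsupp.single y (X - 1) - Finsupp.single (x 0) 1)
      ∈ pSub A p := by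
  rw [map_sub, Finsupp.linearCombination_single, Finsupp.linearCombination_single, h.gv_y, h.gv_x,
    one_smul]
  exact h.rel_mem

variable (p e lvl y x) in
/-- The relations and the multiples of `p`. -/
noncomputable def relModP : Submodule ℤ[X] (Γ →₀ ℤ[X]) :=
  pSub (Γ →₀ ℤ[X]) p ⊔ relModule p e lvl y x

theorem single_mem_relModule (t : Γ) {f : ℤ[X]} (hf : lev p (lvl t) ∣ f) :
    Finsupp.single t f ∈ relModule p e lvl y x := by
  obtain ⟨c, rfl⟩ := hf
  have := Submodule.smul_mem (relModule p e lvl y x) c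
    (Submodule.subset_span (Set.mem_insert_of_mem _ ⟨t, rfl⟩))
  rwa [Finsupp.smul_single, smul_eq_mul, mul_comm] at this

theorem single_mem_relModP (hp : p.Prime) (t : Γ) {f : ℤ[X]}
    (hf : f ∈ augIdeal p (len p (lvl t))) : Finsupp.single t f ∈ relModP p e lvl y x := by
  obtain ⟨B, C, rfl⟩ := CyclicPower.mem_augIdeal.1 hf
  obtain ⟨r, hr⟩ := exists_lev_eq hp (lvl t)
  have h1 : (p : ℤ[X]) * B + (X - 1) ^ len p (lvl t) * C
      = (p : ℤ[X]) * (B - r * C) + lev p (lvl t) * C := by rw [hr]; ring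
  rw [h1, Finsupp.single_add]
  refine add_mem (Submodule.mem_sup_left ?_)
    (Submodule.mem_sup_right (single_mem_relModule t (dvd_mul_right _ _)))
  rw [← smul_eq_mul, ← Finsupp.smul_single]
  exact p_smul_mem_pSub _

theorem rel_mem_relModule : Finsupp.single y (X - (1 + (p : ℤ[X]) * (e : ℤ[X])))
    - ∑ j : Fin (M + 1), Finsupp.single (x j) ((p : ℤ[X]) ^ (j : ℕ)) ∈ relModule p e lvl y x :=
  Submodule.subset_span (Set.mem_insert _ _)

theorem single_sub_mem_relModP : Finsupp.single y (X - 1) - Finsupp.single (x 0) 1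
    ∈ relModP p e lvl y x := by
  have h1 : Finsupp.single y (X - 1) - Finsupp.single (x 0) 1
      = (p : ℤ[X]) • (Finsupp.single y (e : ℤ[X])
        + ∑ j : Fin M, Finsupp.single (x j.succ) ((p : ℤ[X]) ^ (j : ℕ)))
        + (Finsupp.single y (X - (1 + (p : ℤ[X]) * (e : ℤ[X])))
          - ∑ j : Fin (M + 1), Finsupp.single (x j) ((p : ℤ[X]) ^ (j : ℕ))) := by
    rw [Fin.sum_univ_succ, smul_add, Finset.smul_sum]
    simp only [Finsupp.smul_single, smul_eq_mul, Fin.val_succ, pow_succ', Fin.val_zero, pow_zero]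
    have : (X - (1 + (p : ℤ[X]) * (e : ℤ[X])) : ℤ[X]) = (X - 1) - (p : ℤ[X]) * (e : ℤ[X]) := by ring
    rw [this, Finsupp.single_sub y (X - 1 : ℤ[X]) ((p : ℤ[X]) * (e : ℤ[X]))]
    abel
  rw [h1]
  exact add_mem (Submodule.mem_sup_left (p_smul_mem_pSub _))
    (Submodule.mem_sup_right rel_mem_relModule)

theorem mem_relModP (h : Pres p n ξ a e α g lvl gv y x) {z : Γ →₀ ℤ[X]}
    (hz : Finsupp.linearCombination ℤ[X] gv z ∈ pSub A p) : z ∈ relModP p e lvl y x := by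
  classical
  have hE := single_sub_mem_relModP (p := p) (e := e) (lvl := lvl) (y := y) (x := x)
  obtain ⟨z₁, hz₁⟩ : ∃ z₁, z₁ = z + z (x 0) • (Finsupp.single y (X - 1) - Finsupp.single (x 0) 1) :=
    ⟨_, rfl⟩
  have h0 : z₁ (x 0) = 0 := by
    rw [hz₁]
    simp [Ne.symm (h.x_ne 0)]
  have hm : Finsupp.linearCombination ℤ[X] gv z₁ ∈ pSub A p := by
    rw [hz₁, map_add, map_smul]
    exact add_mem hz (Submodule.smul_mem _ _ h.map_single_sub)
  obtain ⟨h1, h2⟩ := h.mem_augIdeal h0 hm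
  have hz₁m : z₁ ∈ relModP p e lvl y x := by
    rw [← Finsupp.sum_single z₁]
    refine Submodule.sum_mem _ fun t _ => ?_
    by_cases ht : t = y
    · rw [ht]
      obtain ⟨B, C, hBC⟩ := CyclicPower.mem_augIdeal.1 h2
      have h3 : Finsupp.single y (z₁ y) = (p : ℤ[X]) • Finsupp.single y B
          + ((X - 1) ^ len p (a 0) * C) • (Finsupp.single y (X - 1) - Finsupp.single (x 0) 1)
          + Finsupp.single (x 0) ((X - 1) ^ len p (a 0) * C) := by
        rw [smul_sub, Finsupp.smul_single, Finsupp.smul_single, Finsupp.smul_single, smul_eq_mul,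
          smul_eq_mul, smul_eq_mul, mul_one, add_sub, sub_add_cancel, ← Finsupp.single_add, hBC]
        congr 1
        ring
      rw [h3]
      refine add_mem (add_mem (Submodule.mem_sup_left (p_smul_mem_pSub _))
        (Submodule.smul_mem _ _ hE)) (single_mem_relModP h.data.prime _ ?_)
      rw [h.lvl_x]
      exact CyclicPower.mem_augIdeal.2 ⟨0, C, by ring⟩
    · exact single_mem_relModP h.data.prime t (h1 t ht)
  have := sub_mem hz₁m (Submodule.smul_mem _ (z (x 0)) hE)
  rwa [hz₁, add_sub_cancel_right] at this

theorem map_mem_of_mem_relModule (h : Pres p n ξ a e α g lvl gv y x) {l : Γ →₀ ℤ[X]}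
    (hl : l ∈ relModule p e lvl y x) :
    ∃ w : A, Finsupp.linearCombination ℤ[X] gv l = (p : ℤ[X]) ^ (M + 1) • w := by
  induction hl using Submodule.span_induction with
  | mem l hl =>
    rcases hl with rfl | ⟨t, rfl⟩
    · refine ⟨g (M + 1), ?_⟩
      rw [map_sub, Finsupp.linearCombination_single, h.gv_y, h.good.rel, Finset.sum_range_succ,
        map_sum, Finset.sum_range]
      simp [Finsupp.linearCombination_single, h.gv_x]
    · exact ⟨0, by simp [Finsupp.linearCombination_single, h.graded.level t]⟩
  | zero => exact ⟨0, by simp⟩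
  | add l l' _ _ hl hl' =>
    obtain ⟨w, hw⟩ := hl
    obtain ⟨w', hw'⟩ := hl'
    exact ⟨w + w', by rw [map_add, hw, hw', smul_add]⟩
  | smul f l _ hl =>
    obtain ⟨w, hw⟩ := hl
    exact ⟨f • w, by rw [map_smul, hw, smul_comm]⟩

theorem exists_torsion_lift (h : Pres p n ξ a e α g lvl gv y x) :
    ∃ r : Γ →₀ ℤ[X], (p : ℤ[X]) • r ∈ relModule p e lvl y x ∧
      ∃ w : A, Finsupp.linearCombination ℤ[X] gv r = ξ + (p : ℤ[X]) ^ M • w := by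
  obtain ⟨k, rfl⟩ : ∃ k, n = k + 1 := ⟨n - 1, (Nat.succ_pred_eq_of_pos h.data.pos).symm⟩
  refine ⟨Finsupp.single y ((e : ℤ[X]) * nm p 0 (k + 1)) + Finsupp.single (x 0) (nm p 0 k)
    + ∑ j : Fin M, Finsupp.single (x j.succ) ((p : ℤ[X]) ^ (j : ℕ) * nm p 0 (k + 1)), ?_,
    - (nm p 0 (k + 1) • g (M + 1)), ?_⟩
  · obtain ⟨r, hr⟩ := exists_nm_eq_pow_add p k 1
    have hnm := nm_mul_nm h.data.prime.pos 0 k 1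
    rw [zero_add, hr, pow_one] at hnm
    have hlt : a 0 ≤ (k : WithBot ℕ) := le_pred_of_lt h.good.core.lt
    have h1 := Submodule.smul_mem _ (- nm p 0 (k + 1))
      (rel_mem_relModule (p := p) (e := e) (lvl := lvl) (y := y) (x := x))
    have h2 := single_mem_relModule (p := p) (e := e) (lvl := lvl) (y := y) (x := x) y
      (f := lv p (k + 1)) (by rw [h.lvl_y, lev_coe])
    have h3 := single_mem_relModule (p := p) (e := e) (lvl := lvl) (y := y) (x := x) (x 0)
      (f := - (nm p 0 k * (lv p k * r))) (by
        rw [h.lvl_x]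
        refine (Dvd.dvd.mul_left (Dvd.dvd.mul_right ?_ _) _).neg_right
        exact lev_dvd_lev (b := (k : WithBot ℕ)) hlt)
    have h4 := add_mem (add_mem h1 h2) h3
    convert h4 using 1
    rw [← X_sub_one_mul_nm, Fin.sum_univ_succ, smul_add, smul_add, smul_sub, smul_add,
      Finset.smul_sum, Finset.smul_sum]
    simp only [Finsupp.smul_single, smul_eq_mul, Fin.val_succ, pow_succ', Fin.val_zero, pow_zero]
    have e1 : ∑ j : Fin M, Finsupp.single (x j.succ) ((p : ℤ[X]) * ((p : ℤ[X]) ^ (j : ℕ) * nm p 0 (k + 1)))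
        = - ∑ j : Fin M, Finsupp.single (x j.succ) (- nm p 0 (k + 1) * ((p : ℤ[X]) * (p : ℤ[X]) ^ (j : ℕ))) := by
      rw [← Finset.sum_neg_distrib]
      refine Finset.sum_congr rfl fun j _ => ?_
      rw [← Finsupp.single_neg]
      congr 1
      ring
    have e2 : Finsupp.single y ((p : ℤ[X]) * ((e : ℤ[X]) * nm p 0 (k + 1)))
        = Finsupp.single y (- nm p 0 (k + 1) * (X - (1 + (p : ℤ[X]) * (e : ℤ[X]))))
          + Finsupp.single y ((X - 1) * nm p 0 (k + 1)) := by
      rw [← Finsupp.single_add]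
      congr 1
      ring
    have e3 : Finsupp.single (x 0) ((p : ℤ[X]) * nm p 0 k)
        = Finsupp.single (x 0) (- (nm p 0 k * (lv p k * r)))
          - Finsupp.single (x 0) (- nm p 0 (k + 1) * 1) := by
      rw [← Finsupp.single_sub]
      congr 1
      linear_combination hnm
    rw [e1, e2, e3]
    abel
  · have hN := h.good.core.norm
    rw [Nat.add_sub_cancel] at hN
    rw [map_add, map_add, map_sum, Finsupp.linearCombination_single,
      Finsupp.linearCombination_single, h.gv_y, h.gv_x]
    simp only [Finsupp.linearCombination_single, h.gv_x, Fin.val_succ, Fin.val_zero]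
    rw [wsum, Finset.sum_range_succ, Finset.sum_range] at hN
    have e1 : ∑ j : Fin M, ((p : ℤ[X]) ^ (j : ℕ) * nm p 0 (k + 1)) • g (j + 1)
        = nm p 0 (k + 1) • ∑ j : Fin M, (p : ℤ[X]) ^ (j : ℕ) • g (j + 1) := by
      rw [Finset.smul_sum]
      exact Finset.sum_congr rfl fun j _ => by rw [mul_comm, mul_smul]
    rw [e1]
    linear_combination (norm := module) hN

theorem exists_eq_pow_smul_add (h : Pres p n ξ a e α g lvl gv y x) (k : ℕ) (hk : k ≤ M + 1)
    {z : Γ →₀ ℤ[X]} {w : A}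
    (hz : Finsupp.linearCombination ℤ[X] gv z = (p : ℤ[X]) ^ k • w) :
    ∃ z', ∃ l ∈ relModule p e lvl y x, z = (p : ℤ[X]) ^ k • z' + l := by
  induction k generalizing z w with
  | zero => exact ⟨z, 0, zero_mem _, by simp⟩
  | succ k ih =>
    have hI : ∀ {z : Γ →₀ ℤ[X]} {w : A},
        Finsupp.linearCombination ℤ[X] gv z = (p : ℤ[X]) • w →
        ∃ z', ∃ l ∈ relModule p e lvl y x, z = (p : ℤ[X]) • z' + l := by
      intro z w hz
      obtain ⟨u, hu, l, hl, rfl⟩ := Submodule.mem_sup.1 (h.mem_relModP (mem_pSub.2 ⟨w, hz⟩))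
      obtain ⟨z', rfl⟩ := mem_pSub.1 hu
      exact ⟨z', l, hl, rfl⟩
    rcases k with _ | k
    · simpa using hI (w := w) (by simpa using hz)
    obtain ⟨z', l, hl, rfl⟩ := ih (by omega) (z := z) (w := (p : ℤ[X]) • w) (by
      rw [hz, pow_succ, mul_smul])
    obtain ⟨u, hu⟩ := h.map_mem_of_mem_relModule hl
    obtain ⟨j, rfl⟩ : ∃ j, M = k + 1 + j := ⟨M - (k + 1), by omega⟩
    rw [map_add, map_smul, hu] at hz
    obtain ⟨r, hr, v, hv⟩ := h.exists_torsion_lift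
    obtain ⟨c, hc⟩ := h.data.tors ((p : ℤ[X]) ^ k • (Finsupp.linearCombination ℤ[X] gv z'
      + (p : ℤ[X]) ^ (j + 1) • u - (p : ℤ[X]) • w)) (by
        linear_combination (norm := module) hz)
    obtain ⟨z₂, l₂, hl₂, he⟩ := ih (by omega) (z := (p : ℤ[X]) ^ k • z' - (c : ℤ[X]) • r)
      (w := w - (p : ℤ[X]) ^ j • u - (c : ℤ[X]) • (p : ℤ[X]) ^ j • v) (by
        rw [map_sub, map_smul, map_smul, hv]
        linear_combination (norm := module) hc)
    refine ⟨z₂, (p : ℤ[X]) • l₂ + (c : ℤ[X]) • (p : ℤ[X]) • r + l,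
      add_mem (add_mem (Submodule.smul_mem _ _ hl₂) (Submodule.smul_mem _ _ hr)) hl, ?_⟩
    linear_combination (norm := module) (p : ℤ[X]) • he

end Pres

end

section

variable {A : Type v} [AddCommGroup A] [Module ℤ[X] A] {p n : ℕ} {ξ : A}

/-- The elements of level `i`. -/
noncomputable def levelSub (A : Type v) [AddCommGroup A] [Module ℤ[X] A] (p i : ℕ) :
    Submodule ℤ[X] A :=
  LinearMap.ker (LinearMap.lsmul ℤ[X] A (lv p i))

theorem coe_linearCombination_levelSub {i : ℕ} {κ : Type w} (f : κ → levelSub A p i)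
    (c : κ →₀ ℤ) : ((Finsupp.linearCombination ℤ f c : levelSub A p i) : A)
      = Finsupp.linearCombination ℤ (fun k => (f k : A)) c := by
  simp [Finsupp.linearCombination_apply, Finsupp.sum]

theorem map_linearCombination_int {B C : Type*} [AddCommGroup B] [AddCommGroup C] (ψ : B →+ C)
    {κ : Type w} (f : κ → B) (c : κ →₀ ℤ) : ψ (Finsupp.linearCombination ℤ f c)
      = Finsupp.linearCombination ℤ (fun k => ψ (f k)) c := by
  simp [Finsupp.linearCombination_apply, Finsupp.sum]

theorem Graded.of_isZBasis {Γ : Type v} {lvl : Γ → WithBot ℕ} {gv : Γ → A}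
    (level : ∀ t, lev p (lvl t) • gv t = 0) (le : ∀ t, lvl t ≤ n)
    (H : ∀ i ≤ n, ∃ (B : Type v) (_ : AddCommGroup B) (ψ : levelSub A p i →+ B)
      (κ : Type v) (f : κ → levelSub A p i) (emb : κ → Γ),
      (∀ γ, ψ γ = 0 ↔ nm p 0 i • (γ : A) ∈ normStep A p n (i + 1)) ∧
      Function.Injective emb ∧ (∀ t, lvl t = i ↔ t ∈ Set.range emb) ∧
      (∀ k, gv (emb k) = f k) ∧ IsZBasis p (fun k => ψ (f k))) : Graded p n lvl gv where
  level := level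
  le := le
  indep := by
    intro i hi c hc hN
    obtain ⟨B, _, ψ, κ, f, emb, hψ, hinj, hr, hf, hb⟩ := H i hi
    have hsub : (c.support : Set Γ) ⊆ Set.range emb := fun t ht =>
      (hr t).1 (hc t (by simpa using ht))
    have hcm := Finsupp.mapDomain_comapDomain emb hinj c hsub
    have h0 : Finsupp.linearCombination ℤ gv c = ((Finsupp.linearCombination ℤ f
        (c.comapDomain emb hinj.injOn) : levelSub A p i) : A) := by
      rw [coe_linearCombination_levelSub, ← hcm, Finsupp.linearCombination_mapDomain, hcm]
      congr 2
      exact funext hf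
    rw [h0, ← hψ, map_linearCombination_int] at hN
    intro t
    by_cases ht : c t = 0
    · simp [ht]
    · obtain ⟨k, rfl⟩ := (hr t).1 (hc t ht)
      simpa using hb.indep _ hN k
  span := by
    intro i hi γ hγ
    obtain ⟨B, _, ψ, κ, f, emb, hψ, hinj, hr, hf, hb⟩ := H i hi
    obtain ⟨c, hc⟩ := hb.span (ψ ⟨γ, hγ⟩)
    refine ⟨c.mapDomain emb, fun t ht => (hr t).2 ?_, ?_⟩
    · by_contra h
      exact ht (Finsupp.mapDomain_of_notMem_range _ _ h)
    · rw [← map_linearCombination_int, eq_comm, ← sub_eq_zero, ← map_sub, hψ] at hc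
      rw [← smul_sub]
      convert hc using 2
      rw [Submodule.coe_sub, coe_linearCombination_levelSub, Finsupp.linearCombination_mapDomain]
      congr 3
      exact funext hf

/-- The levels of the distinguished generators. -/
def olev (n : ℕ) {m : ℕ} (a : Fin m → WithBot ℕ) (o : Option (Fin m)) : WithBot ℕ :=
  o.elim n a

/-- The distinguished generators. -/
def ogen {m : ℕ} (α : A) (g : ℕ → A) (o : Option (Fin m)) : A :=
  o.elim α fun j => g j

theorem CycData.Good.eq_of_level {M : ℕ} {a : Fin (M + 1) → WithBot ℕ} {e : ℤ} {α : A} {g : ℕ → A}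
    (h : CycData.Good p n ξ a e α g) {i : ℕ} {j k : Fin (M + 1)} (hj : a j = i) (hk : a k = i) :
    j = k := by
  rcases lt_trichotomy j k with hlt | heq | hlt
  · have := (h.order k j hlt (by simp [hk]) (Or.inl (by simp [hj]))).1
    exact absurd (hj.trans hk.symm) this.ne
  · exact heq
  · have := (h.order j k hlt (by simp [hj]) (Or.inl (by simp [hk]))).1
    exact absurd (hk.trans hj.symm) this.ne

theorem CycData.Good.dvd_of_norm (h : CycData A p n ξ) {M : ℕ} {a : Fin (M + 1) → WithBot ℕ}
    {e : ℤ} {α : A} {g : ℕ → A} (hg : CycData.Good p n ξ a e α g) {i : ℕ} (hi : i ≤ n)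
    (c : Option (Fin (M + 1)) →₀ ℤ) (hc : ∀ o, c o ≠ 0 → olev n a o = i)
    (hN : nm p 0 i • Finsupp.linearCombination ℤ (ogen α g) c ∈ normStep A p n (i + 1)) :
    ∀ o, (p : ℤ) ∣ c o := by
  have hpp := h.prime
  have hone : ∀ j, a j = (i : WithBot ℕ) → Finsupp.linearCombination ℤ (ogen α g) c
      = (c none : ℤ[X]) • α + (c (some j) : ℤ[X]) • g j := by
    intro j hj
    rw [Finsupp.linearCombination_apply, Finsupp.sum_fintype _ _ (by simp), Fintype.sum_option,
      Finset.sum_eq_single j]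
    · simp [ogen, Int.cast_smul_eq_zsmul]
    · intro k _ hk
      have : c (some k) = 0 := by
        by_contra h0
        exact hk (hg.eq_of_level (hc _ h0) hj)
      simp [this]
    · simp
  have hfix : ∀ j, a j = (i : WithBot ℕ) → (X - 1 : ℤ[X]) • nm p 0 i • g j = 0 := by
    intro j hj
    have := hg.level j
    rw [hj, lev_coe] at this
    rw [← mul_smul, X_sub_one_mul_nm, this]
  have hsome : ∀ j, (p : ℤ) ∣ c (some j) := by
    intro j
    by_contra hnd
    have hj : a j = (i : WithBot ℕ) := hc (some j) (by rintro h0; simp [h0] at hnd)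
    obtain ⟨u, v, huv⟩ := ((Nat.prime_iff_prime_int.1 hpp).coprime_iff_not_dvd.2 hnd)
    have key : ((u : ℤ[X]) * (p : ℤ[X]) + (v : ℤ[X]) * (c (some j) : ℤ[X])) • nm p 0 i • g j
        = nm p 0 i • g j := by
      have : (u : ℤ[X]) * (p : ℤ[X]) + (v : ℤ[X]) * (c (some j) : ℤ[X]) = 1 := by
        exact_mod_cast congrArg (Int.cast : ℤ → ℤ[X]) huv
      rw [this, one_smul]
    rw [hone j hj] at hN
    rcases hi.lt_or_eq with hlt | rfl
    · have hnone : c none = 0 := by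
        by_contra h0
        have := hc _ h0
        simp [olev] at this
        omega
      obtain ⟨γ, x, h1, _, h3, h4⟩ := hN
      rw [hnone] at h4
      refine hg.norm_ne j i hj hlt ((v : ℤ[X]) • γ) ((u : ℤ[X]) • nm p 0 i • g j + (v : ℤ[X]) • x)
        (by rw [smul_comm, h1, smul_zero]) ?_ ?_
      · rw [smul_add, smul_comm, hfix j hj, smul_comm, h3, smul_zero, smul_zero, add_zero]
      · linear_combination (norm := skip) (v : ℤ[X]) • h4 - key
        push_cast
        module
    · obtain ⟨x, h3, h4⟩ := mem_normStep_top.1 hN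
      refine hg.norm_ne_top j hj (-(v * c none))
        ((u : ℤ[X]) • nm p 0 i • g j + (v : ℤ[X]) • x) ?_ ?_
      · rw [smul_add, smul_comm, hfix j hj, smul_comm, h3, smul_zero, smul_zero, add_zero]
      · linear_combination (norm := skip) (v : ℤ[X]) • h4 - key
        push_cast
        module
  rintro (_ | j)
  · by_cases h0 : c none = 0
    · simp [h0]
    have hin : n = i := by simpa [olev] using hc none h0
    subst hin
    obtain ⟨x, h3, h4⟩ := mem_normStep_top.1 hN
    choose q hq using hsome
    have hz : ∀ j, a j ≠ (n : WithBot ℕ) → c (some j) = 0 := fun j hj => by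
      by_contra h0
      exact hj (hc _ h0)
    by_cases hex : ∃ j, a j = (n : WithBot ℕ)
    · obtain ⟨j, hj⟩ := hex
      rw [hone j hj, hq j] at h4
      refine hg.core.dvd_of_smul_norm h (g := x - (q j : ℤ[X]) • nm p 0 n • g j) ?_ ?_
      · rw [smul_sub, h3, smul_comm, hfix j hj, smul_zero, sub_zero]
      · linear_combination (norm := skip) h4
        push_cast
        module
    · push Not at hex
      refine hg.core.dvd_of_smul_norm h (g := x) h3 ?_
      rw [Finsupp.linearCombination_apply, Finsupp.sum_fintype _ _ (by simp), Fintype.sum_option,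
        Finset.sum_eq_zero fun j _ => by rw [hz j (hex j), zero_smul], add_zero] at h4
      rw [← h4, ← Int.cast_smul_eq_zsmul ℤ[X], smul_comm]
      rfl
  · exact hsome j

theorem exists_pres (h : CycData A p n ξ) (M : ℕ) (Q : Fin (n + 1) → Type v)
    [∀ i, CommGroup (Q i)] (ψ : ∀ i : Fin (n + 1), levelSub A p i →+ Additive (Q i))
    (hψ : ∀ i, Function.Surjective (ψ i))
    (hker : ∀ (i : Fin (n + 1)) γ, ψ i γ = 0 ↔ nm p 0 i • (γ : A) ∈ normStep A p n (i + 1)) :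
    ∃ (a : Fin (M + 1) → WithBot ℕ) (e : ℤ) (α : A) (g : ℕ → A) (ι : Fin (n + 1) → Type v)
      (γ : (Σ i, ι i) → A),
      Pres p n ξ a e α g
        (Sum.elim (olev n a) (fun s : Σ i, ι i => (((s.1 : ℕ) : ℕ) : WithBot ℕ)))
        (Sum.elim (ogen α g) γ) (Sum.inl none) (fun j => Sum.inl (some j)) ∧
      ∀ i : Fin (n + 1), Cardinal.mk (ι i) +
        (Nat.card {o : Option (Fin (M + 1)) // olev n a o = ((i : ℕ) : WithBot ℕ)} : Cardinal)
          = MSS.fpdim p (Q i) := by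
  obtain ⟨a, e, α, g, hg⟩ := h.exists_good M
  have hol : ∀ o : Option (Fin (M + 1)), lev p (olev n a o) • ogen α g o = 0 := by
    rintro (_ | j)
    · change lev p (n : WithBot ℕ) • α = 0
      rw [lev_coe, h.per]
    · exact hg.level j
  have hole : ∀ o : Option (Fin (M + 1)), olev n a o ≤ n := by
    rintro (_ | j)
    · exact le_rfl
    · exact hg.le j
  have hlo : ∀ (i : Fin (n + 1))
      (o : {o : Option (Fin (M + 1)) // olev n a o = ((i : ℕ) : WithBot ℕ)}),
      ogen α g o.1 ∈ levelSub A p i := fun i o => by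
    have := hol o.1
    rwa [o.2, lev_coe] at this
  have hin : ∀ i : Fin (n + 1), (i : ℕ) ≤ n := fun i => Nat.lt_succ_iff.1 i.2
  have H : ∀ i : Fin (n + 1), ∃ (ι : Type v) (γ : ι → levelSub A p i),
      IsZBasis p (fun k => ψ i (Sum.elim (fun o => ⟨ogen α g o.1, hlo i o⟩) γ k)) ∧
      Cardinal.mk ι + (Nat.card {o : Option (Fin (M + 1)) // olev n a o = ((i : ℕ) : WithBot ℕ)} :
        Cardinal) = MSS.fpdim p (Q i) := by
    intro i
    refine exists_extension_fpdim h.prime ?_ (ψ i) (hψ i) _ ?_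
    · intro x
      obtain ⟨γ, rfl⟩ := hψ i x
      rw [← map_nsmul, hker, ← Nat.cast_smul_eq_nsmul ℤ[X], Submodule.coe_smul, smul_comm]
      refine p_smul_mem_normStep _ ?_
      rw [← mul_smul, X_sub_one_mul_nm]
      exact γ.2
    · intro c hc k
      rw [hker, coe_linearCombination_levelSub] at hc
      have := hg.dvd_of_norm h (hin i) (c.mapDomain Subtype.val) (fun o ho => by
        by_contra hne
        refine ho (Finsupp.mapDomain_of_notMem_range _ _ ?_)
        rintro ⟨o, rfl⟩
        exact hne o.2) (by
          rw [Finsupp.linearCombination_mapDomain]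
          exact hc) k.1
      rwa [Finsupp.mapDomain_apply Subtype.val_injective] at this
  choose ι γ hb hcard using H
  refine ⟨a, e, α, g, ι, fun s => γ s.1 s.2, ⟨h, hg, ?_, rfl, rfl, fun _ => rfl, fun _ => rfl,
    fun _ => by simp⟩, hcard⟩
  refine Graded.of_isZBasis ?_ ?_ ?_
  · rintro (o | s)
    · exact hol o
    · change lev p ((s.1 : ℕ) : WithBot ℕ) • _ = _
      rw [lev_coe]
      exact (γ s.1 s.2).2
  · rintro (o | s)
    · exact hole o
    · exact WithBot.coe_le_coe.2 (hin s.1)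
  · intro i hi
    let i' : Fin (n + 1) := ⟨i, Nat.lt_succ_iff.2 hi⟩
    refine ⟨_, _, ψ i', _, _, Sum.map Subtype.val (Sigma.mk i'), hker i', ?_, ?_, ?_, hb i'⟩
    · exact Sum.map_injective.2 ⟨Subtype.val_injective, sigma_mk_injective⟩
    · rintro (o | ⟨j, s⟩)
      · constructor
        · exact fun ho => ⟨Sum.inl ⟨o, ho⟩, rfl⟩
        · rintro ⟨(k | k), hk⟩
          · obtain rfl := Sum.inl_injective hk
            exact k.2
          · simp at hk
      · constructor
        · intro hs
          have : j = i' := Fin.ext (by simpa using hs)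
          subst this
          exact ⟨Sum.inr s, rfl⟩
        · rintro ⟨(k | k), hk⟩
          · simp at hk
          · obtain ⟨rfl, -⟩ := Sigma.mk.inj_iff.1 (Sum.inr_injective hk)
            rfl
    · rintro (k | k) <;> rfl

end

/-- Evaluation of integer polynomials at the generator of `G_i`. -/
noncomputable def ev (p m i : ℕ) : ℤ[X] →+* MSS.CycGR p m i :=
  eval₂RingHom (Int.castRingHom _) (MSS.gen p m i)

@[simp] theorem ev_X (p m i : ℕ) : ev p m i X = MSS.gen p m i := by simp [ev]

theorem gen_pow (p m i k : ℕ) : MSS.gen p m i ^ k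
    = MonoidAlgebra.single (Multiplicative.ofAdd ((k : ℕ) : ZMod (p ^ i))) 1 := by
  rw [MSS.gen, ← map_pow, MonoidAlgebra.of_apply, ← ofAdd_nsmul, nsmul_one]

theorem ev_surjective {p : ℕ} (hp : 0 < p) (m i : ℕ) : Function.Surjective (ev p m i) := by
  have : NeZero (p ^ i) := ⟨(pow_pos hp i).ne'⟩
  intro x
  rw [← RingHom.mem_range]
  have h1 : ∀ k, MSS.gen p m i ^ k ∈ (ev p m i).range := fun k => ⟨X ^ k, by simp⟩
  induction x using MonoidAlgebra.induction_on with
  | of k =>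
    have := h1 (ZMod.val k.toAdd)
    rw [gen_pow] at this
    simpa using this
  | add f g hf hg => exact add_mem hf hg
  | smul r f hf =>
    obtain ⟨z, rfl⟩ := ZMod.intCast_surjective r
    rw [Int.cast_smul_eq_zsmul]
    exact zsmul_mem hf z

theorem pow_eq_zero_cycGR (p m i : ℕ) : ((p : MSS.CycGR p m i) ^ m) = 0 := by
  have h : ((p ^ m : ℕ) : ZMod (p ^ m)) = 0 := ZMod.natCast_self _
  have := congrArg (algebraMap (ZMod (p ^ m)) (MSS.CycGR p m i)) h
  rw [map_natCast, map_zero] at this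
  exact_mod_cast this

theorem ev_lv (p m i : ℕ) : ev p m i (lv p i) = 0 := by
  rw [lv, map_sub, map_pow, ev_X, map_one, gen_pow, ZMod.natCast_self]
  exact sub_self _

theorem ev_eq_zero_iff {p : ℕ} (hp : 0 < p) {m i : ℕ} {f : ℤ[X]} :
    ev p m i f = 0 ↔ ∃ A B : ℤ[X], f = lv p i * A + (p : ℤ[X]) ^ m * B := by
  constructor
  · intro h
    have hmon := lv_monic (p := p) hp i
    have hf := modByMonic_add_div f (lv p i)
    have hev : ev p m i (f %ₘ lv p i) = 0 := by
      rw [← hf, map_add, map_mul, ev_lv, zero_mul, add_zero] at h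
      exact h
    have hdeg : (f %ₘ lv p i).natDegree < p ^ i := by
      have h1 : (lv p i).natDegree = p ^ i := by
        rw [lv]
        exact natDegree_X_pow_sub_C (R := ℤ) (r := 1)
      rw [← h1]
      refine natDegree_modByMonic_lt f hmon ?_
      rintro h0
      rw [h0, natDegree_one] at h1
      exact (pow_pos hp i).ne h1
    obtain ⟨B, hB⟩ : C ((p : ℤ) ^ m) ∣ f %ₘ lv p i := by
      rw [C_dvd_iff_dvd_coeff]
      intro k
      by_cases hk : p ^ i ≤ k
      · rw [coeff_eq_zero_of_natDegree_lt (hdeg.trans_le hk)]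
        exact dvd_zero _
      · push Not at hk
        have h2 := congrArg (fun x : MSS.CycGR p m i =>
          x.coeff (Multiplicative.ofAdd ((k : ℕ) : ZMod (p ^ i)))) hev
        have h3 : ev p m i (f %ₘ lv p i) = ∑ l ∈ Finset.range (p ^ i), MonoidAlgebra.single
            (Multiplicative.ofAdd ((l : ℕ) : ZMod (p ^ i)))
            (((f %ₘ lv p i).coeff l : ℤ) : ZMod (p ^ m)) := by
          conv_lhs => rw [as_sum_range' _ _ hdeg]
          rw [map_sum]
          refine Finset.sum_congr rfl fun l _ => ?_
          rw [← C_mul_X_pow_eq_monomial, map_mul, map_pow, ev_X, gen_pow]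
          have : ev p m i (C ((f %ₘ lv p i).coeff l)) = (((f %ₘ lv p i).coeff l : ℤ) :
              MSS.CycGR p m i) := by simp
          rw [this, ← zsmul_eq_mul, ← Int.cast_smul_eq_zsmul (ZMod (p ^ m))]
          simp
        rw [h3] at h2
        have h4 : ∀ l ∈ Finset.range (p ^ i), l ≠ k →
            (Multiplicative.ofAdd ((l : ℕ) : ZMod (p ^ i)))
              ≠ Multiplicative.ofAdd ((k : ℕ) : ZMod (p ^ i)) := by
          intro l hl hlk h5
          refine hlk ?_
          have h6 := (ZMod.natCast_eq_natCast_iff' _ _ _).1 (Multiplicative.ofAdd.injective h5)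
          rwa [Nat.mod_eq_of_lt (Finset.mem_range.1 hl), Nat.mod_eq_of_lt hk] at h6
        have h7 : (((f %ₘ lv p i).coeff k : ℤ) : ZMod (p ^ m)) = 0 := by
          rw [MonoidAlgebra.coeff_zero, Finsupp.zero_apply] at h2
          rw [← h2, MonoidAlgebra.coeff_sum, Finsupp.finsetSum_apply,
            Finset.sum_eq_single_of_mem k (Finset.mem_range.2 hk)]
          · simp [MonoidAlgebra.coeff_single]
          · intro l hl hlk
            rw [MonoidAlgebra.coeff_single, Finsupp.single_apply, if_neg (h4 l hl hlk)]
        have := (ZMod.intCast_zmod_eq_zero_iff_dvd _ _).1 h7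
        exact_mod_cast this
    refine ⟨f /ₘ lv p i, B, ?_⟩
    have hC : C ((p : ℤ) ^ m) = (p : ℤ[X]) ^ m := by simp
    nth_rw 1 [← modByMonic_add_div f (lv p i)]
    rw [hB, hC]
    ring
  · rintro ⟨A, B, rfl⟩
    rw [map_add, map_mul, map_mul, map_pow, ev_lv, map_natCast, pow_eq_zero_cycGR]
    simp

/-- The relation of level `a`, evaluated in the group ring. -/
theorem ev_lev (p m n : ℕ) (a : WithBot ℕ) : ev p m n (lev p a)
    = WithBot.recBotCoe (1 : MSS.CycGR p m n) (fun k => MSS.gen p m n ^ p ^ k - 1) a := by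
  rcases withBot_cases a with rfl | ⟨k, rfl⟩
  · rw [lev_bot, map_one]
    rfl
  · rw [lev_coe, lv, map_sub, map_pow, ev_X, map_one]
    rfl

theorem mem_span_XRels_iff {p n m : ℕ} (hp : 0 < p) {a : Fin m → WithBot ℕ}
    (ha : ∀ j, a j ≤ n) {d : ℤ} {u : Fin (m + 1) → ℤ[X]} :
    (fun k => ev p m n (u k)) ∈ Submodule.span (MSS.CycGR p m n) (MSS.XRels p n m a d) ↔
      ∃ (s t c₀ : ℤ[X]) (b c : Fin m → ℤ[X]),
        u 0 = s * (X - (d : ℤ[X])) + lv p n * t + (p : ℤ[X]) ^ m * c₀ ∧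
        ∀ j : Fin m, u j.succ = - (s * (p : ℤ[X]) ^ (j : ℕ)) + lev p (a j) * b j
          + (p : ℤ[X]) ^ m * c j := by
  have hset : {r : Fin (m + 1) → MSS.CycGR p m n | ∃ i : Fin m, r = MSS.sing p n m i.succ
      (WithBot.recBotCoe (1 : MSS.CycGR p m n) (fun k => MSS.gen p m n ^ p ^ k - 1) (a i))}
      = Set.range fun i : Fin m => MSS.sing p n m i.succ (ev p m n (lev p (a i))) := by
    ext r
    simp only [Set.mem_ofPred_eq, Set.mem_range, ev_lev]
    exact exists_congr fun i => eq_comm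
  have hd : MSS.gen p m n - (d : ZMod (p ^ m)) • (1 : MSS.CycGR p m n)
      = ev p m n (X - (d : ℤ[X])) := by
    rw [map_sub, ev_X, map_intCast, Int.cast_smul_eq_zsmul, zsmul_one]
  have hcomb : ∀ (s : ℤ[X]) (b : Fin m → ℤ[X]),
      ev p m n s • (MSS.sing p n m 0 (ev p m n (X - (d : ℤ[X])))
        - ∑ i : Fin m, MSS.sing p n m i.succ ((p : MSS.CycGR p m n) ^ (i : ℕ)))
        + ∑ i : Fin m, ev p m n (b i) • MSS.sing p n m i.succ (ev p m n (lev p (a i)))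
      = fun k => ev p m n (Fin.cases (motive := fun _ => ℤ[X]) (s * (X - (d : ℤ[X])))
          (fun j => - (s * (p : ℤ[X]) ^ (j : ℕ)) + lev p (a j) * b j) k) := by
    intro s b
    ext1 k
    refine Fin.cases ?_ (fun j => ?_) k
    · simp [MSS.sing]
    · simp only [MSS.sing, Pi.add_apply, Pi.smul_apply, Pi.sub_apply, Finset.sum_apply,
        Fin.cases_succ, Pi.single_apply, Fin.succ_ne_zero, Fin.succ_inj, smul_eq_mul]
      simp [mul_comm]
  rw [MSS.XRels, hset, hd, Submodule.mem_span_insert]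
  constructor
  · rintro ⟨S, z, hz, he⟩
    obtain ⟨B, rfl⟩ := (Submodule.mem_span_range_iff_exists_fun _).1 hz
    obtain ⟨s, rfl⟩ := ev_surjective hp m n S
    choose b hb using fun i => ev_surjective hp m n (B i)
    have h1 := hcomb s b
    simp only [hb] at h1
    rw [h1] at he
    have h0 := congrFun he 0
    rw [Fin.cases_zero, ← sub_eq_zero, ← map_sub, ev_eq_zero_iff hp] at h0
    have hj : ∀ j : Fin m, ∃ A B : ℤ[X], u j.succ - (- (s * (p : ℤ[X]) ^ (j : ℕ))
        + lev p (a j) * b j) = lv p n * A + (p : ℤ[X]) ^ m * B := fun j => by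
      have h0 := congrFun he j.succ
      rwa [Fin.cases_succ, ← sub_eq_zero, ← map_sub, ev_eq_zero_iff hp] at h0
    obtain ⟨t, c₀, h0⟩ := h0
    choose A c hj using hj
    choose q hq using fun j => lev_dvd_lev (p := p) (b := (n : WithBot ℕ)) (ha j)
    refine ⟨s, t, c₀, fun j => b j + q j * A j, c, by linear_combination h0, fun j => ?_⟩
    have := hq j
    rw [lev_coe] at this
    linear_combination hj j + A j * this
  · rintro ⟨s, t, c₀, b, c, h0, hj⟩
    refine ⟨ev p m n s, _, Submodule.sum_mem (t := Finset.univ) _ fun i _ => Submodule.smul_mem _ (ev p m n (b i))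
      (Submodule.subset_span ⟨i, rfl⟩), ?_⟩
    rw [hcomb]
    ext1 k
    rw [← sub_eq_zero, ← map_sub, ev_eq_zero_iff hp]
    refine Fin.cases ?_ (fun j => ?_) k
    · exact ⟨t, c₀, by rw [Fin.cases_zero, h0]; ring⟩
    · exact ⟨0, c j, by rw [Fin.cases_succ, hj j]; ring⟩

section

theorem exists_addEquiv_of_ker_eq {Z J N : Type*} [AddCommGroup Z] [AddCommGroup J]
    [AddCommGroup N] (Φ : Z →+ J) (Ψ : Z →+ N) (hΦ : Function.Surjective Φ)
    (hΨ : Function.Surjective Ψ) (h : ∀ z, Φ z = 0 ↔ Ψ z = 0) :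
    ∃ e : J ≃+ N, ∀ z, e (Φ z) = Ψ z := by
  have hker : Φ.ker = Ψ.ker := by
    ext z
    exact h z
  refine ⟨(QuotientAddGroup.quotientKerEquivOfSurjective Φ hΦ).symm.trans
    ((QuotientAddGroup.quotientAddEquivOfEq hker).trans
      (QuotientAddGroup.quotientKerEquivOfSurjective Ψ hΨ)), fun z => ?_⟩
  have : (QuotientAddGroup.quotientKerEquivOfSurjective Φ hΦ).symm (Φ z) = (z : Z ⧸ Φ.ker) := by
    rw [AddEquiv.symm_apply_eq]
    rfl
  rw [AddEquiv.trans_apply, this]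
  rfl

section target

variable {n m : ℕ} {ι : Fin (n + 1) → Type v}

/-- The index of the generator of `X_{a,d,m}` attached to a distinguished generator. -/
def optIdx (m : ℕ) (k : Fin (m + 1)) : Option (Fin m) := Fin.cases none some k

/-- The map from the free polynomial module onto `X_{a,d,m} ⊕ ⨁ Y_i`. -/
noncomputable def toTarget (p n m : ℕ) (a : Fin m → WithBot ℕ) (d : ℤ)
    (ι : Fin (n + 1) → Type v) : (Option (Fin m) ⊕ (Σ i, ι i) →₀ ℤ[X]) →+
      MSS.Xadm p n m a d × ((i : Fin (n + 1)) → (ι i →₀ MSS.CycGR p m (i : ℕ))) where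
  toFun z := (Submodule.Quotient.mk fun k => ev p m n (z (Sum.inl (optIdx m k))),
    fun i => (z.comapDomain (fun s => Sum.inr ⟨i, s⟩)
      (Sum.inr_injective.comp sigma_mk_injective).injOn).mapRange
        (ev p m i) (map_zero _))
  map_zero' := by
    refine Prod.ext ?_ ?_
    · simp only [Finsupp.zero_apply, map_zero]
      rfl
    · funext i
      ext1 s
      change ev p m i 0 = 0
      exact map_zero _
  map_add' z z' := by
    refine Prod.ext ?_ ?_
    · simp only [Finsupp.add_apply, map_add]
      rfl
    · funext i
      ext1 s
      change ev p m i (z _ + z' _) = ev p m i (z _) + ev p m i (z' _)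
      exact map_add _ _ _

theorem toTarget_smul (p : ℕ) (a : Fin m → WithBot ℕ) (d : ℤ) (f : ℤ[X])
    (z : Option (Fin m) ⊕ (Σ i, ι i) →₀ ℤ[X]) : toTarget p n m a d ι (f • z)
      = (ev p m n f • (toTarget p n m a d ι z).1,
        fun i : Fin (n + 1) => ev p m i f • (toTarget p n m a d ι z).2 i) := by
  refine Prod.ext ?_ ?_
  · simp only [toTarget, AddMonoidHom.coe_mk, ZeroHom.coe_mk, Finsupp.smul_apply, smul_eq_mul,
      map_mul]
    rfl
  · funext i
    ext1 s
    simp [toTarget]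

theorem toTarget_surjective {p : ℕ} (hp : 0 < p) (a : Fin m → WithBot ℕ) (d : ℤ) :
    Function.Surjective (toTarget p n m a d ι) := by
  rintro ⟨x, w⟩
  obtain ⟨v, rfl⟩ := Submodule.Quotient.mk_surjective _ x
  choose u hu using fun k => ev_surjective hp m n (v k)
  choose w' hw using fun i : Fin (n + 1) =>
    Finsupp.mapRange_surjective (α := ι i) _ (map_zero (ev p m i)) (ev_surjective hp m i) (w i)
  refine ⟨Finsupp.sumElim (Finsupp.equivFunOnFinite.symm
    (fun o : Option (Fin m) => u (o.elim 0 Fin.succ)))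
    (Finsupp.sigmaFinsuppEquivPiFinsupp.symm w'), ?_⟩
  refine Prod.ext ?_ ?_
  · simp only [toTarget, AddMonoidHom.coe_mk, ZeroHom.coe_mk, Finsupp.sumElim_inl]
    congr 1
    ext1 k
    rw [← hu k]
    refine Fin.cases rfl (fun j => rfl) k
  · funext i
    change _ = w i
    rw [← hw i]
    ext1 s
    simp only [toTarget, AddMonoidHom.coe_mk, ZeroHom.coe_mk, Finsupp.mapRange_apply,
      Finsupp.comapDomain_apply, Finsupp.sumElim_inr]
    rw [← Finsupp.sigmaFinsuppEquivPiFinsupp_apply, Equiv.apply_symm_apply]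

theorem toTarget_eq_zero_iff {p M : ℕ} (hp : 0 < p) {a : Fin (M + 1) → WithBot ℕ}
    (ha : ∀ j, a j ≤ n) {e : ℤ} {z : Option (Fin (M + 1)) ⊕ (Σ i, ι i) →₀ ℤ[X]} :
    toTarget p n (M + 1) a (1 + p * e) ι z = 0 ↔
      ∃ z', ∃ l ∈ relModule p e
        (Sum.elim (olev n a) (fun s : Σ i, ι i => (((s.1 : ℕ) : ℕ) : WithBot ℕ)))
        (Sum.inl none) (fun j => Sum.inl (some j)), z = (p : ℤ[X]) ^ (M + 1) • z' + l := by
  classical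
  have key : ∀ z, toTarget p n (M + 1) a (1 + p * e) ι z = 0 ↔
      ((fun k => ev p (M + 1) n (z (Sum.inl (optIdx (M + 1) k)))) ∈
        Submodule.span (MSS.CycGR p (M + 1) n) (MSS.XRels p n (M + 1) a (1 + p * e))) ∧
      ∀ s : Σ i, ι i, ev p (M + 1) s.1 (z (Sum.inr s)) = 0 := by
    intro z
    rw [Prod.ext_iff, funext_iff]
    refine and_congr (Submodule.Quotient.mk_eq_zero _) ⟨fun h s => ?_, fun h i => ?_⟩
    · exact DFunLike.congr_fun (h s.1) s.2
    · ext1 s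
      exact h ⟨i, s⟩
  constructor
  · rw [key, mem_span_XRels_iff hp ha]
    rintro ⟨⟨s, t, c₀, b, c, h0, hj⟩, hs⟩
    let R := relModule p e
        (Sum.elim (olev n a) (fun s : Σ i, ι i => (((s.1 : ℕ) : ℕ) : WithBot ℕ)))
        (Sum.inl none) (fun j => Sum.inl (some j))
    let P := LinearMap.range (LinearMap.lsmul ℤ[X] (Option (Fin (M + 1)) ⊕ (Σ i, ι i) →₀ ℤ[X])
      ((p : ℤ[X]) ^ (M + 1)))
    have hmem : ∀ (t : Option (Fin (M + 1)) ⊕ (Σ i, ι i)) (f A B : ℤ[X]),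
        f = lev p (Sum.elim (olev n a) (fun s : Σ i, ι i => (((s.1 : ℕ) : ℕ) : WithBot ℕ)) t) * A
          + (p : ℤ[X]) ^ (M + 1) * B → Finsupp.single t f ∈ P ⊔ R := by
      rintro t f A B rfl
      rw [Finsupp.single_add]
      refine add_mem (Submodule.mem_sup_right (Pres.single_mem_relModule t (dvd_mul_right _ _)))
        (Submodule.mem_sup_left ⟨Finsupp.single t B, ?_⟩)
      rw [LinearMap.lsmul_apply, Finsupp.smul_single, smul_eq_mul]
    let rel : Option (Fin (M + 1)) ⊕ (Σ i, ι i) →₀ ℤ[X] :=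
      Finsupp.single (Sum.inl none) (X - (1 + (p : ℤ[X]) * (e : ℤ[X])))
        - ∑ j : Fin (M + 1), Finsupp.single (Sum.inl (some j)) ((p : ℤ[X]) ^ (j : ℕ))
    have hrel : rel ∈ P ⊔ R := Submodule.mem_sup_right Pres.rel_mem_relModule
    have hz : z - s • rel ∈ P ⊔ R := by
      rw [← Finsupp.sum_single (z - s • rel)]
      refine Submodule.sum_mem _ fun t' _ => ?_
      rcases t' with (_ | j) | s'
      · refine hmem _ _ t c₀ ?_
        have : z (Sum.inl none) = _ := h0
        simp only [rel, Finsupp.sub_apply, Finsupp.smul_apply, Finsupp.finsetSum_apply, this]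
        simp [olev, lev_coe]
        ring
      · refine hmem _ _ (b j) (c j) ?_
        have : z (Sum.inl (some j)) = _ := hj j
        simp only [rel, Finsupp.sub_apply, Finsupp.smul_apply, Finsupp.finsetSum_apply, this]
        simp [olev, Finsupp.single_apply]
        ring
      · obtain ⟨A, B, hAB⟩ := (ev_eq_zero_iff hp).1 (hs s')
        refine hmem _ _ A B ?_
        simp only [rel, Finsupp.sub_apply, Finsupp.smul_apply, Finsupp.finsetSum_apply, hAB]
        simp [lev_coe]
    have hz' := add_mem hz (Submodule.smul_mem _ s hrel)
    rw [sub_add_cancel] at hz'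
    obtain ⟨_, ⟨z', rfl⟩, l, hl, h⟩ := Submodule.mem_sup.1 hz'
    exact ⟨z', l, hl, h.symm⟩
  · rintro ⟨z', l, hl, rfl⟩
    rw [map_add, toTarget_smul]
    have : toTarget p n (M + 1) a (1 + p * e) ι l = 0 := by
      induction hl using Submodule.span_induction with
      | mem l hl =>
        rw [key, mem_span_XRels_iff hp ha]
        rcases hl with rfl | ⟨(_ | j) | s, rfl⟩
        · refine ⟨⟨1, 0, 0, 0, 0, ?_, fun j => ?_⟩, fun s => ?_⟩
          · simp [optIdx]
          · simp [optIdx, Finsupp.single_apply]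
          · simp
        · refine ⟨⟨0, 1, 0, 0, 0, ?_, fun j => ?_⟩, fun s => ?_⟩
          · simp [optIdx, olev, lev_coe]
          · simp [optIdx]
          · simp
        · refine ⟨⟨0, 0, 0, Pi.single j 1, 0, ?_, fun k => ?_⟩, fun s => ?_⟩
          · simp [optIdx]
          · rcases eq_or_ne j k with rfl | hjk
            · simp [optIdx, olev]
            · simp [optIdx, hjk.symm]
          · simp
        · refine ⟨⟨0, 0, 0, 0, 0, ?_, fun j => ?_⟩, fun s' => ?_⟩
          · simp [optIdx]
          · simp [optIdx]
          · rcases eq_or_ne s s' with rfl | hss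
            · simp [lev_coe, ev_lv]
            · simp [hss]
      | zero => exact map_zero _
      | add l l' _ _ hl hl' => rw [map_add, hl, hl', add_zero]
      | smul f l _ hl =>
        rw [toTarget_smul, hl]
        simp
        rfl
    rw [this, add_zero, map_pow, map_natCast, pow_eq_zero_cycGR]
    refine Prod.ext (zero_smul _ _) ?_
    funext i
    simp [pow_eq_zero_cycGR]

end target

theorem Pres.exists_iso {A : Type v} [AddCommGroup A] [Module ℤ[X] A] {p n : ℕ} {ξ : A}
    {M : ℕ} {a : Fin (M + 1) → WithBot ℕ} {e : ℤ} {α : A} {g : ℕ → A}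
    {ι : Fin (n + 1) → Type v} {γ : (Σ i, ι i) → A}
    (h : Pres p n ξ a e α g
        (Sum.elim (olev n a) (fun s : Σ i, ι i => (((s.1 : ℕ) : ℕ) : WithBot ℕ)))
        (Sum.elim (ogen α g) γ) (Sum.inl none) (fun j => Sum.inl (some j)))
    {J : Type v} [AddCommGroup J] (π : A →+ J) (hπ : Function.Surjective π)
    (hker : ∀ x, π x = 0 ↔ ∃ w, x = (p : ℤ[X]) ^ (M + 1) • w) :
    ∃ E : J ≃+ (MSS.Xadm p n (M + 1) a (1 + p * e) ×
        ((i : Fin (n + 1)) → (ι i →₀ MSS.CycGR p (M + 1) (i : ℕ)))),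
      ∀ x, E (π ((X : ℤ[X]) • x)) = (MSS.gen p (M + 1) n • (E (π x)).1,
        fun i : Fin (n + 1) => MSS.gen p (M + 1) (i : ℕ) • (E (π x)).2 i) := by
  have hp := h.data.prime.pos
  let Φ := π.comp (Finsupp.linearCombination ℤ[X] (Sum.elim (ogen (m := M + 1) α g) γ)).toAddMonoidHom
  have hrep : ∀ x, ∃ z, π x = Φ z ∧ π ((X : ℤ[X]) • x) = Φ ((X : ℤ[X]) • z) := by
    intro x
    obtain ⟨z, y, rfl⟩ := h.graded.exists_sub_pow_smul h.data (M + 1) x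
    refine ⟨z, ?_, ?_⟩
    · rw [map_add, (hker _).2 ⟨y, rfl⟩, add_zero]
      rfl
    · rw [smul_add, map_add, (hker (X • _)).2 ⟨(X : ℤ[X]) • y, smul_comm _ _ _⟩, add_zero,
        ← map_smul]
      rfl
  have hΦ : Function.Surjective Φ := fun x => by
    obtain ⟨x, rfl⟩ := hπ x
    obtain ⟨z, hz, -⟩ := hrep x
    exact ⟨z, hz.symm⟩
  obtain ⟨E, hE⟩ := exists_addEquiv_of_ker_eq Φ (toTarget p n (M + 1) a (1 + p * e) ι) hΦ
    (toTarget_surjective hp a _) fun z => by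
      rw [toTarget_eq_zero_iff hp h.good.le]
      constructor
      · intro hz
        obtain ⟨w, hw⟩ := (hker _).1 hz
        exact h.exists_eq_pow_smul_add (M + 1) le_rfl hw
      · rintro ⟨z', l, hl, rfl⟩
        obtain ⟨w, hw⟩ := h.map_mem_of_mem_relModule hl
        refine (hker _).2 ⟨Finsupp.linearCombination ℤ[X] (Sum.elim (ogen (m := M + 1) α g) γ) z' + w, ?_⟩
        rw [smul_add, ← hw, ← map_smul, ← map_add]
        rfl
  refine ⟨E, fun x => ?_⟩
  obtain ⟨z, h1, h2⟩ := hrep x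
  rw [h1, h2, hE, hE, toTarget_smul, ev_X]
  simp only [ev_X]

end

section

/-- Numerical conditions on a norm pair forcing `X_{a,d,m}` to be indecomposable. -/
structure Tight (p n : ℕ) {M : ℕ} (a : Fin (M + 1) → WithBot ℕ) (e : ℤ) : Prop where
  prime : p.Prime
  pos : 0 < n
  le : ∀ j, a j ≤ n
  lt : a 0 < n
  special : p = 2 → n = 1 → a 0 = ⊥
  order : ∀ i j : Fin (M + 1), j < i → a i ≠ ⊥ → (a j ≠ ⊥ ∨ j = 0) → a j < a i ∧
    ∃ Q : ℤ[X], lev p (a i) = lev p (a j) * Q ∧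
      (p : ℤ) ^ ((i : ℕ) - (j : ℕ) + 1) ∣ Q.eval (1 + p * e)

/-- A presentation of a module by the relations of `X_{a,d,m}`. -/
structure Presents {V : Type*} [AddCommGroup V] [Module ℤ[X] V] (p n : ℕ) {M : ℕ}
    (a : Fin (M + 1) → WithBot ℕ) (e : ℤ) (y : V) (x : Fin (M + 1) → V) : Prop where
  gen : ∀ z : V, ∃ (f : ℤ[X]) (c : Fin (M + 1) → ℤ[X]), z = f • y + ∑ k, c k • x k
  rel : ∀ (f : ℤ[X]) (g : Fin (M + 1) → ℤ[X]), f • y + ∑ k, g k • x k = 0 ↔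
    ∃ (s t c₀ : ℤ[X]) (b c : Fin (M + 1) → ℤ[X]),
      f = s * (X - (1 + (p : ℤ[X]) * (e : ℤ[X]))) + lv p n * t + (p : ℤ[X]) ^ (M + 1) * c₀ ∧
      ∀ j, g j = - (s * (p : ℤ[X]) ^ (j : ℕ)) + lev p (a j) * b j + (p : ℤ[X]) ^ (M + 1) * c j

variable {V : Type*} [AddCommGroup V] [Module ℤ[X] V] {p n M : ℕ}
  {a : Fin (M + 1) → WithBot ℕ} {e : ℤ} {y : V} {x : Fin (M + 1) → V}

namespace Presents

theorem y_rel (h : Presents p n a e y x) :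
    (X - (1 + (p : ℤ[X]) * (e : ℤ[X]))) • y = ∑ k : Fin (M + 1), ((p : ℤ[X]) ^ (k : ℕ)) • x k := by
  have := (h.rel (X - (1 + (p : ℤ[X]) * (e : ℤ[X]))) (fun k : Fin (M + 1) => - (p : ℤ[X]) ^ (k : ℕ))).2
    ⟨1, 0, 0, 0, 0, by simp, fun j => by simp⟩
  simpa only [neg_smul, Finset.sum_neg_distrib, ← sub_eq_add_neg, sub_eq_zero] using this

theorem y_level (h : Presents p n a e y x) : lv p n • y = 0 := by
  have := (h.rel (lv p n) 0).2 ⟨0, 1, 0, 0, 0, by simp, fun j => by simp⟩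
  simpa using this

theorem y_pow (h : Presents p n a e y x) : ((p : ℤ[X]) ^ (M + 1)) • y = 0 := by
  have := (h.rel ((p : ℤ[X]) ^ (M + 1)) 0).2 ⟨0, 0, 1, 0, 0, by simp, fun j => by simp⟩
  simpa using this

theorem x_level (h : Presents p n a e y x) (i : Fin (M + 1)) : lev p (a i) • x i = 0 := by
  have := (h.rel 0 (Pi.single i (lev p (a i)))).2 ⟨0, 0, 0, Pi.single i 1, 0, by simp, fun j => by
    rcases eq_or_ne j i with rfl | hj
    · simp
    · simp [hj]⟩
  simpa [Pi.single_apply] using this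

theorem x_pow (h : Presents p n a e y x) (i : Fin (M + 1)) :
    ((p : ℤ[X]) ^ (M + 1)) • x i = 0 := by
  have := (h.rel 0 (Pi.single i ((p : ℤ[X]) ^ (M + 1)))).2
    ⟨0, 0, 0, 0, Pi.single i 1, by simp, fun j => by
    rcases eq_or_ne j i with rfl | hj
    · simp
    · simp [hj]⟩
  simpa [Pi.single_apply] using this

theorem x_eq_zero (h : Presents p n a e y x) {i : Fin (M + 1)} (hi : a i = ⊥) : x i = 0 := by
  have := h.x_level i
  rwa [hi, lev_bot, one_smul] at this

end Presents

/-- Matrix entries over `ℤ[X]` representing an endomorphism of `X_{a,d,m}`, chosen so that the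
first defining relation holds exactly. -/
structure Lift (p : ℕ) (a : Fin (M + 1) → WithBot ℕ) (e : ℤ) (y : V) (x : Fin (M + 1) → V)
    (φ : V →ₗ[ℤ[X]] V) (f : ℤ[X]) (c u : Fin (M + 1) → ℤ[X])
    (C : Fin (M + 1) → Fin (M + 1) → ℤ[X]) : Prop where
  map_y : φ y = f • y + ∑ k, c k • x k
  map_x : ∀ i, φ (x i) = u i • y + ∑ k, C i k • x k
  rel_y : (X - (1 + (p : ℤ[X]) * (e : ℤ[X]))) * f = ∑ j : Fin (M + 1), (p : ℤ[X]) ^ (j : ℕ) * u j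
  rel_x : ∀ k, (X - (1 + (p : ℤ[X]) * (e : ℤ[X]))) * c k = ∑ j : Fin (M + 1), (p : ℤ[X]) ^ (j : ℕ) * C j k
  bot : ∀ i, i ≠ 0 → a i = ⊥ → u i = 0 ∧ ∀ k, C i k = 0

theorem Presents.exists_lift (h : Presents p n a e y x) (φ : V →ₗ[ℤ[X]] V) (f : ℤ[X])
    (c : Fin (M + 1) → ℤ[X]) (hy : φ y = f • y + ∑ k, c k • x k) :
    ∃ u C, Lift p a e y x φ f c u C := by
  have h1 : ∀ i, ∃ (u : ℤ[X]) (C : Fin (M + 1) → ℤ[X]),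
      φ (x i) = u • y + ∑ k, C k • x k ∧ (a i = ⊥ → u = 0 ∧ ∀ k, C k = 0) := by
    intro i
    by_cases hi : a i = ⊥
    · exact ⟨0, 0, by simp [h.x_eq_zero hi], fun _ => ⟨rfl, fun _ => rfl⟩⟩
    · obtain ⟨u, C, hu⟩ := h.gen (φ (x i))
      exact ⟨u, C, hu, fun h => absurd h hi⟩
  choose u C hx hbot using h1
  let D : ℤ[X] := X - (1 + (p : ℤ[X]) * (e : ℤ[X]))
  let u' : Fin (M + 1) → ℤ[X] := Fin.cases
    (D * f - ∑ j : Fin M, (p : ℤ[X]) ^ ((j.succ : Fin (M + 1)) : ℕ) * u j.succ)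
    (fun j => u j.succ)
  let C' : Fin (M + 1) → Fin (M + 1) → ℤ[X] := Fin.cases
    (fun k => D * c k - ∑ j : Fin M, (p : ℤ[X]) ^ ((j.succ : Fin (M + 1)) : ℕ) * C j.succ k)
    (fun j => C j.succ)
  refine ⟨u', C', hy, fun i => ?_, ?_, fun k => ?_, fun i => ?_⟩
  · refine Fin.cases ?_ (fun j => hx j.succ) i
    have hr := congrArg φ h.y_rel
    rw [map_smul, map_sum, Fin.sum_univ_succ, map_smul, Fin.val_zero, pow_zero,
      one_smul, hy] at hr
    rw [← sub_eq_iff_eq_add] at hr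
    rw [← hr]
    have h2 : ∑ j : Fin M, φ ((p : ℤ[X]) ^ ((j.succ : Fin (M + 1)) : ℕ) • x j.succ)
        = (∑ j : Fin M, (p : ℤ[X]) ^ ((j.succ : Fin (M + 1)) : ℕ) * u j.succ) • y
          + ∑ k, (∑ j : Fin M, (p : ℤ[X]) ^ ((j.succ : Fin (M + 1)) : ℕ) * C j.succ k) • x k := by
      simp only [map_smul, hx, smul_add, Finset.sum_add_distrib, Finset.sum_smul, mul_smul,
        Finset.smul_sum]
      congr 1
      exact Finset.sum_comm
    rw [h2]
    simp only [u', C', Fin.cases_zero, sub_smul, Finset.sum_sub_distrib, mul_smul, smul_add,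
      Finset.smul_sum, D]
    abel
  · rw [Fin.sum_univ_succ]
    simp [u', D]
  · rw [Fin.sum_univ_succ]
    simp [C', D]
  · refine Fin.cases (fun h => absurd rfl h) (fun j _ hj => ?_) i
    exact hbot j.succ hj

namespace Lift

variable {φ : V →ₗ[ℤ[X]] V} {f : ℤ[X]} {c u : Fin (M + 1) → ℤ[X]}
    {C : Fin (M + 1) → Fin (M + 1) → ℤ[X]}

theorem exists_level (L : Lift p a e y x φ f c u C) (h : Presents p n a e y x)
    (i : Fin (M + 1)) : ∃ (s t c₀ : ℤ[X]) (b c : Fin (M + 1) → ℤ[X]),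
      lev p (a i) * u i = s * (X - (1 + (p : ℤ[X]) * (e : ℤ[X]))) + lv p n * t
        + (p : ℤ[X]) ^ (M + 1) * c₀ ∧
      ∀ j, lev p (a i) * C i j = - (s * (p : ℤ[X]) ^ (j : ℕ)) + lev p (a j) * b j
        + (p : ℤ[X]) ^ (M + 1) * c j := by
  refine (h.rel _ _).1 ?_
  have h1 := congrArg φ (h.x_level i)
  rw [map_smul, map_zero, L.map_x, smul_add, Finset.smul_sum] at h1
  simpa only [mul_smul] using h1

theorem pow_dvd (p : ℕ) {k l : ℕ} (h : k ≤ l) : ∃ r : ℤ[X], (p : ℤ[X]) ^ l = (p : ℤ[X]) ^ k * r :=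
  pow_dvd_pow _ h

theorem u_mem (L : Lift p a e y x φ f c u C) (h : Presents p n a e y x) (T : Tight p n a e)
    {i : Fin (M + 1)} (hi0 : i ≠ 0) (hi : a i < n) : u i ∈ augIdeal p 1 := by
  by_cases hb : a i = ⊥
  · rw [(L.bot i hi0 hb).1]
    exact zero_mem _
  obtain ⟨s, t, c₀, b, c', h1, h2⟩ := L.exists_level h i
  obtain ⟨r, hr⟩ := pow_dvd p (k := (i : ℕ) + 1) (l := M + 1) i.isLt
  have hp0 : (p : ℤ[X]) ^ (i : ℕ) ≠ 0 := pow_ne_zero _ (by exact_mod_cast T.prime.ne_zero)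
  obtain ⟨A, hA⟩ := cancel_lev T.prime.pos (a i) (e := (i : ℕ)) (c := C i i - b i) (Q := 0) (b := 0)
    (A := - s + (p : ℤ[X]) * r * c' i) (by
      linear_combination h2 i + c' i * hr)
  have h3 : s = - (lev p (a i) * A) + (p : ℤ[X]) * (r * c' i) := by
    apply mul_left_cancel₀ hp0
    linear_combination h2 i + c' i * hr - lev p (a i) * hA
  rw [← lev_mul_mem_augIdeal_iff T.prime (a i), h1]
  have hr' : (p : ℤ[X]) ^ (M + 1) * c₀ = (p : ℤ[X]) * ((p : ℤ[X]) ^ M * c₀) := by ring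
  refine add_mem (add_mem ?_ (augIdeal_mono (len_lt_len T.prime hi)
    (lv_mul_mem_augIdeal T.prime n t))) (hr' ▸ p_mul_mem_augIdeal _ _ _)
  have h4 : s * (X - (1 + (p : ℤ[X]) * (e : ℤ[X])))
      = lev p (a i) * ((X - 1) ^ 1 * (- A))
        + (p : ℤ[X]) * (r * c' i * (X - 1) - s * (e : ℤ[X])) := by
    linear_combination (X - 1) * h3
  rw [h4]
  exact add_mem ((lev_mul_mem_augIdeal_iff T.prime _).2 (pow_mul_mem_augIdeal le_rfl _))
    (p_mul_mem_augIdeal _ _ _)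

theorem C_mem (L : Lift p a e y x φ f c u C) (h : Presents p n a e y x) (T : Tight p n a e)
    {i k : Fin (M + 1)} (hik : a i < a k) (hk0 : k ≠ 0) : C i k ∈ augIdeal p 1 := by
  obtain ⟨s, t, c₀, b, c', -, h2⟩ := L.exists_level h i
  obtain ⟨l, hl⟩ := Nat.exists_eq_succ_of_ne_zero (Fin.val_ne_zero_iff.2 hk0)
  rw [← lev_mul_mem_augIdeal_iff T.prime (a i), h2]
  obtain ⟨r, hr⟩ := exists_lev_eq T.prime (a k)
  have : - (s * (p : ℤ[X]) ^ (k : ℕ)) + lev p (a k) * b k + (p : ℤ[X]) ^ (M + 1) * c' k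
      = (p : ℤ[X]) * (- (s * (p : ℤ[X]) ^ l) + r * b k + (p : ℤ[X]) ^ M * c' k)
        + (X - 1) ^ len p (a k) * b k := by
    rw [hl, hr, Nat.succ_eq_add_one]
    ring
  rw [this]
  exact add_mem (p_mul_mem_augIdeal _ _ _) (pow_mul_mem_augIdeal (len_lt_len T.prime hik) _)

end Lift

theorem Tight.len_add_one_lt (T : Tight p n a e) : len p (a 0) + 1 < p ^ n := by
  have h2 := T.prime.two_le
  have h3 : p ^ 1 ≤ p ^ n := Nat.pow_le_pow_right T.prime.pos T.pos
  have h4 := len_lt_len T.prime T.lt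
  rw [len_coe] at h4
  refine lt_of_le_of_ne h4 fun h => ?_
  have hn := T.pos
  have h5 : a 0 ≠ ⊥ → False := by
    intro hb
    rcases withBot_cases (a 0) with h' | ⟨k, hk⟩
    · exact hb h'
    have hlt := T.lt
    rw [hk, len_coe] at h
    rw [hk] at hlt
    have hkn : k < n := by exact_mod_cast hlt
    rcases Nat.eq_zero_or_pos k with rfl | hk0
    · rw [pow_zero] at h
      have hp2 : p = 2 := by rw [pow_one] at h3; omega
      subst hp2
      have hn1 : n = 1 := Nat.pow_right_injective le_rfl (by simpa using h.symm)
      exact hb (T.special rfl hn1)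
    · have e1 : p ∣ p ^ k := dvd_pow_self p hk0.ne'
      have e2 : p ∣ p ^ k + 1 := h ▸ dvd_pow_self p hn.ne'
      exact T.prime.one_lt.ne' (Nat.dvd_one.1 ((Nat.dvd_add_right e1).1 e2))
  by_cases hb : a 0 = ⊥
  · rw [hb, len_bot] at h
    rw [pow_one] at h3
    omega
  · exact h5 hb

end

section

variable {V : Type*} [AddCommGroup V] [Module ℤ[X] V] {p n M : ℕ}
  {a : Fin (M + 1) → WithBot ℕ} {e : ℤ} {y : V} {x : Fin (M + 1) → V}

namespace Lift

variable {φ : V →ₗ[ℤ[X]] V} {f : ℤ[X]} {c u : Fin (M + 1) → ℤ[X]}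
    {C : Fin (M + 1) → Fin (M + 1) → ℤ[X]}

theorem eval_sum_eq_zero (L : Lift p a e y x φ f c u C) (k : Fin (M + 1)) :
    ∑ j : Fin (M + 1), (p : ℤ) ^ (j : ℕ) * (C j k).eval (1 + p * e) = 0 := by
  have := congrArg (eval (1 + (p : ℤ) * e)) (L.rel_x k)
  rw [eval_mul, eval_finsetSum] at this
  simpa using this.symm

theorem u_zero_eq (L : Lift p a e y x φ f c u C) :
    ∃ r, u 0 = (X - 1) * f + (p : ℤ[X]) * r := by
  refine ⟨-(e : ℤ[X]) * f - ∑ j : Fin M, (p : ℤ[X]) ^ (j : ℕ) * u j.succ, ?_⟩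
  have := L.rel_y
  rw [Fin.sum_univ_succ] at this
  simp only [Fin.val_zero, pow_zero, one_mul, Fin.val_succ, pow_succ', mul_assoc,
    ← Finset.mul_sum] at this
  linear_combination -this

theorem C_zero_eq (L : Lift p a e y x φ f c u C) (k : Fin (M + 1)) :
    ∃ r, C 0 k = (X - 1) * c k + (p : ℤ[X]) * r := by
  refine ⟨-(e : ℤ[X]) * c k - ∑ j : Fin M, (p : ℤ[X]) ^ (j : ℕ) * C j.succ k, ?_⟩
  have := L.rel_x k
  rw [Fin.sum_univ_succ] at this
  simp only [Fin.val_zero, pow_zero, one_mul, Fin.val_succ, pow_succ', mul_assoc,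
    ← Finset.mul_sum] at this
  linear_combination -this

theorem u_zero_mem (L : Lift p a e y x φ f c u C) : u 0 ∈ augIdeal p 1 := by
  obtain ⟨r, hr⟩ := L.u_zero_eq
  exact mem_augIdeal.2 ⟨r, f, by rw [hr]; ring⟩

/-- Off-diagonal contributions to the evaluation at the twist. -/
theorem pow_dvd_eval (L : Lift p a e y x φ f c u C) (h : Presents p n a e y x)
    (T : Tight p n a e) {i j : Fin (M + 1)} (hi : a i ≠ ⊥) (hj0 : j ≠ 0) (hji : j ≠ i) :
    (p : ℤ) ^ ((i : ℕ) + 1) ∣ (p : ℤ) ^ (j : ℕ) * (C j i).eval (1 + p * e) := by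
  rcases lt_or_gt_of_ne hji with hlt | hgt
  · by_cases hb : a j = ⊥
    · rw [(L.bot j hj0 hb).2 i]
      simp
    obtain ⟨-, Q, hQ, hQd⟩ := T.order i j hlt hi (Or.inl hb)
    obtain ⟨s, t, c₀, b, c', -, h2⟩ := L.exists_level h j
    obtain ⟨r, hr⟩ := pow_dvd p (k := (i : ℕ)) (l := M + 1) i.isLt.le
    obtain ⟨A, hA⟩ := cancel_lev T.prime.pos (a j) (e := (i : ℕ)) (c := C j i) (Q := Q) (b := b i)
      (A := - s + r * c' i) (by linear_combination h2 i + c' i * hr + b i * hQ)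
    have hj1 : 1 ≤ (j : ℕ) := Nat.one_le_iff_ne_zero.2 (Fin.val_ne_zero_iff.2 hj0)
    have hlt' : (j : ℕ) < i := hlt
    have e1 : (p : ℤ) ^ ((i : ℕ) + 1) = (p : ℤ) ^ (j : ℕ) * (p : ℤ) ^ ((i : ℕ) - (j : ℕ) + 1) := by
      rw [← pow_add]
      congr 1
      omega
    rw [e1]
    refine mul_dvd_mul_left _ ?_
    rw [hA, eval_add, eval_mul, eval_mul]
    refine dvd_add (Dvd.dvd.mul_right hQd _) (Dvd.dvd.mul_right ?_ _)
    have : eval (1 + (p : ℤ) * e) ((p : ℤ[X]) ^ (i : ℕ)) = (p : ℤ) ^ (i : ℕ) := by simp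
    rw [this]
    exact pow_dvd_pow _ (by omega)
  · have hgt' : (i : ℕ) < j := hgt
    exact Dvd.dvd.mul_right (pow_dvd_pow _ hgt') _

theorem pow_dvd_eval_zero (L : Lift p a e y x φ f c u C) (h : Presents p n a e y x)
    (T : Tight p n a e) {i : Fin (M + 1)} (hi : a i ≠ ⊥) (hi0 : i ≠ 0) :
    (p : ℤ) ^ ((i : ℕ) + 1) ∣ (C 0 i).eval (1 + p * e) + (p : ℤ) ^ (i : ℕ) * f.eval (1 + p * e) := by
  obtain ⟨-, Q, hQ, hQd⟩ := T.order i 0 (Fin.pos_of_ne_zero hi0) hi (Or.inr rfl)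
  obtain ⟨s, t, c₀, b, c', h1, h2⟩ := L.exists_level h 0
  obtain ⟨r, hr⟩ := pow_dvd p (k := (i : ℕ) + 1) (l := M + 1) i.isLt
  obtain ⟨ru, hu⟩ := L.u_zero_eq
  obtain ⟨rl, hl⟩ := exists_lv_eq T.prime n
  obtain ⟨r0, h0⟩ := exists_lev_eq T.prime (a 0)
  have hlen := T.len_add_one_lt
  obtain ⟨E, hE⟩ := Nat.exists_eq_add_of_lt hlen
  have hs : ∃ w, s = lev p (a 0) * f - (X - 1) ^ (len p (a 0) + E + 1) * t + (p : ℤ[X]) * w := by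
    have : (X - 1) * (s - (lev p (a 0) * f - (X - 1) ^ (len p (a 0) + E + 1) * t))
        = (p : ℤ[X]) * (lev p (a 0) * ru + s * (e : ℤ[X]) - rl * t - (p : ℤ[X]) ^ M * c₀) := by
      rw [hl, hE] at h1
      rw [hu] at h1
      linear_combination -h1
    obtain ⟨w, hw⟩ := exists_eq_mul_of_eval_one
      (f := lev p (a 0) * ru + s * (e : ℤ[X]) - rl * t - (p : ℤ[X]) ^ M * c₀) (by
        have h3 := congrArg (eval 1) this
        rw [eval_mul, eval_mul, eval_sub, eval_X, eval_one, sub_self, zero_mul,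
          eval_natCast] at h3
        exact (mul_eq_zero.1 h3.symm).resolve_left (by exact_mod_cast T.prime.ne_zero))
    refine ⟨w, ?_⟩
    apply mul_left_cancel₀ X_sub_one_ne_zero
    linear_combination this + (p : ℤ[X]) * hw
  obtain ⟨w, hw⟩ := hs
  obtain ⟨A, hA⟩ := cancel_lev T.prime.pos (a 0) (e := (i : ℕ) + 1)
    (c := C 0 i + (p : ℤ[X]) ^ (i : ℕ) * (f - (X - 1) ^ (E + 1) * t)) (Q := Q) (b := b i)
    (A := - w + r * c' i - r0 * (X - 1) ^ (E + 1) * t) (by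
      linear_combination h2 i + c' i * hr + b i * hQ - (p : ℤ[X]) ^ (i : ℕ) * hw
        - (p : ℤ[X]) ^ (i : ℕ) * (X - 1) ^ (E + 1) * t * h0)
  have h5 := congrArg (eval (1 + (p : ℤ) * e)) hA
  have h6 : (C 0 i).eval (1 + p * e) + (p : ℤ) ^ (i : ℕ) * f.eval (1 + p * e)
      = Q.eval (1 + p * e) * (b i).eval (1 + p * e)
        + (p : ℤ) ^ ((i : ℕ) + 1) * (A.eval (1 + p * e) + (p * e) ^ E * e * t.eval (1 + p * e)) := by
    simp only [eval_add, eval_mul, eval_sub, eval_pow, eval_X, eval_one, eval_natCast] at h5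
    linear_combination h5
  rw [h6]
  rw [Fin.val_zero, Nat.sub_zero] at hQd
  exact dvd_add (Dvd.dvd.mul_right hQd _) (dvd_mul_right _ _)

theorem diag_sub_mem (L : Lift p a e y x φ f c u C) (h : Presents p n a e y x)
    (T : Tight p n a e) {i : Fin (M + 1)} (hi : a i ≠ ⊥) (hi0 : i ≠ 0) :
    C i i - f ∈ augIdeal p 1 := by
  classical
  let d : ℤ := 1 + p * e
  let R : Fin (M + 1) → ℤ := fun j => (p : ℤ) ^ (j : ℕ) * (C j i).eval d
    + (if j = 0 then (p : ℤ) ^ (i : ℕ) * f.eval d else 0)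
    - (if j = i then (p : ℤ) ^ (i : ℕ) * f.eval d else 0)
  have hsum : ∑ j, R j = 0 := by
    have := L.eval_sum_eq_zero i
    simp only [R, Finset.sum_add_distrib, Finset.sum_sub_distrib, Finset.sum_ite_eq',
      Finset.mem_univ, if_true, d, this]
    ring
  have hdvd : ∀ j ∈ Finset.univ.erase i, (p : ℤ) ^ ((i : ℕ) + 1) ∣ R j := by
    intro j hj
    have hji := Finset.ne_of_mem_erase hj
    simp only [R, if_neg hji, sub_zero]
    rcases eq_or_ne j 0 with rfl | hj0
    · simpa using L.pow_dvd_eval_zero h T hi hi0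
    · simpa [hj0] using L.pow_dvd_eval h T hi hj0 hji
  have h1 : (p : ℤ) ^ ((i : ℕ) + 1) ∣ R i := by
    rw [← Finset.add_sum_erase _ _ (Finset.mem_univ i)] at hsum
    rw [eq_neg_of_add_eq_zero_left hsum]
    exact (Finset.dvd_sum hdvd).neg_right
  have h2 : R i = (p : ℤ) ^ (i : ℕ) * (C i i - f).eval d := by
    simp only [R, if_neg hi0, if_true, eval_sub]
    ring
  rw [h2, pow_succ] at h1
  have h3 := Int.dvd_of_mul_dvd_mul_left (pow_ne_zero _ (by exact_mod_cast T.prime.ne_zero)) h1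
  rw [mem_augIdeal_one]
  have h4 : (p : ℤ) ∣ (C i i - f).eval d - (C i i - f).eval 1 := by
    refine dvd_trans ⟨e, ?_⟩ (sub_dvd_eval_sub d 1 (C i i - f))
    simp [d]
  exact (dvd_sub_right h3).1 h4

theorem c_mem (L : Lift p a e y x φ f c u C) (h : Presents p n a e y x)
    (T : Tight p n a e) {l : Fin (M + 1)} (hl : a l = n) : c l ∈ augIdeal p 1 := by
  have hl0 : l ≠ 0 := by
    rintro rfl
    exact T.lt.ne hl
  obtain ⟨s, t, c₀, b, c', -, h2⟩ := L.exists_level h 0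
  obtain ⟨rl, hrl⟩ := exists_lev_eq T.prime (a l)
  obtain ⟨r0, h0⟩ := exists_lev_eq T.prime (a 0)
  obtain ⟨rc, hrc⟩ := L.C_zero_eq l
  obtain ⟨k, hk⟩ := Nat.exists_eq_succ_of_ne_zero (Fin.val_ne_zero_iff.2 hl0)
  have hlen := T.len_add_one_lt
  rw [hl, len_coe] at hrl
  refine augIdeal_cancel_pow T.prime.pos (len p (a 0) + 1) (augIdeal_mono (k := p ^ n) hlen ?_)
  have h3 := h2 l
  rw [hl, hrl, hk, Nat.succ_eq_add_one] at h3
  refine mem_augIdeal.2 ⟨- (r0 * (X - 1) * c l) - lev p (a 0) * rc - s * (p : ℤ[X]) ^ k + rl * b l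
    + (p : ℤ[X]) ^ M * c' l, b l, ?_⟩
  linear_combination h3 - lev p (a 0) * hrc - (X - 1) * c l * h0

end Lift

end

section

variable {V : Type*} [AddCommGroup V] [Module ℤ[X] V] {p n M : ℕ}
  {a : Fin (M + 1) → WithBot ℕ} {e : ℤ} {y : V} {x : Fin (M + 1) → V}

theorem X_sub_mem_augIdeal (p : ℕ) (e : ℤ) :
    X - (1 + (p : ℤ[X]) * (e : ℤ[X])) ∈ augIdeal p 1 :=
  mem_augIdeal.2 ⟨-(e : ℤ[X]), 1, by ring⟩

theorem augIdeal_one_pow_le {I : Ideal ℤ[X]} (hp : p.Prime) {k : ℕ}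
    (h1 : (p : ℤ[X]) ^ k ∈ I) (h2 : lv p n ∈ I) : ∃ l, augIdeal p 1 ^ l ≤ I := by
  have hpI : (p : ℤ[X]) ∈ I.radical := ⟨k, h1⟩
  refine Ideal.exists_pow_le_of_le_radical_of_fg (fun f hf => ?_) (IsNoetherian.noetherian _)
  obtain ⟨A, B, rfl⟩ := mem_augIdeal.1 hf
  refine add_mem (Ideal.mul_mem_right _ _ hpI) (Ideal.mul_mem_right _ _ ?_)
  rw [pow_one]
  obtain ⟨r, hr⟩ := exists_lv_eq hp n
  have h3 : (X - 1 : ℤ[X]) ^ p ^ n ∈ I.radical := by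
    rw [eq_sub_of_add_eq hr.symm]
    exact sub_mem (Ideal.le_radical h2) (Ideal.mul_mem_right _ _ hpI)
  exact Ideal.mem_radical_of_pow_mem h3

namespace Presents

theorem level_smul (h : Presents p n a e y x) (T : Tight p n a e) (z : V) : lv p n • z = 0 := by
  obtain ⟨f, c, rfl⟩ := h.gen z
  rw [smul_add, smul_comm, h.y_level, smul_zero, zero_add, Finset.smul_sum]
  refine Finset.sum_eq_zero fun k _ => ?_
  obtain ⟨q, hq⟩ := lev_dvd_lev (p := p) (T.le k)
  rw [lev_coe] at hq
  rw [smul_comm, hq, mul_comm, mul_smul, h.x_level, smul_zero, smul_zero]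

theorem pow_smul (h : Presents p n a e y x) (z : V) : ((p : ℤ[X]) ^ (M + 1)) • z = 0 := by
  obtain ⟨f, c, rfl⟩ := h.gen z
  rw [smul_add, smul_comm, h.y_pow, smul_zero, zero_add, Finset.smul_sum]
  refine Finset.sum_eq_zero fun k _ => ?_
  rw [smul_comm, h.x_pow, smul_zero]

theorem eq_zero_of_range_le (h : Presents p n a e y x) (T : Tight p n a e)
    {φ : V →ₗ[ℤ[X]] V} (hφ : ∀ z, φ (φ z) = φ z)
    (hN : ∀ z, φ z ∈ augIdeal p 1 • (⊤ : Submodule ℤ[X] V)) : φ = 0 := by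
  have h1 : ∀ k, LinearMap.range φ ≤ augIdeal p 1 ^ k • (⊤ : Submodule ℤ[X] V) := by
    intro k
    induction k with
    | zero => simp
    | succ k ih =>
      rintro _ ⟨z, rfl⟩
      rw [← hφ]
      have h2 : φ (φ z) ∈ Submodule.map φ (augIdeal p 1 • (⊤ : Submodule ℤ[X] V)) :=
        ⟨_, hN z, rfl⟩
      rw [Submodule.map_smul'', Submodule.map_top] at h2
      rw [pow_succ', Submodule.mul_smul]
      exact smul_mono_right _ ih h2
  obtain ⟨l, hl⟩ := augIdeal_one_pow_le (I := Module.annihilator ℤ[X] V) (n := n) T.prime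
    (Module.mem_annihilator.2 h.pow_smul) (Module.mem_annihilator.2 (h.level_smul T))
  ext z
  have h3 := Submodule.smul_mono_left hl (h1 l ⟨z, rfl⟩)
  have h4 : Module.annihilator ℤ[X] V • (⊤ : Submodule ℤ[X] V) = ⊥ := by
    rw [← Submodule.annihilator_top, Submodule.annihilator_smul]
  rw [h4] at h3
  exact h3

theorem eq_zero_of_mem (h : Presents p n a e y x) (T : Tight p n a e)
    {φ : V →ₗ[ℤ[X]] V} (hφ : ∀ z, φ (φ z) = φ z) {f : ℤ[X]} {c : Fin (M + 1) → ℤ[X]}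
    (hy : φ y = f • y + ∑ k, c k • x k) (hf : f ∈ augIdeal p 1) : φ = 0 := by
  obtain ⟨u, C, L⟩ := h.exists_lift φ f c hy
  let N : Submodule ℤ[X] V := augIdeal p 1 • (⊤ : Submodule ℤ[X] V)
  have hN : ∀ {g : ℤ[X]} (z : V), g ∈ augIdeal p 1 → g • z ∈ N := fun z hg =>
    Submodule.smul_mem_smul hg trivial
  have hφN : ∀ {z}, z ∈ N → φ z ∈ N := by
    intro z hz
    have h2 : φ z ∈ Submodule.map φ N := ⟨z, hz, rfl⟩
    rw [Submodule.map_smul''] at h2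
    exact (smul_mono_right _ le_top : augIdeal p 1 • Submodule.map φ ⊤ ≤ N) h2
  have hx0 : x 0 ∈ N := by
    have h1 := h.y_rel
    rw [Fin.sum_univ_succ, Fin.val_zero, pow_zero, one_smul, ← sub_eq_iff_eq_add] at h1
    rw [← h1]
    refine sub_mem (hN _ (X_sub_mem_augIdeal p e)) (Submodule.sum_mem _ fun j _ => hN _ ?_)
    rw [Fin.val_succ, pow_succ']
    exact p_mul_mem_augIdeal _ _ _
  have hxi : ∀ i, φ (x i) = u i • φ y + ∑ k, C i k • φ (x k) := by
    intro i
    conv_lhs => rw [← hφ, L.map_x, map_add, map_smul, map_sum]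
    simp only [map_smul]
  have hyy : φ y = f • φ y + ∑ k, c k • φ (x k) := by
    conv_lhs => rw [← hφ, hy, map_add, map_smul, map_sum]
    simp only [map_smul]
  have hdiag : ∀ i, i ≠ 0 → a i ≠ ⊥ → C i i ∈ augIdeal p 1 := fun i hi0 hi => by
    have := add_mem (L.diag_sub_mem h T hi hi0) hf
    rwa [sub_add_cancel] at this
  have hne : ∀ {i}, ¬ a i < n → a i = n := fun {i} hi => le_antisymm (T.le i) (not_lt.1 hi)
  have step1 : ∀ l : ℕ, ∀ i : Fin (M + 1), (i : ℕ) = l → a i < n → φ (x i) ∈ N := by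
    intro l
    induction l using Nat.strong_induction_on with
    | _ l ih =>
      intro i hil hi
      rcases eq_or_ne i 0 with rfl | hi0
      · exact hφN hx0
      by_cases hb : a i = ⊥
      · rw [h.x_eq_zero hb, map_zero]
        exact zero_mem _
      rw [hxi]
      refine add_mem (hN _ (L.u_mem h T hi0 hi)) (Submodule.sum_mem _ fun k _ => ?_)
      rcases lt_trichotomy k i with hk | rfl | hk
      · refine Submodule.smul_mem _ _ (ih k (hil ▸ hk) k rfl ?_)
        by_cases hkb : a k = ⊥
        · rw [hkb]
          exact WithBot.bot_lt_coe n
        · exact (T.order i k hk hb (Or.inl hkb)).1.trans hi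
      · exact hN _ (hdiag k hi0 hb)
      · by_cases hkb : a k = ⊥
        · rw [h.x_eq_zero hkb, map_zero, smul_zero]
          exact zero_mem _
        · refine hN _ (L.C_mem h T (T.order k i hk hkb (Or.inl hb)).1 ?_)
          rintro rfl
          exact absurd hk (Fin.not_lt_zero _)
  have hyN : φ y ∈ N := by
    rw [hyy]
    refine add_mem (hN _ hf) (Submodule.sum_mem _ fun k _ => ?_)
    by_cases hk : a k < n
    · exact Submodule.smul_mem _ _ (step1 k k rfl hk)
    · exact hN _ (L.c_mem h T (hne hk))
  have hxN : ∀ i, φ (x i) ∈ N := by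
    intro i
    by_cases hi : a i < n
    · exact step1 i i rfl hi
    have hin := hne hi
    have hib : a i ≠ ⊥ := by
      rw [hin]
      exact WithBot.coe_ne_bot
    have hi0 : i ≠ 0 := by
      rintro rfl
      exact hi T.lt
    rw [hxi]
    refine add_mem (Submodule.smul_mem _ _ hyN) (Submodule.sum_mem _ fun k _ => ?_)
    by_cases hk : a k < n
    · exact Submodule.smul_mem _ _ (step1 k k rfl hk)
    have hkn := hne hk
    have hkb : a k ≠ ⊥ := by
      rw [hkn]
      exact WithBot.coe_ne_bot
    rcases lt_trichotomy k i with hki | rfl | hki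
    · exact absurd (hkn.trans hin.symm) (T.order i k hki hib (Or.inl hkb)).1.ne
    · exact hN _ (hdiag k hi0 hib)
    · exact absurd (hin.trans hkn.symm) (T.order k i hki hkb (Or.inl hib)).1.ne
  refine h.eq_zero_of_range_le T hφ fun z => ?_
  obtain ⟨g, c', rfl⟩ := h.gen z
  rw [map_add, map_smul, map_sum]
  refine add_mem (Submodule.smul_mem _ _ hyN) (Submodule.sum_mem _ fun k _ => ?_)
  rw [map_smul]
  exact Submodule.smul_mem _ _ (hxN k)

theorem mem_or_sub_mem (h : Presents p n a e y x) (T : Tight p n a e)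
    {φ : V →ₗ[ℤ[X]] V} (hφ : ∀ z, φ (φ z) = φ z) {f : ℤ[X]} {c : Fin (M + 1) → ℤ[X]}
    (hy : φ y = f • y + ∑ k, c k • x k) : f ∈ augIdeal p 1 ∨ 1 - f ∈ augIdeal p 1 := by
  obtain ⟨u, C, L⟩ := h.exists_lift φ f c hy
  have h1 := hφ y
  rw [hy, map_add, map_smul, map_sum, hy, ← sub_eq_zero] at h1
  simp only [map_smul, L.map_x] at h1
  have h2 : (f * f + ∑ k, c k * u k - f) • y
      + ∑ l, (f * c l + ∑ k, c k * C k l - c l) • x l = 0 := by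
    rw [← h1]
    simp only [sub_smul, add_smul, Finset.sum_smul, Finset.sum_sub_distrib,
      Finset.sum_add_distrib, smul_add, Finset.smul_sum, mul_smul]
    rw [Finset.sum_comm (f := fun l k => c k • C k l • x l)]
    abel
  obtain ⟨s, t, c₀, -, -, h3, -⟩ := (h.rel _ _).1 h2
  have h4 : f * f + ∑ k, c k * u k - f ∈ augIdeal p 1 := by
    rw [h3, pow_succ', mul_assoc]
    refine add_mem (add_mem (Ideal.mul_mem_left _ _ (X_sub_mem_augIdeal p e)) ?_)
      (p_mul_mem_augIdeal _ _ _)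
    exact augIdeal_mono (pow_pos T.prime.pos n) (lv_mul_mem_augIdeal T.prime n t)
  have h5 : ∑ k, c k * u k ∈ augIdeal p 1 := by
    refine Ideal.sum_mem _ fun k _ => ?_
    by_cases hk : a k < n
    · refine Ideal.mul_mem_left _ _ ?_
      rcases eq_or_ne k 0 with rfl | hk0
      · exact L.u_zero_mem
      · exact L.u_mem h T hk0 hk
    · exact Ideal.mul_mem_right _ _ (L.c_mem h T (le_antisymm (T.le k) (not_lt.1 hk)))
  have h6 : f * (1 - f) ∈ augIdeal p 1 := by
    have := sub_mem h5 h4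
    ring_nf at this ⊢
    exact this
  rw [mem_augIdeal_one, eval_mul] at h6
  rw [mem_augIdeal_one, mem_augIdeal_one]
  exact (Nat.prime_iff_prime_int.1 T.prime).dvd_or_dvd h6

/-- A module presented by the relations of `X_{a,d,m}` has only trivial idempotents. -/
theorem idempotent_eq (h : Presents p n a e y x) (T : Tight p n a e)
    {φ : V →ₗ[ℤ[X]] V} (hφ : ∀ z, φ (φ z) = φ z) : φ = 0 ∨ φ = LinearMap.id := by
  obtain ⟨f, c, hy⟩ := h.gen (φ y)
  rcases h.mem_or_sub_mem T hφ hy with hf | hf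
  · exact Or.inl (h.eq_zero_of_mem T hφ hy hf)
  · right
    have := h.eq_zero_of_mem T (φ := LinearMap.id - φ) (f := 1 - f) (c := fun k => - c k)
      (fun z => by simp [hφ]) (by
        simp only [LinearMap.sub_apply, LinearMap.id_apply, hy, neg_smul, sub_smul, one_smul,
          Finset.sum_neg_distrib]
        abel) hf
    exact (sub_eq_zero.1 this).symm

theorem y_ne_zero (h : Presents p n a e y x) (T : Tight p n a e) : y ≠ 0 := by
  intro h0
  obtain ⟨s, t, c₀, -, -, h3, -⟩ := (h.rel 1 0).1 (by simp [h0])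
  have : (1 : ℤ[X]) ∈ augIdeal p 1 := by
    rw [h3, pow_succ', mul_assoc]
    refine add_mem (add_mem (Ideal.mul_mem_left _ _ (X_sub_mem_augIdeal p e)) ?_)
      (p_mul_mem_augIdeal _ _ _)
    exact augIdeal_mono (pow_pos T.prime.pos n) (lv_mul_mem_augIdeal T.prime n t)
  rw [mem_augIdeal_one, eval_one] at this
  exact T.prime.one_lt.ne' (Nat.dvd_one.1 (by exact_mod_cast this))

end Presents

/-- The module `X_{a,d,m}` of a tight norm pair is indecomposable. -/
theorem Tight.isIndecomposable (T : Tight p n a e) :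
    MSS.IsIndecomposable (MSS.CycGR p (M + 1) n) (MSS.Xadm p n (M + 1) a (1 + p * e)) := by
  classical
  let : Module ℤ[X] (MSS.Xadm p n (M + 1) a (1 + p * e)) := Module.compHom _ (ev p (M + 1) n)
  have hsm : ∀ (f : ℤ[X]) (z : MSS.Xadm p n (M + 1) a (1 + p * e)), f • z = ev p (M + 1) n f • z :=
    fun _ _ => rfl
  let q := Submodule.mkQ (Submodule.span (MSS.CycGR p (M + 1) n)
    (MSS.XRels p n (M + 1) a (1 + p * e)))
  let b : Fin (M + 2) → MSS.Xadm p n (M + 1) a (1 + p * e) := fun k => q (Pi.single k 1)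
  have hq : ∀ v : Fin (M + 2) → ℤ[X], v 0 • b 0 + ∑ k : Fin (M + 1), v k.succ • b k.succ
      = q fun k => ev p (M + 1) n (v k) := by
    intro v
    have h1 := LinearMap.pi_apply_eq_sum_univ q fun k => ev p (M + 1) n (v k)
    have h2 : ∀ i : Fin (M + 2), (fun j => if i = j then (1 : MSS.CycGR p (M + 1) n) else 0)
        = Pi.single i 1 := fun i => by
      ext1 j
      simp only [Pi.single_apply, eq_comm]
    rw [h1, Fin.sum_univ_succ (n := M + 1)]
    simp only [h2]
    rfl
  have hP : Presents p n a e (b 0) (fun k : Fin (M + 1) => b k.succ) := by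
    constructor
    · intro z
      obtain ⟨v, rfl⟩ := Submodule.mkQ_surjective _ z
      choose w hw using fun k => ev_surjective T.prime.pos (M + 1) n (v k)
      refine ⟨w 0, fun k => w k.succ, ?_⟩
      rw [hq w]
      simp only [hw]
      rfl
    · intro f g
      have h1 := hq (Fin.cons f g)
      simp only [Fin.cons_zero, Fin.cons_succ] at h1
      rw [h1]
      have h2 := mem_span_XRels_iff (d := 1 + p * e) T.prime.pos T.le (u := Fin.cons f g)
      simp only [Fin.cons_zero, Fin.cons_succ] at h2
      have hd : (((1 + p * e : ℤ)) : ℤ[X]) = 1 + (p : ℤ[X]) * (e : ℤ[X]) := by push_cast; rfl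
      rw [hd] at h2
      rw [← h2]
      exact Submodule.Quotient.mk_eq_zero _
  refine ⟨fun h0 => hP.y_ne_zero T ?_, fun S S' h1 h2 => ?_⟩
  · have : b 0 ∈ (⊤ : Submodule (MSS.CycGR p (M + 1) n) _) := trivial
    rw [h0] at this
    exact this
  · have hc : IsCompl S S' := ⟨disjoint_iff.2 h1, codisjoint_iff.2 h2⟩
    let φ : MSS.Xadm p n (M + 1) a (1 + p * e) →ₗ[ℤ[X]] MSS.Xadm p n (M + 1) a (1 + p * e) :=
      { toFun := fun z => S.projectionOnto S' hc z
        map_add' := fun z z' => by rw [map_add]; rfl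
        map_smul' := fun f z => by rw [hsm, map_smul]; rfl }
    have hφ : ∀ z, φ (φ z) = φ z := fun z => by
      change ((S.projectionOnto S' hc _ : S) : MSS.Xadm p n (M + 1) a (1 + p * e)) = _
      exact congrArg _ (Submodule.projectionOnto_apply_left hc (S.projectionOnto S' hc z))
    rcases hP.idempotent_eq T hφ with h | h
    · left
      rw [Submodule.eq_bot_iff]
      intro z hz
      have h3 : φ z = z :=
        congrArg Subtype.val (Submodule.projectionOnto_apply_left hc ⟨z, hz⟩)
      rw [← h3, h]
      rfl
    · right
      rw [Submodule.eq_bot_iff]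
      intro z hz
      have h3 : φ z = 0 :=
        congrArg Subtype.val ((Submodule.projectionOnto_apply_eq_zero_iff hc).2 hz)
      rw [h] at h3
      exact h3

end

theorem Pres.tight {A : Type v} [AddCommGroup A] [Module ℤ[X] A] {p n : ℕ} {ξ : A} {M : ℕ}
    {a : Fin (M + 1) → WithBot ℕ} {e : ℤ} {α : A} {g : ℕ → A} {Γ : Type w}
    {lvl : Γ → WithBot ℕ} {gv : Γ → A} {y : Γ} {x : Fin (M + 1) → Γ}
    (h : Pres p n ξ a e α g lvl gv y x) : Tight p n a e :=
  ⟨h.data.prime, h.data.pos, h.good.le, h.good.core.lt, h.good.core.special, h.good.order⟩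

theorem card_olev_of_ne {n M : ℕ} (a : Fin M → WithBot ℕ) {i : WithBot ℕ}
    (hi : (n : WithBot ℕ) ≠ i) :
    Nat.card {o : Option (Fin M) // olev n a o = i} = Nat.card {j : Fin M // a j = i} := by
  refine (Nat.card_congr (Equiv.ofBijective
    (fun j : {j : Fin M // a j = i} =>
      (⟨some j.1, j.2⟩ : {o : Option (Fin M) // olev n a o = i})) ⟨fun j k h => ?_, ?_⟩)).symm
  · exact Subtype.ext (Option.some_injective _ (Subtype.ext_iff.1 h))
  · rintro ⟨_ | j, h⟩
    · exact absurd h hi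
    · exact ⟨⟨j, h⟩, rfl⟩

theorem card_olev_self (n : ℕ) {M : ℕ} (a : Fin M → WithBot ℕ) :
    Nat.card {o : Option (Fin M) // olev n a o = (n : WithBot ℕ)}
      = Nat.card {j : Fin M // a j = (n : WithBot ℕ)} + 1 := by
  rw [← Finite.card_option]
  refine (Nat.card_congr (Equiv.ofBijective
    (fun o : Option {j : Fin M // a j = (n : WithBot ℕ)} =>
      (o.elim ⟨none, rfl⟩ fun j => ⟨some j.1, j.2⟩ :
        {o : Option (Fin M) // olev n a o = (n : WithBot ℕ)})) ⟨?_, ?_⟩)).symm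
  · rintro (_ | j) (_ | k) h
    · rfl
    · exact absurd (Subtype.ext_iff.1 h) (Option.some_ne_none _).symm
    · exact absurd (Subtype.ext_iff.1 h) (Option.some_ne_none _)
    · exact congrArg some (Subtype.ext (Option.some_injective _ (Subtype.ext_iff.1 h)))
  · rintro ⟨_ | j, h⟩
    · exact ⟨none, rfl⟩
    · exact ⟨some ⟨j, h⟩, rfl⟩

theorem CycData.exists_decomposition {A : Type v} [AddCommGroup A] [Module ℤ[X] A] {p n : ℕ}
    {ξ : A} (h : CycData A p n ξ) (M : ℕ) (Q : Fin (n + 1) → Type v)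
    [∀ i, CommGroup (Q i)] (ψ : ∀ i : Fin (n + 1), levelSub A p i →+ Additive (Q i))
    (hψ : ∀ i, Function.Surjective (ψ i))
    (hker : ∀ (i : Fin (n + 1)) γ, ψ i γ = 0 ↔ nm p 0 i • (γ : A) ∈ normStep A p n (i + 1))
    {J : Type v} [AddCommGroup J] (π : A →+ J) (hπ : Function.Surjective π)
    (hπ0 : ∀ x, π x = 0 ↔ ∃ w, x = (p : ℤ[X]) ^ (M + 1) • w) :
    ∃ (a : Fin (M + 1) → WithBot ℕ) (d : ℤ) (ι : Fin (n + 1) → Type v),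
      (∀ i, a i ≤ (n : WithBot ℕ)) ∧
      (p : ℤ) ∣ d - 1 ∧
      MSS.IsIndecomposable (MSS.CycGR p (M + 1) n) (MSS.Xadm p n (M + 1) a d) ∧
      (∀ i : Fin (n + 1), (i : ℕ) < n →
        Cardinal.mk (ι i) +
          (Nat.card {j : Fin (M + 1) // a j = ((i : ℕ) : WithBot ℕ)} : Cardinal)
          = MSS.fpdim p (Q i)) ∧
      (Cardinal.mk (ι (Fin.last n)) + 1 +
          (Nat.card {j : Fin (M + 1) // a j = (n : WithBot ℕ)} : Cardinal)
          = MSS.fpdim p (Q (Fin.last n))) ∧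
      ∃ E : J ≃+ (MSS.Xadm p n (M + 1) a d ×
          ((i : Fin (n + 1)) → (ι i →₀ MSS.CycGR p (M + 1) (i : ℕ)))),
        ∀ x, E (π ((X : ℤ[X]) • x)) = (MSS.gen p (M + 1) n • (E (π x)).1,
          fun i : Fin (n + 1) => MSS.gen p (M + 1) (i : ℕ) • (E (π x)).2 i) := by
  obtain ⟨a, e, α, g, ι, γ, hP, hc⟩ := exists_pres h M Q ψ hψ hker
  obtain ⟨E, hE⟩ := hP.exists_iso π hπ hπ0
  refine ⟨a, 1 + p * e, ι, hP.good.le, ⟨e, by ring⟩, hP.tight.isIndecomposable, fun i hi => ?_,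
    ?_, E, hE⟩
  · rw [← hc i]
    exact congrArg (fun k : ℕ => Cardinal.mk (ι i) + (k : Cardinal))
      (card_olev_of_ne a fun h => hi.ne' (WithBot.coe_injective h)).symm
  · rw [← hc (Fin.last n), add_assoc, add_comm (1 : Cardinal)]
    refine (congrArg (fun k : Cardinal => Cardinal.mk (ι (Fin.last n)) + k) ?_)
    rw [← Nat.cast_one (R := Cardinal), ← Nat.cast_add]
    exact congrArg _ (card_olev_self n a).symm

section

section Units

variable {F : Type u} {K : Type v} [Field F] [Field K] [Algebra F K]

@[simp] theorem umap_one (x : Kˣ) : MSS.umap (1 : K ≃ₐ[F] K) x = x := Units.ext rfl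

theorem umap_mul (σ τ : K ≃ₐ[F] K) (x : Kˣ) :
    MSS.umap (σ * τ) x = MSS.umap σ (MSS.umap τ x) := Units.ext rfl

@[simp] theorem coe_umap (σ : K ≃ₐ[F] K) (x : Kˣ) : (MSS.umap σ x : K) = σ x := rfl

/-- Hilbert's Theorem 90 for the cyclic group generated by `τ`. -/
theorem exists_umap_div_eq (τ : K ≃ₐ[F] K) (hτ : 0 < orderOf τ) (x : Kˣ)
    (hx : ∏ l ∈ Finset.range (orderOf τ), MSS.umap (τ ^ l) x = 1) :
    ∃ w : Kˣ, x = MSS.umap τ w / w := by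
  let c : ℕ → Kˣ := fun l => ∏ k ∈ Finset.range l, MSS.umap (τ ^ k) x
  have hc : ∀ l, x * MSS.umap τ (c l) = c (l + 1) := fun l => by
    simp only [c, map_prod, ← umap_mul, ← pow_succ']
    rw [Finset.prod_range_succ' _ l, pow_zero, umap_one, mul_comm]
  have hinj : Set.InjOn (fun l : ℕ => ((τ ^ l : K ≃ₐ[F] K) : K →* K))
      (Finset.range (orderOf τ)) := fun k hk l hl h => by
    refine pow_injOn_Iio_orderOf (x := τ) (by simpa using hk) (by simpa using hl) ?_
    exact AlgEquiv.ext fun z => DFunLike.congr_fun h z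
  have hlin := linearIndependent_monoidHom K K
  have hli : LinearIndependent K (fun (l : Finset.range (orderOf τ)) =>
      (((τ ^ (l : ℕ) : K ≃ₐ[F] K) : K →* K) : K → K)) :=
    hlin.comp (fun l : Finset.range (orderOf τ) => ((τ ^ (l : ℕ) : K ≃ₐ[F] K) : K →* K))
      fun k l h => Subtype.ext (hinj k.2 l.2 h)
  obtain ⟨z, hz⟩ : ∃ z : K, ∑ l ∈ Finset.range (orderOf τ), (c l : K) * (τ ^ l) z ≠ 0 := by
    by_contra! h
    have h1 := (Fintype.linearIndependent_iff.1 hli) (fun l => (c l : K)) (by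
      ext z
      rw [Finset.sum_apply, Pi.zero_apply, ← h z,
        ← Finset.sum_coe_sort (Finset.range (orderOf τ)) fun l => (c l : K) * (τ ^ l) z]
      rfl) ⟨0, Finset.mem_range.2 hτ⟩
    exact (c 0).ne_zero h1
  set b := ∑ l ∈ Finset.range (orderOf τ), (c l : K) * (τ ^ l) z with hb
  have key : (x : K) * τ b = b := by
    have h1 : (x : K) * τ b
        = ∑ l ∈ Finset.range (orderOf τ), (c (l + 1) : K) * (τ ^ (l + 1)) z := by
      rw [hb, map_sum, Finset.mul_sum]
      refine Finset.sum_congr rfl fun l _ => ?_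
      rw [map_mul, ← mul_assoc, ← hc l, Units.val_mul, coe_umap, pow_succ', AlgEquiv.mul_apply]
    have h2 := Finset.sum_range_succ' (fun l => (c l : K) * (τ ^ l) z) (orderOf τ)
    rw [Finset.sum_range_succ] at h2
    have h3 : c (orderOf τ) = c 0 := by simpa [c] using hx
    rw [h3, pow_orderOf_eq_one, pow_zero] at h2
    rw [h1, hb]
    exact (add_right_cancel h2).symm
  refine ⟨(Units.mk0 b hz)⁻¹, Units.ext ?_⟩
  rw [map_inv, inv_div_inv, Units.val_div_eq_div_val, coe_umap, Units.val_mk0,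
    eq_div_iff ((map_ne_zero τ).2 hz), key]

end Units

end

section

section UnitModule

variable {F : Type u} {K : Type v} [Field F] [Field K] [Algebra F K]

/-- The unit group of `K`, written additively, as a `ℤ[X]`-module with `X` acting as `σ`. -/
def UnitModule (_σ : K ≃ₐ[F] K) : Type v := Additive Kˣ

variable (σ : K ≃ₐ[F] K)

instance : AddCommGroup (UnitModule σ) := inferInstanceAs (AddCommGroup (Additive Kˣ))

/-- The automorphism `σ` as an endomorphism of the additive group `UnitModule σ`. -/
def UnitModule.endo : Module.End ℤ (UnitModule σ) := (MSS.umap σ).toAdditive.toIntLinearMap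

noncomputable instance : Module ℤ[X] (UnitModule σ) :=
  Module.compHom _ (aeval (UnitModule.endo σ)).toRingHom

/-- A unit of `K` as an element of `UnitModule σ`. -/
def tu (x : Kˣ) : UnitModule σ := Additive.ofMul x

theorem tu_surjective : Function.Surjective (tu σ) := fun x => ⟨x.toMul, rfl⟩

theorem tu_injective : Function.Injective (tu σ) := fun _ _ h => h

@[simp] theorem tu_inj {x y : Kˣ} : tu σ x = tu σ y ↔ x = y := (tu_injective σ).eq_iff

theorem tu_one : tu σ 1 = 0 := rfl

theorem tu_mul (x y : Kˣ) : tu σ (x * y) = tu σ x + tu σ y := rfl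

theorem tu_div (x y : Kˣ) : tu σ (x / y) = tu σ x - tu σ y := rfl

theorem tu_prod {κ : Type*} (s : Finset κ) (f : κ → Kˣ) :
    tu σ (∏ l ∈ s, f l) = ∑ l ∈ s, tu σ (f l) := rfl

theorem tu_eq_zero {x : Kˣ} : tu σ x = 0 ↔ x = 1 := tu_inj σ

theorem X_smul_tu (x : Kˣ) : (X : ℤ[X]) • tu σ x = tu σ (MSS.umap σ x) := by
  change aeval (UnitModule.endo σ) X (tu σ x) = _
  rw [aeval_X]
  rfl

theorem X_pow_smul_tu (k : ℕ) (x : Kˣ) :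
    (X ^ k : ℤ[X]) • tu σ x = tu σ (MSS.umap (σ ^ k) x) := by
  induction k with
  | zero => simp
  | succ k ih => rw [pow_succ', mul_smul, ih, X_smul_tu, ← umap_mul, ← pow_succ']

theorem natCast_smul_tu (k : ℕ) (x : Kˣ) : (k : ℤ[X]) • tu σ x = tu σ (x ^ k) := by
  rw [Nat.cast_smul_eq_nsmul]
  rfl

theorem X_sub_one_smul_tu {x : Kˣ} : (X - 1 : ℤ[X]) • tu σ x = 0 ↔ MSS.umap σ x = x := by
  rw [sub_smul, one_smul, X_smul_tu, sub_eq_zero, tu_inj]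

theorem lv_smul_tu (p i : ℕ) (x : Kˣ) :
    lv p i • tu σ x = tu σ (MSS.umap (σ ^ p ^ i) x / x) := by
  rw [lv, sub_smul, one_smul, X_pow_smul_tu, tu_div]

theorem lv_smul_tu_eq_zero {p i : ℕ} {x : Kˣ} : lv p i • tu σ x = 0 ↔ x ∈ MSS.KiU p σ i := by
  rw [lv_smul_tu, tu_eq_zero]
  rfl

theorem nm_smul_tu (p i k : ℕ) (x : Kˣ) :
    nm p i k • tu σ x = tu σ (∏ l ∈ Finset.range (p ^ k), MSS.umap ((σ ^ p ^ i) ^ l) x) := by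
  rw [nm, Finset.sum_smul, tu_prod]
  simp_rw [← pow_mul, X_pow_smul_tu]

theorem nm_zero_smul_tu (p i : ℕ) (x : Kˣ) :
    nm p 0 i • tu σ x = tu σ (MSS.normHom p σ i x) := by
  rw [nm_smul_tu, MSS.normHom, MonoidHom.finsetProd_apply]
  simp

theorem umap_eq_self_iff [IsGalois F K] [FiniteDimensional F K]
    (hgen : ∀ τ : K ≃ₐ[F] K, τ ∈ Subgroup.zpowers σ) {x : Kˣ} :
    MSS.umap σ x = x ↔ x ∈ MSS.Funits F := by
  constructor
  · intro h
    have h1 : σ ∈ MulAction.stabilizer (K ≃ₐ[F] K) (x : K) := congrArg Units.val h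
    have h2 : (x : K) ∈ Set.range (algebraMap F K) :=
      (IsGalois.mem_range_algebraMap_iff_fixed _).2 fun τ =>
        (Subgroup.zpowers_le.2 h1) (hgen τ)
    obtain ⟨f, hf⟩ := h2
    have hf0 : f ≠ 0 := fun h0 => x.ne_zero (by rw [← hf, h0, map_zero])
    exact ⟨Units.mk0 f hf0, Units.ext hf⟩
  · rintro ⟨f, rfl⟩
    exact Units.ext (σ.commutes f)

theorem cycData_unitModule [IsGalois F K] [FiniteDimensional F K] {p n : ℕ} (hp : p.Prime)
    (hn : 0 < n) (horder : orderOf σ = p ^ n)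
    (ξ : Kˣ) (hξ : IsPrimitiveRoot (ξ : K) p)
    (hξF : (ξ : K) ∈ Set.range (algebraMap F K))
    (hspecial : p = 2 → n = 1 → ∃ γ : Kˣ, MSS.normHom p σ n γ = -1) :
    CycData (UnitModule σ) p n (tu σ ξ) := by
  have hp0 := hp.pos
  have hξ' : IsPrimitiveRoot ξ p := IsPrimitiveRoot.coe_units_iff.1 hξ
  have h1 : σ ^ p ^ n = 1 := by rw [← horder, pow_orderOf_eq_one]
  have : NeZero p := ⟨hp.ne_zero⟩
  refine ⟨hp, hn, fun x => ?_, fun s hs x hx hN => ?_, fun x hx => ?_, ?_, ?_, ?_, ?_⟩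
  · obtain ⟨x, rfl⟩ := tu_surjective σ x
    rw [lv_smul_tu, h1, umap_one, div_self', tu_one]
  · obtain ⟨x, rfl⟩ := tu_surjective σ x
    have hord : orderOf (σ ^ p ^ s) = p ^ (n - s) := by
      rw [orderOf_pow_of_dvd (pow_ne_zero _ hp.ne_zero) (by rw [horder]; exact pow_dvd_pow p hs.le),
        horder, Nat.pow_div hs.le hp0]
    have hN' : nm p s (n - s) • tu σ x = 0 := by
      rw [show n - s = 1 + (n - s - 1) by omega, ← nm_mul_nm hp0, mul_comm, mul_smul, hN, smul_zero]
    rw [nm_smul_tu, tu_eq_zero, ← hord] at hN'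
    obtain ⟨w, hw⟩ := exists_umap_div_eq (σ ^ p ^ s) (by rw [hord]; exact pow_pos hp0 _) x hN'
    have hxw : tu σ x = lv p s • tu σ w := by rw [lv_smul_tu, ← hw]
    refine ⟨tu σ w, ?_, hxw⟩
    rw [← lv_mul_nm, mul_comm, mul_smul, ← hxw, hN]
  · obtain ⟨x, rfl⟩ := tu_surjective σ x
    rw [natCast_smul_tu, tu_eq_zero] at hx
    obtain ⟨c, -, hc⟩ := hξ.eq_pow_of_pow_eq_one (ξ := (x : K))
      (by rw [← Units.val_pow_eq_pow_val, hx, Units.val_one])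
    refine ⟨c, ?_⟩
    rw [Int.cast_natCast, natCast_smul_tu, tu_inj]
    exact Units.ext (by rw [Units.val_pow_eq_pow_val, hc])
  · obtain ⟨f, hf⟩ := hξF
    rw [X_sub_one_smul_tu]
    exact Units.ext (by rw [coe_umap, ← hf, σ.commutes])
  · rw [natCast_smul_tu, hξ'.pow_eq_one, tu_one]
  · rw [Ne, tu_eq_zero]
    exact hξ'.ne_one hp.one_lt
  · intro h2 hn1
    obtain ⟨γ, hγ⟩ := hspecial h2 hn1
    refine ⟨tu σ γ, ?_⟩
    rw [nm_zero_smul_tu, hγ, tu_inj]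
    subst h2
    exact Units.ext (by rw [hξ.eq_neg_one_of_two_right]; rfl)

/-- The subgroup of `NiF p σ i` by which one divides to compute `eKF p n σ i`. -/
noncomputable def nextSub (F : Type u) {K : Type v} [Field F] [Field K] [Algebra F K] (p n : ℕ)
    (σ : K ≃ₐ[F] K) (i : ℕ) : Subgroup Kˣ :=
  if i < n then MSS.NiF p σ (i + 1) else MSS.FpPow F p

theorem eKF_eq {p n i : ℕ} (hi : i ≤ n) : MSS.eKF p n σ i
    = MSS.fpdim p (MSS.NiF p σ i ⧸ (nextSub F p n σ i).subgroupOf (MSS.NiF p σ i)) := by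
  by_cases h : i < n
  · rw [MSS.eKF, if_pos h, nextSub, if_pos h]
  · obtain rfl : i = n := by omega
    rw [MSS.eKF, if_neg h, nextSub, if_neg h]

theorem FpPow_le_nextSub (p n i : ℕ) : MSS.FpPow F p ≤ nextSub F p n σ i := by
  rw [nextSub]
  split_ifs
  · exact le_sup_right
  · exact le_rfl

variable [IsGalois F K] [FiniteDimensional F K]

theorem mem_FpPow_iff {p n : ℕ} (hgen : ∀ τ : K ≃ₐ[F] K, τ ∈ Subgroup.zpowers σ) {x : Kˣ} :
    x ∈ MSS.FpPow F p ↔ tu σ x ∈ normStep (UnitModule σ) p n (n + 1) := by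
  rw [mem_normStep_top]
  constructor
  · rintro ⟨f, hf, rfl⟩
    exact ⟨tu σ f, (X_sub_one_smul_tu σ).2 ((umap_eq_self_iff σ hgen).2 hf),
      (natCast_smul_tu σ p f).symm⟩
  · rintro ⟨g, h1, h2⟩
    obtain ⟨g, rfl⟩ := tu_surjective σ g
    rw [natCast_smul_tu, tu_inj] at h2
    exact ⟨g, (umap_eq_self_iff σ hgen).1 ((X_sub_one_smul_tu σ).1 h1), h2.symm⟩

theorem mem_NiF_iff {p n i : ℕ} (hi : i ≤ n)
    (hgen : ∀ τ : K ≃ₐ[F] K, τ ∈ Subgroup.zpowers σ) {x : Kˣ} :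
    x ∈ MSS.NiF p σ i ↔ tu σ x ∈ normStep (UnitModule σ) p n i := by
  rw [mem_normStep, MSS.NiF, Subgroup.mem_sup]
  constructor
  · rintro ⟨_, ⟨γ, hγ, rfl⟩, y, hy, rfl⟩
    obtain ⟨g, h1, h2⟩ := mem_normStep_top.1 ((mem_FpPow_iff (n := n) σ hgen).1 hy)
    exact ⟨tu σ γ, g, (lv_smul_tu_eq_zero σ).2 hγ, fun h => absurd hi h.not_ge, h1,
      by rw [tu_mul, h2, nm_zero_smul_tu]⟩
  · rintro ⟨γ, g, h1, -, h2, h3⟩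
    obtain ⟨γ, rfl⟩ := tu_surjective σ γ
    obtain ⟨g, rfl⟩ := tu_surjective σ g
    rw [nm_zero_smul_tu, natCast_smul_tu, ← tu_mul, tu_inj] at h3
    exact ⟨_, ⟨γ, (lv_smul_tu_eq_zero σ).1 h1, rfl⟩, _,
      ⟨g, (umap_eq_self_iff σ hgen).1 ((X_sub_one_smul_tu σ).1 h2), rfl⟩, h3.symm⟩

theorem mem_nextSub_iff {p n i : ℕ} (hi : i ≤ n)
    (hgen : ∀ τ : K ≃ₐ[F] K, τ ∈ Subgroup.zpowers σ) {x : Kˣ} :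
    x ∈ nextSub F p n σ i ↔ tu σ x ∈ normStep (UnitModule σ) p n (i + 1) := by
  by_cases h : i < n
  · rw [nextSub, if_pos h, mem_NiF_iff σ h hgen]
  · obtain rfl : i = n := by omega
    rw [nextSub, if_neg h, mem_FpPow_iff σ hgen]

end UnitModule

section NormClass

variable {F : Type u} {K : Type v} [Field F] [Field K] [Algebra F K] (σ : K ≃ₐ[F] K)

/-- The norm of an element of level `i`, as an element of `NiF p σ i`. -/
noncomputable def levelNorm (p i : ℕ) :
    levelSub (UnitModule σ) p i →+ Additive (MSS.NiF p σ i) where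
  toFun γ := Additive.ofMul ⟨MSS.normHom p σ i (Additive.toMul (α := Kˣ) γ.1),
    Subgroup.mem_sup_left ⟨_, (lv_smul_tu_eq_zero σ).1 γ.2, rfl⟩⟩
  map_zero' := Subtype.ext (map_one (MSS.normHom p σ i))
  map_add' _ _ := Subtype.ext (map_mul (MSS.normHom p σ i) _ _)

/-- The class of the norm of an element of level `i`. -/
noncomputable def normClass (p n i : ℕ) : levelSub (UnitModule σ) p i →+
    Additive (MSS.NiF p σ i ⧸ (nextSub F p n σ i).subgroupOf (MSS.NiF p σ i)) :=
  (QuotientGroup.mk' ((nextSub F p n σ i).subgroupOf (MSS.NiF p σ i))).toAdditive.comp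
    (levelNorm σ p i)

theorem normClass_surjective (p n i : ℕ) : Function.Surjective (normClass σ p n i) := by
  intro z
  obtain ⟨⟨x, hx⟩, hz⟩ := QuotientGroup.mk'_surjective
    ((nextSub F p n σ i).subgroupOf (MSS.NiF p σ i)) z.toMul
  obtain ⟨_, ⟨γ, hγ, rfl⟩, y, hy, rfl⟩ := Subgroup.mem_sup.1 hx
  refine ⟨⟨tu σ γ, (lv_smul_tu_eq_zero σ).2 hγ⟩, Eq.trans (QuotientGroup.eq.2 ?_) hz⟩
  have h : (MSS.normHom p σ i γ)⁻¹ * (MSS.normHom p σ i γ * y) ∈ nextSub F p n σ i := by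
    rw [inv_mul_cancel_left]
    exact FpPow_le_nextSub σ p n i hy
  exact h

theorem normClass_eq_zero_iff [IsGalois F K] [FiniteDimensional F K] {p n i : ℕ} (hi : i ≤ n)
    (hgen : ∀ τ : K ≃ₐ[F] K, τ ∈ Subgroup.zpowers σ) (γ : levelSub (UnitModule σ) p i) :
    normClass σ p n i γ = 0 ↔
      nm p 0 i • (γ : UnitModule σ) ∈ normStep (UnitModule σ) p n (i + 1) := by
  obtain ⟨γ, hγ⟩ := γ
  obtain ⟨γ, rfl⟩ := tu_surjective σ γ
  rw [nm_zero_smul_tu, ← mem_nextSub_iff σ hi hgen]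
  exact (QuotientGroup.eq_one_iff
    (N := (nextSub F p n σ i).subgroupOf (MSS.NiF p σ i)) _).trans Subgroup.mem_subgroupOf

/-- The projection to the units modulo `q`-th powers. -/
def powClass (q : ℕ) : UnitModule σ →+ Additive (Kˣ ⧸ MSS.powSub K q) :=
  let f : Additive Kˣ →+ Additive (Kˣ ⧸ MSS.powSub K q) :=
    (QuotientGroup.mk' (MSS.powSub K q)).toAdditive
  f

theorem powClass_surjective (q : ℕ) : Function.Surjective (powClass σ q) :=
  QuotientGroup.mk'_surjective (MSS.powSub K q)

theorem powClass_eq_zero_iff {p M : ℕ} (x : UnitModule σ) :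
    powClass σ (p ^ M) x = 0 ↔ ∃ w, x = (p : ℤ[X]) ^ M • w := by
  obtain ⟨x, rfl⟩ := tu_surjective σ x
  refine (QuotientGroup.eq_one_iff (N := MSS.powSub K (p ^ M)) x).trans ⟨?_, ?_⟩
  · rintro ⟨w, rfl⟩
    refine ⟨tu σ w, ?_⟩
    rw [← Nat.cast_pow, natCast_smul_tu]
    rfl
  · rintro ⟨w, h⟩
    obtain ⟨w, rfl⟩ := tu_surjective σ w
    rw [← Nat.cast_pow, natCast_smul_tu, tu_inj] at h
    exact ⟨w, h.symm⟩

end NormClass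

end

end CyclicPower

/-- **Theorem 1 (Main theorem).**  Let `m ≥ 1`, suppose `ξ_p ∈ F`, and if `p = 2`
and `n = 1` suppose `-1 ∈ N_{K/F}(K^×)`.  Then
`J_m ≅ X_{a,d,m} ⊕ ⨁_{i=0}^n Y_i` as `R_m[G]`-modules, where `X_{a,d,m}` is
indecomposable, each `Y_i` is a free `R_m[G_i]`-module of rank `e(i,m)`, and
`e(i,m) + |{j : a_j = i}| = e_i(K/F)` for `i < n`, while
`e(n,m) + 1 + |{j : a_j = n}| = e_n(K/F)`. -/
theorem statement_0 {F : Type u} {K : Type v} [Field F] [Field K] [Algebra F K]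
    [IsGalois F K] [FiniteDimensional F K]
    (p n m : ℕ) (hp : p.Prime) (hn : 0 < n) (hm : 0 < m)
    (σ : K ≃ₐ[F] K) (horder : orderOf σ = p ^ n)
    (hgen : ∀ τ : K ≃ₐ[F] K, τ ∈ Subgroup.zpowers σ)
    (ξ : Kˣ) (hξ : IsPrimitiveRoot (ξ : K) p)
    (hξF : (ξ : K) ∈ Set.range (algebraMap F K))
    (hspecial : p = 2 → n = 1 → ∃ γ : Kˣ, MSS.normHom p σ n γ = -1) :
    ∃ (a : Fin m → WithBot ℕ) (d : ℤ) (ι : Fin (n + 1) → Type v),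
      (∀ i, a i ≤ (n : WithBot ℕ)) ∧
      (p : ℤ) ∣ d - 1 ∧
      MSS.IsIndecomposable (MSS.CycGR p m n) (MSS.Xadm p n m a d) ∧
      (∀ i : Fin (n + 1), (i : ℕ) < n →
        Cardinal.mk (ι i) + (Nat.card {j : Fin m // a j = ((i : ℕ) : WithBot ℕ)} : Cardinal)
          = MSS.eKF p n σ (i : ℕ)) ∧
      (Cardinal.mk (ι (Fin.last n)) + 1 +
          (Nat.card {j : Fin m // a j = (n : WithBot ℕ)} : Cardinal)
          = MSS.eKF p n σ n) ∧
      ∃ e : Additive (Kˣ ⧸ MSS.powSub K (p ^ m)) ≃+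
            (MSS.Xadm p n m a d × ((i : Fin (n + 1)) → (ι i →₀ MSS.CycGR p m (i : ℕ)))),
        ∀ x : Kˣ ⧸ MSS.powSub K (p ^ m),
          e (Additive.ofMul (MSS.jmap (p ^ m) σ x)) =
            (MSS.gen p m n • (e (Additive.ofMul x)).1,
             fun i : Fin (n + 1) => MSS.gen p m (i : ℕ) • (e (Additive.ofMul x)).2 i) := by
  obtain ⟨M, rfl⟩ := Nat.exists_eq_succ_of_ne_zero hm.ne'
  have hdata := CyclicPower.cycData_unitModule σ hp hn horder ξ hξ hξF hspecial
  obtain ⟨a, d, ι, h1, h2, h3, h4, h5, E, hE⟩ := hdata.exists_decomposition M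
      (fun i : Fin (n + 1) => MSS.NiF p σ i ⧸ (CyclicPower.nextSub F p n σ i).subgroupOf _)
      (fun i => CyclicPower.normClass σ p n i)
      (fun i => CyclicPower.normClass_surjective σ p n i)
      (fun i => CyclicPower.normClass_eq_zero_iff σ (Nat.lt_succ_iff.1 i.2) hgen)
      (J := Additive (Kˣ ⧸ MSS.powSub K (p ^ (M + 1))))
      (CyclicPower.powClass σ (p ^ (M + 1))) (CyclicPower.powClass_surjective σ _)
      (fun x => CyclicPower.powClass_eq_zero_iff σ x)
  refine ⟨a, d, ι, h1, h2, h3, fun i hi => ?_, ?_, E, fun x => ?_⟩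
  · rw [CyclicPower.eKF_eq σ hi.le, ← h4 i hi]
  · rw [CyclicPower.eKF_eq σ le_rfl, h5]
    rfl
  · obtain ⟨x, rfl⟩ := QuotientGroup.mk_surjective x
    have := hE (CyclicPower.tu σ x)
    rwa [CyclicPower.X_smul_tu] at this
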